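/- Every rate pair (R_1,R_2) in the region ℛ_{J,A} is achievable under the strong joint secrecy constraint by adaptive codes; that is, for every (R_1,R_2) in the closure of the convex hull of the union, over all finite sets 𝒱1, 𝒱2 and all input distributions P_{V1,V2,X1,X2} from the class 𝒬, of the regions ℛ_{J,A}(P) := { (R_1,R_2) ∈ ℝ_{≥0}² : R_1 ≤ I(Y_2;V_1|X_2), R_2 ≤ I(Y_1;V_2|X_1), R_1+R_2 ≤ I(Y_2;V_1|X_2) + I(Y_1;V_2|X_1) − I(V_1,V_2;Z) }, there exists a sequence of (L_{1,n}, L_{2,n}, n) adaptive codes with (log L_{i,n})/n → R_i for i = 1,2, P_e^{(n)} → 0, and I(M_1,M_2;Z^n) → 0 as n → ∞. -/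

import Mathlib

open Finset

noncomputable section

variable {V1 V2 X1 X2 Y1 Y2 Z : Type*}
  [Fintype V1] [Fintype V2] [Fintype X1] [Fintype X2] [Fintype Y1] [Fintype Y2] [Fintype Z]

/-- Single-letter joint law of `(V1,V2,X1,X2,Y1,Y2,Z)` induced by an input distribution
from the class `𝒬` and the two-way wiretap channel `W`. -/
def slJoint (PV1 : V1 → ℝ) (PX1 : V1 → X1 → ℝ) (PV2 : V2 → ℝ) (PX2 : V2 → X2 → ℝ)
    (W : X1 → X2 → Y1 × Y2 × Z → ℝ) :
    V1 × V2 × X1 × X2 × Y1 × Y2 × Z → ℝ :=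
  fun p => PV1 p.1 * PX1 p.1 p.2.2.1 * PV2 p.2.1 * PX2 p.2.1 p.2.2.2.1 *
    W p.2.2.1 p.2.2.2.1 (p.2.2.2.2.1, p.2.2.2.2.2.1, p.2.2.2.2.2.2)

/-- Single-letter marginal of `(Y2, V1, X2)`. -/
def pY2V1X2 (PV1 : V1 → ℝ) (PX1 : V1 → X1 → ℝ) (PV2 : V2 → ℝ) (PX2 : V2 → X2 → ℝ)
    (W : X1 → X2 → Y1 × Y2 × Z → ℝ) : Y2 × V1 × X2 → ℝ :=
  fun p => ∑ v2, ∑ x1, ∑ y1, ∑ z,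
    slJoint PV1 PX1 PV2 PX2 W (p.2.1, v2, x1, p.2.2, y1, p.1, z)

/-- Single-letter marginal of `(Y1, V2, X1)`. -/
def pY1V2X1 (PV1 : V1 → ℝ) (PX1 : V1 → X1 → ℝ) (PV2 : V2 → ℝ) (PX2 : V2 → X2 → ℝ)
    (W : X1 → X2 → Y1 × Y2 × Z → ℝ) : Y1 × V2 × X1 → ℝ :=
  fun p => ∑ v1, ∑ x2, ∑ y2, ∑ z,
    slJoint PV1 PX1 PV2 PX2 W (v1, p.2.1, p.2.2, x2, p.1, y2, z)

/-- Single-letter marginal of `((V1, V2), Z)`. -/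
def pV12Z (PV1 : V1 → ℝ) (PX1 : V1 → X1 → ℝ) (PV2 : V2 → ℝ) (PX2 : V2 → X2 → ℝ)
    (W : X1 → X2 → Y1 × Y2 × Z → ℝ) : (V1 × V2) × Z → ℝ :=
  fun p => ∑ x1, ∑ x2, ∑ y1, ∑ y2,
    slJoint PV1 PX1 PV2 PX2 W (p.1.1, p.1.2, x1, x2, y1, y2, p.2)

/-- Single-letter marginal of `(Z, V1)`. -/
def pZV1 (PV1 : V1 → ℝ) (PX1 : V1 → X1 → ℝ) (PV2 : V2 → ℝ) (PX2 : V2 → X2 → ℝ)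
    (W : X1 → X2 → Y1 × Y2 × Z → ℝ) : Z × V1 → ℝ :=
  fun p => ∑ v2, ∑ x1, ∑ x2, ∑ y1, ∑ y2,
    slJoint PV1 PX1 PV2 PX2 W (p.2, v2, x1, x2, y1, y2, p.1)

/-- Single-letter marginal of `(Z, V2)`. -/
def pZV2 (PV1 : V1 → ℝ) (PX1 : V1 → X1 → ℝ) (PV2 : V2 → ℝ) (PX2 : V2 → X2 → ℝ)
    (W : X1 → X2 → Y1 × Y2 × Z → ℝ) : Z × V2 → ℝ :=
  fun p => ∑ v1, ∑ x1, ∑ x2, ∑ y1, ∑ y2,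
    slJoint PV1 PX1 PV2 PX2 W (v1, p.2, x1, x2, y1, y2, p.1)

/-- Shannon mutual information `I(A;B)` of a joint PMF on `A × B` (natural log). -/
def miDist {A B : Type*} [Fintype A] [Fintype B] (P : A × B → ℝ) : ℝ :=
  ∑ a, ∑ b, P (a, b) * Real.log (P (a, b) / ((∑ b', P (a, b')) * (∑ a', P (a', b))))

/-- Shannon conditional mutual information `I(A;B|C)` of a joint PMF on `A × B × C`
(natural log). -/
def cmiDist {A B C : Type*} [Fintype A] [Fintype B] [Fintype C] (P : A × B × C → ℝ) : ℝ :=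
  ∑ a, ∑ b, ∑ c, P (a, b, c) *
    Real.log ((P (a, b, c) * ∑ a', ∑ b', P (a', b', c)) /
      ((∑ b', P (a, b', c)) * (∑ a', P (a', b, c))))

/-- Causality of an adaptive stochastic encoder: the conditional distribution of the
input at time `k` depends on the past inputs and outputs only. -/
def Causal {XI YI : Type*} (N L : ℕ)
    (φ : Fin N → Fin L → (Fin N → XI) → (Fin N → YI) → XI → ℝ) : Prop :=
  ∀ (k : Fin N) (m : Fin L) (x x' : Fin N → XI) (y y' : Fin N → YI),
    (∀ j : Fin N, (j : ℕ) < (k : ℕ) → x j = x' j ∧ y j = y' j) →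
    φ k m x y = φ k m x' y'

/-- Joint law of messages, inputs, outputs and eavesdropper observations induced by an
`(L1, L2, N)` adaptive code (with uniform independent messages) over `N` memoryless uses
of the channel `W`. -/
def PfullA (N L1 L2 : ℕ) (W : X1 → X2 → Y1 × Y2 × Z → ℝ)
    (φ1 : Fin N → Fin L1 → (Fin N → X1) → (Fin N → Y1) → X1 → ℝ)
    (φ2 : Fin N → Fin L2 → (Fin N → X2) → (Fin N → Y2) → X2 → ℝ) :
    (Fin L1 × Fin L2) × (Fin N → X1) × (Fin N → X2) × (Fin N → Y1) × (Fin N → Y2) ×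
      (Fin N → Z) → ℝ :=
  fun p => (1 / ((L1 : ℝ) * (L2 : ℝ))) *
    (∏ k, φ1 k p.1.1 p.2.1 p.2.2.2.1 (p.2.1 k)) *
    (∏ k, φ2 k p.1.2 p.2.2.1 p.2.2.2.2.1 (p.2.2.1 k)) *
    ∏ k, W (p.2.1 k) (p.2.2.1 k) (p.2.2.2.1 k, p.2.2.2.2.1 k, p.2.2.2.2.2 k)

/-- Average decoding error probability of an adaptive code. -/
def PeA (N L1 L2 : ℕ) (W : X1 → X2 → Y1 × Y2 × Z → ℝ)
    (φ1 : Fin N → Fin L1 → (Fin N → X1) → (Fin N → Y1) → X1 → ℝ)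
    (φ2 : Fin N → Fin L2 → (Fin N → X2) → (Fin N → Y2) → X2 → ℝ)
    (ψ1 : Fin L1 → (Fin N → X1) → (Fin N → Y1) → Fin L2)
    (ψ2 : Fin L2 → (Fin N → X2) → (Fin N → Y2) → Fin L1) : ℝ :=
  ∑ m1, ∑ m2, ∑ x1s, ∑ x2s, ∑ y1s, ∑ y2s, ∑ zs,
    PfullA N L1 L2 W φ1 φ2 ((m1, m2), x1s, x2s, y1s, y2s, zs) *
      (if ψ1 m1 x1s y1s ≠ m2 ∨ ψ2 m2 x2s y2s ≠ m1 then 1 else 0)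

/-- Joint leakage `I(M1,M2;Z^N)` of an adaptive code. -/
def leakJointA (N L1 L2 : ℕ) (W : X1 → X2 → Y1 × Y2 × Z → ℝ)
    (φ1 : Fin N → Fin L1 → (Fin N → X1) → (Fin N → Y1) → X1 → ℝ)
    (φ2 : Fin N → Fin L2 → (Fin N → X2) → (Fin N → Y2) → X2 → ℝ) : ℝ :=
  miDist (fun p : (Fin L1 × Fin L2) × (Fin N → Z) =>
    ∑ x1s, ∑ x2s, ∑ y1s, ∑ y2s, PfullA N L1 L2 W φ1 φ2 (p.1, x1s, x2s, y1s, y2s, p.2))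

/-- Individual leakage `I(M1;Z^N)` of an adaptive code. -/
def leakM1A (N L1 L2 : ℕ) (W : X1 → X2 → Y1 × Y2 × Z → ℝ)
    (φ1 : Fin N → Fin L1 → (Fin N → X1) → (Fin N → Y1) → X1 → ℝ)
    (φ2 : Fin N → Fin L2 → (Fin N → X2) → (Fin N → Y2) → X2 → ℝ) : ℝ :=
  miDist (fun p : Fin L1 × (Fin N → Z) =>
    ∑ m2, ∑ x1s, ∑ x2s, ∑ y1s, ∑ y2s,
      PfullA N L1 L2 W φ1 φ2 ((p.1, m2), x1s, x2s, y1s, y2s, p.2))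

/-- Individual leakage `I(M2;Z^N)` of an adaptive code. -/
def leakM2A (N L1 L2 : ℕ) (W : X1 → X2 → Y1 × Y2 × Z → ℝ)
    (φ1 : Fin N → Fin L1 → (Fin N → X1) → (Fin N → Y1) → X1 → ℝ)
    (φ2 : Fin N → Fin L2 → (Fin N → X2) → (Fin N → Y2) → X2 → ℝ) : ℝ :=
  miDist (fun p : Fin L2 × (Fin N → Z) =>
    ∑ m1, ∑ x1s, ∑ x2s, ∑ y1s, ∑ y2s,
      PfullA N L1 L2 W φ1 φ2 ((m1, p.1), x1s, x2s, y1s, y2s, p.2))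

/-- An input distribution from the class `𝒬`: independent auxiliary variables `V1, V2`
over arbitrary finite alphabets together with the prefixing kernels `P_{X1|V1}`,
`P_{X2|V2}`. -/
structure InputDist (X1 X2 : Type*) [Fintype X1] [Fintype X2] where
  V1 : Type
  V2 : Type
  [fV1 : Fintype V1]
  [fV2 : Fintype V2]
  PV1 : V1 → ℝ
  PX1 : V1 → X1 → ℝ
  PV2 : V2 → ℝ
  PX2 : V2 → X2 → ℝ
  PV1_nonneg : ∀ v, 0 ≤ PV1 v
  PV1_sum : ∑ v, PV1 v = 1
  PX1_nonneg : ∀ v x, 0 ≤ PX1 v x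
  PX1_sum : ∀ v, ∑ x, PX1 v x = 1
  PV2_nonneg : ∀ v, 0 ≤ PV2 v
  PV2_sum : ∑ v, PV2 v = 1
  PX2_nonneg : ∀ v x, 0 ≤ PX2 v x
  PX2_sum : ∀ v, ∑ x, PX2 v x = 1

attribute [instance] InputDist.fV1 InputDist.fV2

open scoped BigOperators

set_option linter.unusedSectionVars false

/-! ### Causal kernels -/

/-- `F x y` is the probability that a causal randomized strategy emits the inputs `x` when it is
fed the outputs `y`. -/
def IsCausalKernel {X Y : Type*} [Fintype X] :
    (N : ℕ) → ((Fin N → X) → (Fin N → Y) → ℝ) → Prop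
  | 0, F => ∀ x y, F x y = 1
  | N + 1, F => ∃ F₀ : (Fin N → X) → (Fin N → Y) → ℝ, IsCausalKernel N F₀ ∧
      ∃ φ : (Fin N → X) → (Fin N → Y) → X → ℝ,
        (∀ x y, (∀ a, 0 ≤ φ x y a) ∧ ∑ a, φ x y a = 1) ∧
        ∀ x y, F x y = F₀ (fun i => x i.castSucc) (fun i => y i.castSucc) *
          φ (fun i => x i.castSucc) (fun i => y i.castSucc) (x (Fin.last N))

theorem IsCausalKernel.nonneg {X Y : Type*} [Fintype X] {N : ℕ}
    {F : (Fin N → X) → (Fin N → Y) → ℝ} (hF : IsCausalKernel N F) (x : Fin N → X)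
    (y : Fin N → Y) : 0 ≤ F x y := by
  induction N with
  | zero => rw [hF x y]; exact zero_le_one
  | succ N ih =>
    obtain ⟨F₀, h₀, φ, hφ, hF⟩ := hF
    rw [hF]
    exact mul_nonneg (ih h₀ _ _) ((hφ _ _).1 _)

theorem IsCausalKernel.mixture {X Y ι : Type*} [Fintype X] [Fintype ι] {N : ℕ} (w : ι → ℝ)
    (hw : ∀ u, 0 ≤ w u) (hw1 : ∑ u, w u = 1) (F : ι → (Fin N → X) → (Fin N → Y) → ℝ)
    (hF : ∀ u, IsCausalKernel N (F u)) :
    IsCausalKernel N (fun x y => ∑ u, w u * F u x y) := by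
  induction N with
  | zero =>
    intro x y
    rw [← hw1]
    exact sum_congr rfl fun u _ => by rw [hF u x y, mul_one]
  | succ N ih =>
    choose F₀ h₀ φ hφ hF using hF
    obtain ⟨u₀⟩ : Nonempty ι := by
      by_contra h
      rw [not_nonempty_iff] at h
      simp at hw1
    have hnn : ∀ x y u, 0 ≤ w u * F₀ u x y := fun x y u => mul_nonneg (hw u) ((h₀ u).nonneg x y)
    classical
    refine ⟨fun x y => ∑ u, w u * F₀ u x y, ih F₀ h₀, fun x y a =>
      if ∑ u, w u * F₀ u x y = 0 then φ u₀ x y a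
      else (∑ u, w u * F₀ u x y * φ u x y a) / ∑ u, w u * F₀ u x y, ?_, ?_⟩
    · intro x y
      by_cases h : ∑ u, w u * F₀ u x y = 0
      · simpa only [if_pos h] using hφ u₀ x y
      · simp only [if_neg h]
        refine ⟨fun a => div_nonneg (sum_nonneg fun u _ => mul_nonneg (hnn x y u) ((hφ u x y).1 a))
          (sum_nonneg fun u _ => hnn x y u), ?_⟩
        rw [← sum_div, sum_comm, div_eq_one_iff_eq h]
        exact sum_congr rfl fun u _ => by rw [← mul_sum, (hφ u x y).2, mul_one]
    · intro x y
      simp only [hF]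
      set x' := fun i : Fin N => x i.castSucc
      set y' := fun i : Fin N => y i.castSucc
      by_cases h : ∑ u, w u * F₀ u x' y' = 0
      · rw [h, zero_mul]
        refine sum_eq_zero fun u _ => ?_
        rw [← mul_assoc, (sum_eq_zero_iff_of_nonneg fun u _ => hnn x' y' u).1 h u (mem_univ u),
          zero_mul]
      · rw [if_neg h, mul_div_cancel₀ _ h]
        exact sum_congr rfl fun u _ => by rw [mul_assoc]

theorem IsCausalKernel.append {X Y : Type*} [Fintype X] {N N' : ℕ}
    {F : (Fin N → X) → (Fin N → Y) → ℝ} (hF : IsCausalKernel N F)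
    (H : (Fin N → X) → (Fin N → Y) → (Fin N' → X) → (Fin N' → Y) → ℝ)
    (hH : ∀ x y, IsCausalKernel N' (H x y)) :
    IsCausalKernel (N + N') (fun x y =>
      F (fun i => x (i.castAdd N')) (fun i => y (i.castAdd N')) *
        H (fun i => x (i.castAdd N')) (fun i => y (i.castAdd N'))
          (fun i => x (i.natAdd N)) (fun i => y (i.natAdd N))) := by
  induction N' with
  | zero =>
    have h : (fun x y =>
        F (fun i => x (i.castAdd 0)) (fun i => y (i.castAdd 0)) *
          H (fun i => x (i.castAdd 0)) (fun i => y (i.castAdd 0))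
            (fun i => x (i.natAdd N)) (fun i => y (i.natAdd N))) = F := by
      funext x y
      rw [hH, mul_one]
      rfl
    exact Eq.mpr (congrArg (IsCausalKernel N) h) hF
  | succ N' ih =>
    choose H₀ h₀ φ hφ hH using hH
    refine ⟨_, ih H₀ h₀, fun x y => φ (fun i => x (i.castAdd N')) (fun i => y (i.castAdd N'))
      (fun i => x (i.natAdd N)) (fun i => y (i.natAdd N)), fun x y => hφ _ _ _ _, fun x y => ?_⟩
    beta_reduce
    rw [hH, ← mul_assoc]
    rfl

theorem IsCausalKernel.append_mixture {X Y ι : Type*} [Fintype X] [Fintype ι] {N N' : ℕ}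
    (G : (Fin N → X) → (Fin N → Y) → ι → ℝ) (hG : ∀ x y b, 0 ≤ G x y b)
    (hF : IsCausalKernel N fun x y => ∑ b, G x y b)
    (H : ι → (Fin N' → X) → (Fin N' → Y) → ℝ) (hH : ∀ b, IsCausalKernel N' (H b)) (b₀ : ι) :
    IsCausalKernel (N + N') (fun x y =>
      ∑ b, G (fun i => x (i.castAdd N')) (fun i => y (i.castAdd N')) b *
        H b (fun i => x (i.natAdd N)) (fun i => y (i.natAdd N))) := by
  classical
  let w : (Fin N → X) → (Fin N → Y) → ι → ℝ := fun x y b =>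
    if ∑ b, G x y b = 0 then (if b = b₀ then 1 else 0) else G x y b / ∑ b, G x y b
  have hw : ∀ x y b, (∑ b, G x y b) * w x y b = G x y b := by
    intro x y b
    by_cases h : ∑ b, G x y b = 0
    · rw [h, zero_mul, (sum_eq_zero_iff_of_nonneg fun b _ => hG x y b).1 h b (mem_univ b)]
    · simp only [w, if_neg h]
      rw [mul_div_cancel₀ _ h]
  convert hF.append (fun x y x' y' => ∑ b, w x y b * H b x' y') (fun x y => ?_) using 3 with x y
  · simp only [mul_sum, ← mul_assoc, hw]
  · refine IsCausalKernel.mixture _ (fun b => ?_) ?_ _ hH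
    · simp only [w]
      split_ifs
      · exact zero_le_one
      · exact le_rfl
      · exact div_nonneg (hG _ _ _) (sum_nonneg fun b _ => hG _ _ _)
    · by_cases h : ∑ b, G x y b = 0
      · simp [w, if_pos h]
      · simp only [w, if_neg h]
        rw [← sum_div, div_self h]

theorem IsCausalKernel.prod {X Y : Type*} [Fintype X] {N : ℕ} (f : Fin N → X → ℝ)
    (hf : ∀ k, (∀ a, 0 ≤ f k a) ∧ ∑ a, f k a = 1) :
    IsCausalKernel N (fun x (_ : Fin N → Y) => ∏ k, f k (x k)) := by
  induction N with
  | zero => intro x y; simp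
  | succ N ih =>
    exact ⟨_, ih (fun k => f k.castSucc) fun k => hf _, fun _ _ => f (Fin.last N),
      fun _ _ => hf _, fun x y => Fin.prod_univ_castSucc _⟩

/-- Every causal kernel factors into behavioural encoding rules. -/
theorem IsCausalKernel.exists_encoder {X Y : Type*} [Fintype X] {N : ℕ}
    {F : (Fin N → X) → (Fin N → Y) → ℝ} (hF : IsCausalKernel N F) :
    ∃ φ : Fin N → (Fin N → X) → (Fin N → Y) → X → ℝ,
      (∀ (k : Fin N) (x x' : Fin N → X) (y y' : Fin N → Y),
        (∀ j : Fin N, (j : ℕ) < (k : ℕ) → x j = x' j ∧ y j = y' j) → φ k x y = φ k x' y') ∧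
      (∀ k x y, (∀ a, 0 ≤ φ k x y a) ∧ ∑ a, φ k x y a = 1) ∧
      ∀ x y, F x y = ∏ k, φ k x y (x k) := by
  induction N with
  | zero => exact ⟨fun k => k.elim0, fun k => k.elim0, fun k => k.elim0, fun x y => by
      rw [hF x y]; simp⟩
  | succ N ih =>
    obtain ⟨F₀, h₀, φ, hφ, hF⟩ := hF
    obtain ⟨φ₀, hc, hp, he⟩ := ih h₀
    refine ⟨fun k x y => Fin.lastCases (motive := fun _ => X → ℝ)
      (φ (fun i => x i.castSucc) (fun i => y i.castSucc))
      (fun j => φ₀ j (fun i => x i.castSucc) (fun i => y i.castSucc)) k, ?_, ?_, ?_⟩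
    · intro k x x' y y' h
      induction k using Fin.lastCases with
      | last =>
        simp only [Fin.lastCases_last]
        congr 1 <;> funext i
        · exact (h i.castSucc i.castSucc_lt_last).1
        · exact (h i.castSucc i.castSucc_lt_last).2
      | cast j =>
        simp only [Fin.lastCases_castSucc]
        exact hc j _ _ _ _ fun i hi => h i.castSucc hi
    · intro k x y
      induction k using Fin.lastCases with
      | last => simpa only [Fin.lastCases_last] using hφ _ _
      | cast j => simpa only [Fin.lastCases_castSucc] using hp j _ _
    · intro x y
      rw [hF, he, Fin.prod_univ_castSucc]
      simp only [Fin.lastCases_last, Fin.lastCases_castSucc]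

/-! ### Interaction of two strategies through the channel -/

/-- Inputs and legitimate outputs over `N` channel uses. -/
abbrev Transcript (X1 X2 Y1 Y2 : Type*) (N : ℕ) :=
  (Fin N → X1) × (Fin N → X2) × (Fin N → Y1) × (Fin N → Y2)

/-- Splitting a transcript into its first `N` and its last `N'` channel uses. -/
def Transcript.splitEquiv (X1 X2 Y1 Y2 : Type*) (N N' : ℕ) :
    Transcript X1 X2 Y1 Y2 (N + N') ≃ Transcript X1 X2 Y1 Y2 N × Transcript X1 X2 Y1 Y2 N' where
  toFun p := ((fun i => p.1 (i.castAdd N'), fun i => p.2.1 (i.castAdd N'),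
      fun i => p.2.2.1 (i.castAdd N'), fun i => p.2.2.2 (i.castAdd N')),
    (fun i => p.1 (i.natAdd N), fun i => p.2.1 (i.natAdd N),
      fun i => p.2.2.1 (i.natAdd N), fun i => p.2.2.2 (i.natAdd N)))
  invFun p := (Fin.append p.1.1 p.2.1, Fin.append p.1.2.1 p.2.2.1,
    Fin.append p.1.2.2.1 p.2.2.2.1, Fin.append p.1.2.2.2 p.2.2.2.2)
  left_inv p := by simp only [Fin.append_castAdd_natAdd]
  right_inv p := by simp

/-- The mass of eavesdropper output `z` when strategies with (sub-)kernels `F1` and `F2` interact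
through `N` uses of the channel. -/
def interact (W : X1 → X2 → Y1 × Y2 × Z → ℝ) (N : ℕ) (F1 : (Fin N → X1) → (Fin N → Y1) → ℝ)
    (F2 : (Fin N → X2) → (Fin N → Y2) → ℝ) (z : Fin N → Z) : ℝ :=
  ∑ p : Transcript X1 X2 Y1 Y2 N, F1 p.1 p.2.2.1 * F2 p.2.1 p.2.2.2 *
    ∏ k, W (p.1 k) (p.2.1 k) (p.2.2.1 k, p.2.2.2 k, z k)

section interact

variable {W : X1 → X2 → Y1 × Y2 × Z → ℝ} {N N' : ℕ}

theorem interact_mono (hW0 : ∀ x1 x2 p, 0 ≤ W x1 x2 p)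
    {F1 F1' : (Fin N → X1) → (Fin N → Y1) → ℝ} {F2 F2' : (Fin N → X2) → (Fin N → Y2) → ℝ}
    (h1 : ∀ x y, 0 ≤ F1 x y) (h2 : ∀ x y, 0 ≤ F2 x y) (h1' : ∀ x y, F1 x y ≤ F1' x y)
    (h2' : ∀ x y, F2 x y ≤ F2' x y) (z : Fin N → Z) :
    interact W N F1 F2 z ≤ interact W N F1' F2' z :=
  sum_le_sum fun _ _ => mul_le_mul_of_nonneg_right
    (mul_le_mul (h1' _ _) (h2' _ _) (h2 _ _) ((h1 _ _).trans (h1' _ _)))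
    (prod_nonneg fun _ _ => hW0 _ _ _)

theorem interact_nonneg (hW0 : ∀ x1 x2 p, 0 ≤ W x1 x2 p)
    {F1 : (Fin N → X1) → (Fin N → Y1) → ℝ} {F2 : (Fin N → X2) → (Fin N → Y2) → ℝ}
    (h1 : ∀ x y, 0 ≤ F1 x y) (h2 : ∀ x y, 0 ≤ F2 x y) (z : Fin N → Z) :
    0 ≤ interact W N F1 F2 z :=
  sum_nonneg fun _ _ => mul_nonneg (mul_nonneg (h1 _ _) (h2 _ _))
    (prod_nonneg fun _ _ => hW0 _ _ _)

theorem interact_sum_left {ι : Type*} [Fintype ι] (F1 : ι → (Fin N → X1) → (Fin N → Y1) → ℝ)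
    (F2 : (Fin N → X2) → (Fin N → Y2) → ℝ) (z : Fin N → Z) :
    interact W N (fun x y => ∑ i, F1 i x y) F2 z = ∑ i, interact W N (F1 i) F2 z := by
  simp only [interact, sum_mul]
  exact sum_comm

theorem interact_sum_right {ι : Type*} [Fintype ι] (F1 : (Fin N → X1) → (Fin N → Y1) → ℝ)
    (F2 : ι → (Fin N → X2) → (Fin N → Y2) → ℝ) (z : Fin N → Z) :
    interact W N F1 (fun x y => ∑ i, F2 i x y) z = ∑ i, interact W N F1 (F2 i) z := by
  simp only [interact, sum_mul, mul_sum]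
  exact sum_comm

theorem interact_expect_left {ι : Type*} [Fintype ι] (F1 : ι → (Fin N → X1) → (Fin N → Y1) → ℝ)
    (F2 : (Fin N → X2) → (Fin N → Y2) → ℝ) (z : Fin N → Z) :
    interact W N (fun x y => 𝔼 i, F1 i x y) F2 z = 𝔼 i, interact W N (F1 i) F2 z := by
  simp only [interact, expect_mul]
  exact (expect_sum_comm _ _ _).symm

theorem interact_expect_right {ι : Type*} [Fintype ι] (F1 : (Fin N → X1) → (Fin N → Y1) → ℝ)
    (F2 : ι → (Fin N → X2) → (Fin N → Y2) → ℝ) (z : Fin N → Z) :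
    interact W N F1 (fun x y => 𝔼 i, F2 i x y) z = 𝔼 i, interact W N F1 (F2 i) z := by
  simp only [interact, expect_mul, mul_expect]
  exact (expect_sum_comm _ _ _).symm

theorem interact_append (F1 : (Fin N → X1) → (Fin N → Y1) → ℝ)
    (F2 : (Fin N → X2) → (Fin N → Y2) → ℝ) (H1 : (Fin N' → X1) → (Fin N' → Y1) → ℝ)
    (H2 : (Fin N' → X2) → (Fin N' → Y2) → ℝ) (z : Fin (N + N') → Z) :
    interact W (N + N')
      (fun x y => F1 (fun i => x (i.castAdd N')) (fun i => y (i.castAdd N')) *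
        H1 (fun i => x (i.natAdd N)) (fun i => y (i.natAdd N)))
      (fun x y => F2 (fun i => x (i.castAdd N')) (fun i => y (i.castAdd N')) *
        H2 (fun i => x (i.natAdd N)) (fun i => y (i.natAdd N))) z =
    interact W N F1 F2 (fun i => z (i.castAdd N')) *
      interact W N' H1 H2 (fun i => z (i.natAdd N)) := by
  simp only [interact]
  rw [sum_mul_sum, ← Fintype.sum_prod_type']
  refine Fintype.sum_equiv (Transcript.splitEquiv X1 X2 Y1 Y2 N N') _ _ fun p => ?_
  simp only [Fin.prod_univ_add, Transcript.splitEquiv, Equiv.coe_fn_mk]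
  ring

theorem sum_interact_eq_one (hW1 : ∀ x1 x2, ∑ p, W x1 x2 p = 1)
    {F1 : (Fin N → X1) → (Fin N → Y1) → ℝ} {F2 : (Fin N → X2) → (Fin N → Y2) → ℝ}
    (h1 : IsCausalKernel N F1) (h2 : IsCausalKernel N F2) :
    ∑ z, interact W N F1 F2 z = 1 := by
  induction N with
  | zero =>
    simp only [interact, h1 _ _, h2 _ _]
    simp
  | succ N ih =>
    obtain ⟨F1', h1', φ1, hφ1, hF1⟩ := h1
    obtain ⟨F2', h2', φ2, hφ2, hF2⟩ := h2
    rw [← ih h1' h2']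
    simp only [interact]
    rw [← Fintype.sum_prod_type', ← Fintype.sum_prod_type']
    let e : ((Fin (N + 1) → Z) × Transcript X1 X2 Y1 Y2 (N + 1)) ≃
        ((Fin N → Z) × Transcript X1 X2 Y1 Y2 N) × (X1 × X2 × Y1 × Y2 × Z) :=
      { toFun := fun q => ((fun i => q.1 i.castSucc, fun i => q.2.1 i.castSucc,
            fun i => q.2.2.1 i.castSucc, fun i => q.2.2.2.1 i.castSucc,
            fun i => q.2.2.2.2 i.castSucc),
          (q.2.1 (Fin.last N), q.2.2.1 (Fin.last N), q.2.2.2.1 (Fin.last N),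
            q.2.2.2.2 (Fin.last N), q.1 (Fin.last N)))
        invFun := fun r => (Fin.snoc (α := fun _ => Z) r.1.1 r.2.2.2.2.2,
          Fin.snoc (α := fun _ => X1) r.1.2.1 r.2.1, Fin.snoc (α := fun _ => X2) r.1.2.2.1 r.2.2.1,
          Fin.snoc (α := fun _ => Y1) r.1.2.2.2.1 r.2.2.2.1,
          Fin.snoc (α := fun _ => Y2) r.1.2.2.2.2 r.2.2.2.2.1)
        left_inv := fun q => by
          refine Prod.ext ?_ (Prod.ext ?_ (Prod.ext ?_ (Prod.ext ?_ ?_))) <;>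
            exact Fin.snoc_init_self (α := fun _ => _) _
        right_inv := fun r => by simp }
    rw [Fintype.sum_equiv e _ (fun r =>
      (F1' r.1.2.1 r.1.2.2.2.1 * F2' r.1.2.2.1 r.1.2.2.2.2 *
        ∏ k, W (r.1.2.1 k) (r.1.2.2.1 k) (r.1.2.2.2.1 k, r.1.2.2.2.2 k, r.1.1 k)) *
      (φ1 r.1.2.1 r.1.2.2.2.1 r.2.1 * φ2 r.1.2.2.1 r.1.2.2.2.2 r.2.2.1 *
        W r.2.1 r.2.2.1 r.2.2.2)) ?_]
    · rw [Fintype.sum_prod_type]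
      refine sum_congr rfl fun r _ => ?_
      simp only [← mul_sum]
      have : ∑ i : X1 × X2 × Y1 × Y2 × Z, φ1 r.2.1 r.2.2.2.1 i.1 * φ2 r.2.2.1 r.2.2.2.2 i.2.1 *
          W i.1 i.2.1 i.2.2 = 1 := by
        rw [Fintype.sum_prod_type]
        calc _ = ∑ a, ∑ b, φ1 r.2.1 r.2.2.2.1 a * φ2 r.2.2.1 r.2.2.2.2 b := by
              refine sum_congr rfl fun a _ => ?_
              rw [Fintype.sum_prod_type]
              exact sum_congr rfl fun b _ => by simp only [← mul_sum, hW1, mul_one]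
          _ = 1 := by simp only [← mul_sum, (hφ2 _ _).2, mul_one, (hφ1 _ _).2]
      rw [this, mul_one]
    · intro q
      simp only [hF1, hF2, Fin.prod_univ_castSucc, e, Equiv.coe_fn_mk]
      ring

end interact

/-! ### Secret codes with a shared key, and their sequential composition -/

/-- A randomized strategy over `N` channel uses: given the shared key and the own message,
`G κ a x y b` is the probability of emitting `x` and finally deciding on `b` when fed `y`. -/
def IsStrategy {X Y : Type*} [Fintype X] {N : ℕ} {K A B : Type*} [Fintype B]
    (G : K → A → (Fin N → X) → (Fin N → Y) → B → ℝ) : Prop :=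
  ∀ κ a, (∀ x y b, 0 ≤ G κ a x y b) ∧ IsCausalKernel N fun x y => ∑ b, G κ a x y b

/-- There are strategies over `N` channel uses which consume a uniform shared key from `K`, exchange
messages from `A1` and `A2`, and for which the mass of the event that both decisions are correct and the
eavesdropper sees `z` falls short of a fixed law `q` by at most `δ` in total, on average over the
messages. -/
def Achieves (W : X1 → X2 → Y1 × Y2 × Z → ℝ) (N : ℕ) (K A1 A2 : Type) [Fintype K] [Fintype A1]
    [Fintype A2] (δ : ℝ) : Prop :=
  ∃ (G1 : K → A1 → (Fin N → X1) → (Fin N → Y1) → A2 → ℝ)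
    (G2 : K → A2 → (Fin N → X2) → (Fin N → Y2) → A1 → ℝ) (q : (Fin N → Z) → ℝ),
    IsStrategy G1 ∧ IsStrategy G2 ∧ (∀ z, 0 ≤ q z) ∧ ∑ z, q z = 1 ∧
      𝔼 a : A1 × A2, ∑ z, max (q z - 𝔼 κ, interact W N (fun x y => G1 κ a.1 x y a.2)
        (fun x y => G2 κ a.2 x y a.1) z) 0 ≤ δ

/-- The strategy that draws a local key `j`, uses it as part of the message of `G`, and
then runs `H` with the pair of `j` and the key decided by `G`. -/
def compStrategy {X Y K M M' J J' L L' : Type*} [Fintype J] [Fintype J'] {N N' : ℕ}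
    (G : K → M × J → (Fin N → X) → (Fin N → Y) → M' × J' → ℝ)
    (H : J × J' → L → (Fin N' → X) → (Fin N' → Y) → L' → ℝ) :
    K → M × L → (Fin (N + N') → X) → (Fin (N + N') → Y) → M' × L' → ℝ :=
  fun κ a x y b => 𝔼 j, ∑ j',
    G κ (a.1, j) (fun i => x (i.castAdd N')) (fun i => y (i.castAdd N')) (b.1, j') *
      H (j, j') a.2 (fun i => x (i.natAdd N)) (fun i => y (i.natAdd N)) b.2

theorem IsStrategy.comp {X Y K M M' J J' L L' : Type*} [Fintype X] [Fintype J] [Fintype J']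
    [Fintype M'] [Fintype L'] [Nonempty J] [Nonempty M'] [Nonempty J'] {N N' : ℕ}
    {G : K → M × J → (Fin N → X) → (Fin N → Y) → M' × J' → ℝ}
    {H : J × J' → L → (Fin N' → X) → (Fin N' → Y) → L' → ℝ}
    (hG : IsStrategy G) (hH : IsStrategy H) : IsStrategy (compStrategy G H) := by
  refine fun κ a => ⟨fun x y b => expect_nonneg fun j _ => sum_nonneg fun j' _ =>
    mul_nonneg ((hG _ _).1 _ _ _) ((hH _ _).1 _ _ _), ?_⟩
  have hm := IsCausalKernel.mixture (ι := J) (fun _ => (Fintype.card J : ℝ)⁻¹)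
    (fun _ => by positivity) (by simp) _ fun j =>
      IsCausalKernel.append_mixture (G κ (a.1, j)) (hG _ _).1 (hG κ (a.1, j)).2
        (fun b x y => ∑ l, H (j, b.2) a.2 x y l) (fun b => (hH _ _).2) (Classical.arbitrary _)
  convert hm using 3 with x y
  simp only [compStrategy]
  rw [← expect_sum_comm, Fintype.expect_eq_sum_div_card, div_eq_inv_mul, mul_sum]
  refine sum_congr rfl fun j _ => ?_
  congr 1
  simp only [Fintype.sum_prod_type, mul_sum]
  refine sum_congr rfl fun m _ => sum_comm

theorem deficit_comp_le {M J L S S' : Type*} [Fintype M] [Fintype J] [Fintype L] [Fintype S]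
    [Fintype S'] [Nonempty M] [Nonempty J] [Nonempty L] (q : S → ℝ) (q' : S' → ℝ)
    (hq : ∀ z, 0 ≤ q z) (hq1 : ∑ z, q z = 1) (g : M → J → S → ℝ) (g' : J → L → S' → ℝ)
    (hg' : ∀ j l z, 0 ≤ g' j l z) (hg'1 : ∀ j l, ∑ z, g' j l z ≤ 1) :
    𝔼 p : M × L, ∑ z : S × S',
      max (q z.1 * q' z.2 - 𝔼 j, g p.1 j z.1 * g' j p.2 z.2) 0 ≤
    (𝔼 p : M × J, ∑ z, max (q z - g p.1 p.2 z) 0) +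
      𝔼 l, ∑ z, max (q' z - 𝔼 j, g' j l z) 0 := by
  have key : ∀ p : M × L, ∑ z : S × S',
      max (q z.1 * q' z.2 - 𝔼 j, g p.1 j z.1 * g' j p.2 z.2) 0 ≤
      (𝔼 j, ∑ z, max (q z - g p.1 j z) 0) + ∑ z, max (q' z - 𝔼 j, g' j p.2 z) 0 := by
    intro p
    have h1 : ∀ z : S × S', max (q z.1 * q' z.2 - 𝔼 j, g p.1 j z.1 * g' j p.2 z.2) 0 ≤
        (𝔼 j, max (q z.1 - g p.1 j z.1) 0 * g' j p.2 z.2) +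
          q z.1 * max (q' z.2 - 𝔼 j, g' j p.2 z.2) 0 := by
      intro z
      have e : q z.1 * q' z.2 - 𝔼 j, g p.1 j z.1 * g' j p.2 z.2 =
          (𝔼 j, (q z.1 - g p.1 j z.1) * g' j p.2 z.2) +
            q z.1 * (q' z.2 - 𝔼 j, g' j p.2 z.2) := by
        simp only [sub_mul, expect_sub_distrib, mul_sub, mul_expect]
        ring
      refine max_le ?_ ?_
      · rw [e]
        exact add_le_add (expect_le_expect fun j _ =>
          mul_le_mul_of_nonneg_right (le_max_left _ _) (hg' _ _ _))
          (mul_le_mul_of_nonneg_left (le_max_left _ _) (hq _))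
      · exact add_nonneg (expect_nonneg fun j _ => mul_nonneg (le_max_right _ _) (hg' _ _ _))
          (mul_nonneg (hq _) (le_max_right _ _))
    refine (sum_le_sum fun z _ => h1 z).trans ?_
    rw [sum_add_distrib, Fintype.sum_prod_type, Fintype.sum_prod_type]
    refine add_le_add ?_ ?_
    · calc _ = 𝔼 j, ∑ z, max (q z - g p.1 j z) 0 * ∑ z', g' j p.2 z' := by
            simp only [← expect_sum_comm, ← mul_sum]
        _ ≤ _ := ?_
      refine expect_le_expect fun j _ => sum_le_sum fun z _ => ?_
      exact mul_le_of_le_one_right (le_max_right _ _) (hg'1 _ _)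
    · simp only [← mul_sum, ← sum_mul, hq1, one_mul]
      exact le_rfl
  refine (expect_le_expect fun p _ => key p).trans (le_of_eq ?_)
  rw [expect_add_distrib, ← univ_product_univ, expect_product, expect_product, ← univ_product_univ,
    expect_product]
  simp only [Fintype.expect_const]

theorem Achieves.comp {W : X1 → X2 → Y1 × Y2 × Z → ℝ} (hW0 : ∀ x1 x2 p, 0 ≤ W x1 x2 p)
    (hW1 : ∀ x1 x2, ∑ p, W x1 x2 p = 1) {N N' : ℕ} {K M1 M2 J1 J2 L1 L2 : Type}
    [Fintype K] [Fintype M1] [Fintype M2] [Fintype J1] [Fintype J2] [Fintype L1] [Fintype L2]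
    [Nonempty M1] [Nonempty M2] [Nonempty J1] [Nonempty J2] [Nonempty L1] [Nonempty L2]
    {δ δ' : ℝ} (h : Achieves W N K (M1 × J1) (M2 × J2) δ)
    (h' : Achieves W N' (J1 × J2) L1 L2 δ') :
    Achieves W (N + N') K (M1 × L1) (M2 × L2) (δ + δ') := by
  obtain ⟨G1, G2, q, hG1, hG2, hq, hq1, hδ⟩ := h
  obtain ⟨H1, H2, q', hH1, hH2, hq', hq1', hδ'⟩ := h'
  have hH2' : IsStrategy fun p : J2 × J1 => H2 (p.2, p.1) := fun κ a => hH2 _ _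
  let eZ := Fin.appendEquiv (α := Z) N N'
  refine ⟨compStrategy G1 H1, compStrategy G2 fun p => H2 (p.2, p.1),
    fun z => q (fun i => z (i.castAdd N')) * q' (fun i => z (i.natAdd N)), hG1.comp hH1,
    hG2.comp hH2', fun z => mul_nonneg (hq _) (hq' _), ?_, ?_⟩
  · rw [← eZ.sum_comp, Fintype.sum_prod_type]
    simp [eZ, Fin.appendEquiv, ← mul_sum, hq1', hq1]
  let g : M1 × M2 → J1 × J2 → (Fin N → Z) → ℝ := fun m j z => 𝔼 κ,
    interact W N (fun x y => G1 κ (m.1, j.1) x y (m.2, j.2))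
      (fun x y => G2 κ (m.2, j.2) x y (m.1, j.1)) z
  let g' : J1 × J2 → L1 × L2 → (Fin N' → Z) → ℝ := fun j l z =>
    interact W N' (fun x y => H1 j l.1 x y l.2) (fun x y => H2 j l.2 x y l.1) z
  have hg' : ∀ j l z, 0 ≤ g' j l z := fun j l z =>
    interact_nonneg hW0 (fun _ _ => (hH1 _ _).1 _ _ _) (fun _ _ => (hH2 _ _).1 _ _ _) z
  have hg'1 : ∀ j l, ∑ z, g' j l z ≤ 1 := fun j l => by
    rw [← sum_interact_eq_one hW1 (hH1 j l.1).2 (hH2 j l.2).2]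
    refine sum_le_sum fun z _ => interact_mono hW0 (fun _ _ => (hH1 _ _).1 _ _ _)
      (fun _ _ => (hH2 _ _).1 _ _ _) (fun x y => ?_) (fun x y => ?_) z
    · exact single_le_sum (f := fun b => H1 j l.1 x y b) (fun b _ => (hH1 _ _).1 _ _ _) (mem_univ _)
    · exact single_le_sum (f := fun b => H2 j l.2 x y b) (fun b _ => (hH2 _ _).1 _ _ _) (mem_univ _)
  have hmass : ∀ (m : M1 × M2) (l : L1 × L2) (z : Fin (N + N') → Z),
      𝔼 j, g m j (fun i => z (i.castAdd N')) * g' j l (fun i => z (i.natAdd N)) ≤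
      𝔼 κ, interact W (N + N') (fun x y => compStrategy G1 H1 κ (m.1, l.1) x y (m.2, l.2))
        (fun x y => compStrategy G2 (fun p => H2 (p.2, p.1)) κ (m.2, l.2) x y (m.1, l.1)) z := by
    intro m l z
    simp only [g, expect_mul]
    rw [expect_comm]
    refine expect_le_expect fun κ _ => ?_
    simp only [compStrategy]
    rw [interact_expect_left, ← univ_product_univ, expect_product]
    refine expect_le_expect fun j1 _ => ?_
    simp only [interact_expect_right]
    refine expect_le_expect fun j2 _ => ?_
    have e : interact W (N + N')
        (fun x y => ∑ j', G1 κ (m.1, j1) (fun i => x (i.castAdd N')) (fun i => y (i.castAdd N'))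
            (m.2, j') * H1 (j1, j') l.1 (fun i => x (i.natAdd N)) (fun i => y (i.natAdd N)) l.2)
        (fun x y => ∑ j', G2 κ (m.2, j2) (fun i => x (i.castAdd N')) (fun i => y (i.castAdd N'))
            (m.1, j') * H2 (j', j2) l.2 (fun i => x (i.natAdd N)) (fun i => y (i.natAdd N)) l.1) z =
        ∑ a, ∑ b, interact W N (fun x y => G1 κ (m.1, j1) x y (m.2, a))
          (fun x y => G2 κ (m.2, j2) x y (m.1, b)) (fun i => z (i.castAdd N')) *
        interact W N' (fun x y => H1 (j1, a) l.1 x y l.2)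
          (fun x y => H2 (b, j2) l.2 x y l.1) (fun i => z (i.natAdd N)) := by
      rw [interact_sum_left]
      refine sum_congr rfl fun a _ => ?_
      rw [interact_sum_right]
      exact sum_congr rfl fun b _ => interact_append (fun x y => G1 κ (m.1, j1) x y (m.2, a))
        (fun x y => G2 κ (m.2, j2) x y (m.1, b)) (fun x y => H1 (j1, a) l.1 x y l.2)
        (fun x y => H2 (b, j2) l.2 x y l.1) z
    rw [e]
    have hnn : ∀ (a : J2) (b : J1), 0 ≤
        interact W N (fun x y => G1 κ (m.1, j1) x y (m.2, a))
          (fun x y => G2 κ (m.2, j2) x y (m.1, b)) (fun i => z (i.castAdd N')) *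
        interact W N' (fun x y => H1 (j1, a) l.1 x y l.2)
          (fun x y => H2 (b, j2) l.2 x y l.1) (fun i => z (i.natAdd N)) := fun a b =>
      mul_nonneg (interact_nonneg hW0 (fun _ _ => (hG1 _ _).1 _ _ _)
          (fun _ _ => (hG2 _ _).1 _ _ _) _)
        (interact_nonneg hW0 (fun _ _ => (hH1 _ _).1 _ _ _) (fun _ _ => (hH2 _ _).1 _ _ _) _)
    exact (single_le_sum (f := fun b => _) (fun b _ => hnn j2 b) (mem_univ j1)).trans
      (single_le_sum (f := fun a => ∑ b, _) (fun a _ => sum_nonneg fun b _ => hnn a b)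
        (mem_univ j2))
  have main := deficit_comp_le q q' hq hq1 g g' hg' hg'1
  refine le_trans ?_ (main.trans (add_le_add ?_ hδ'))
  · refine (Fintype.expect_equiv (Equiv.prodProdProdComm M1 L1 M2 L2) _
      (fun p => ∑ z : Fin (N + N') → Z, max (q (fun i => z (i.castAdd N')) *
        q' (fun i => z (i.natAdd N)) - 𝔼 κ, interact W (N + N')
          (fun x y => compStrategy G1 H1 κ (p.1.1, p.2.1) x y (p.1.2, p.2.2))
          (fun x y => compStrategy G2 (fun p => H2 (p.2, p.1)) κ (p.1.2, p.2.2) x y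
            (p.1.1, p.2.1)) z) 0) (fun _ => rfl)).le.trans ?_
    refine expect_le_expect fun p _ => ?_
    rw [← eZ.sum_comp]
    refine sum_le_sum fun z _ => max_le_max_right _ ?_
    refine (sub_le_sub_left (hmass p.1 p.2 _) _).trans (le_of_eq ?_)
    simp [eZ, Fin.appendEquiv]
  · exact (Fintype.expect_equiv (Equiv.prodProdProdComm M1 J1 M2 J2) _ _
      (fun _ => rfl)).symm.le.trans
      hδ

/-! ### From secret codes to adaptive codes -/

/-- Gibbs inequality bounds the information a uniform message has about an output by the average
divergence of the output laws from an arbitrary reference law. -/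
theorem miDist_le_sum_log {M S : Type*} [Fintype M] [Fintype S] [Nonempty M] (P : M → S → ℝ)
    (hP : ∀ m z, 0 ≤ P m z) (hP1 : ∀ m, ∑ z, P m z = 1) (r : S → ℝ) (hr : ∀ z, 0 < r z)
    (hr1 : ∑ z, r z = 1) :
    miDist (fun p : M × S => (Fintype.card M : ℝ)⁻¹ * P p.1 p.2) ≤
      𝔼 m, ∑ z, P m z * Real.log (P m z / r z) := by
  set w : ℝ := (Fintype.card M : ℝ)⁻¹ with hw
  have hw0 : 0 < w := by positivity
  let s : S → ℝ := fun z => ∑ m, w * P m z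
  have hs0 : ∀ z, 0 ≤ s z := fun z => sum_nonneg fun m _ => mul_nonneg hw0.le (hP m z)
  have hs1 : ∑ z, s z = 1 := by
    simp only [s]
    rw [sum_comm]
    simp [← mul_sum, hP1, hw]
  have term : ∀ m z, w * P m z * Real.log (w * P m z / ((∑ z', w * P m z') * s z)) ≤
      w * (P m z * Real.log (P m z / r z)) + w * P m z * (r z / s z - 1) := by
    intro m z
    rcases (hP m z).eq_or_lt with h | h
    · simp [← h]
    have hs : 0 < s z := (mul_pos hw0 h).trans_le
      (single_le_sum (f := fun m => w * P m z) (fun m _ => mul_nonneg hw0.le (hP m z)) (mem_univ m))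
    rw [← mul_sum, hP1, mul_one, mul_div_mul_left _ _ hw0.ne', ← mul_assoc, ← mul_add]
    refine mul_le_mul_of_nonneg_left ?_ (mul_pos hw0 h).le
    rw [Real.log_div h.ne' hs.ne', Real.log_div h.ne' (hr z).ne']
    have := Real.log_le_sub_one_of_pos (div_pos (hr z) hs)
    rw [Real.log_div (hr z).ne' hs.ne'] at this
    linarith
  calc miDist (fun p : M × S => w * P p.1 p.2)
      ≤ ∑ m, ∑ z, (w * (P m z * Real.log (P m z / r z)) + w * P m z * (r z / s z - 1)) :=
        sum_le_sum fun m _ => sum_le_sum fun z _ => term m z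
    _ = (𝔼 m, ∑ z, P m z * Real.log (P m z / r z)) + ∑ z, s z * (r z / s z - 1) := by
        simp only [sum_add_distrib]
        congr 1
        · simp only [← mul_sum]
          rw [Fintype.expect_eq_sum_div_card, hw, div_eq_inv_mul]
        · rw [sum_comm]
          simp only [s, sum_mul]
    _ ≤ _ := by
        have : ∑ z, s z * (r z / s z - 1) ≤ ∑ z, (r z - s z) := by
          refine sum_le_sum fun z _ => ?_
          rcases (hs0 z).eq_or_lt with h | h
          · simp [← h, (hr z).le]
          · rw [mul_sub, mul_div_cancel₀ _ h.ne', mul_one]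
        rw [sum_sub_distrib, hr1, hs1] at this
        linarith

theorem sum_mul_log_le {S : Type*} [Fintype S] [Nonempty S] (P q : S → ℝ) (hP : ∀ z, 0 ≤ P z)
    (hP1 : ∑ z, P z = 1) (hq : ∀ z, 0 ≤ q z) (hq1 : ∑ z, q z = 1) {η : ℝ} (hη : 0 < η)
    (hη1 : η ≤ 1) :
    ∑ z, P z * Real.log (P z / ((1 - η) * q z + η / Fintype.card S)) ≤
      (∑ z, max (q z - P z) 0 + η) * (1 + Real.log (Fintype.card S / η)) := by
  set r : S → ℝ := fun z => (1 - η) * q z + η / Fintype.card S with hr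
  have hc : (1 : ℝ) ≤ Fintype.card S := by exact_mod_cast Fintype.card_pos
  have hr0 : ∀ z, η / Fintype.card S ≤ r z := fun z =>
    le_add_of_nonneg_left (mul_nonneg (by linarith) (hq z))
  have hpos : 0 < η / Fintype.card S := by positivity
  have hr1 : ∑ z, r z = 1 := by
    simp only [hr, sum_add_distrib, ← mul_sum, hq1]
    simp
    field_simp
    ring
  have hB : 0 ≤ Real.log (Fintype.card S / η) :=
    Real.log_nonneg ((one_le_div hη).2 (hη1.trans hc))
  have term : ∀ z, P z * Real.log (P z / r z) ≤
      max (P z - r z) 0 * (1 + Real.log (Fintype.card S / η)) := by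
    intro z
    have hrz : 0 < r z := hpos.trans_le (hr0 z)
    rcases le_or_gt (P z) (r z) with h | h
    · refine le_trans ?_ (mul_nonneg (le_max_right _ _) (by linarith))
      exact mul_nonpos_of_nonneg_of_nonpos (hP z)
        (Real.log_nonpos (div_nonneg (hP z) hrz.le) ((div_le_one hrz).2 h))
    · have hPz : 0 < P z := hrz.trans h
      have h1 : P z ≤ 1 := hP1 ▸ single_le_sum (fun z _ => hP z) (mem_univ z)
      have h2 : Real.log (P z / r z) ≤ Real.log (Fintype.card S / η) := by
        refine Real.log_le_log (div_pos hPz hrz) ?_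
        rw [div_le_div_iff₀ hrz hη]
        have := (div_le_iff₀ (by positivity : (0 : ℝ) < Fintype.card S)).1 (hr0 z)
        nlinarith
      have h3 := Real.log_le_sub_one_of_pos (div_pos hPz hrz)
      have h4 : r z * Real.log (P z / r z) ≤ P z - r z := by
        have := mul_le_mul_of_nonneg_left h3 hrz.le
        rwa [mul_sub, mul_div_cancel₀ _ hrz.ne', mul_one] at this
      rw [max_eq_left (by linarith)]
      nlinarith [mul_le_mul_of_nonneg_left h2 (sub_nonneg.2 h.le)]
  have hswap : ∑ z, max (P z - r z) 0 = ∑ z, max (r z - P z) 0 := by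
    have : ∀ z, max (P z - r z) 0 - max (r z - P z) 0 = P z - r z := fun z => by
      rcases le_total (P z) (r z) with h | h
      · rw [max_eq_right (by linarith), max_eq_left (by linarith)]; ring
      · rw [max_eq_left (by linarith), max_eq_right (by linarith)]; ring
    have h := sum_congr (rfl : (univ : Finset S) = univ) fun z _ => this z
    rw [sum_sub_distrib, sum_sub_distrib, hP1, hr1] at h
    linarith
  have hdef : ∑ z, max (r z - P z) 0 ≤ ∑ z, max (q z - P z) 0 + η := by
    have : ∀ z, max (r z - P z) 0 ≤ max (q z - P z) 0 + η / Fintype.card S := fun z => by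
      refine max_le ?_ (add_nonneg (le_max_right _ _) hpos.le)
      have h1 := le_max_left (q z - P z) 0
      have h2 := le_max_right (q z - P z) 0
      have h3 := mul_nonneg hη.le (hP z)
      have h4 := mul_le_mul_of_nonneg_left h1 (sub_nonneg.2 hη1)
      have h5 := mul_nonneg hη.le h2
      simp only [hr]
      nlinarith
    refine (sum_le_sum fun z _ => this z).trans (le_of_eq ?_)
    rw [sum_add_distrib]
    simp
    field_simp
  refine (sum_le_sum fun z _ => term z).trans ?_
  rw [← sum_mul, hswap]
  exact mul_le_mul_of_nonneg_right hdef (by linarith)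

/-- Deterministic maximum likelihood decisions are at least as good as randomized ones. -/
theorem exists_decoder {T O M : Type*} [Fintype T] [Fintype O] [Fintype M] [Nonempty M]
    [DecidableEq M] (obs : T → O) (w : M → T → ℝ) :
    ∃ ψ : O → M, ∀ G : O → M → ℝ, (∀ o m, 0 ≤ G o m) →
      ∑ m, ∑ t, G (obs t) m * w m t ≤
        ∑ m, ∑ t, (if ψ (obs t) = m then ∑ b, G (obs t) b else 0) * w m t := by
  classical
  let h : M → O → ℝ := fun m o => ∑ t with obs t = o, w m t
  choose ψ hψ using fun o => Finite.exists_max fun m => h m o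
  refine ⟨ψ, fun G hG => ?_⟩
  have e : ∀ F : O → M → ℝ, ∑ m, ∑ t, F (obs t) m * w m t = ∑ o, ∑ m, F o m * h m o := fun F => by
    rw [sum_comm (s := (univ : Finset O))]
    refine sum_congr rfl fun m _ => ?_
    rw [← sum_fiberwise univ obs]
    refine sum_congr rfl fun o _ => ?_
    rw [mul_sum]
    refine sum_congr rfl fun t ht => ?_
    rw [(mem_filter.1 ht).2]
  rw [e G, e fun o m => if ψ o = m then ∑ b, G o b else 0]
  refine sum_le_sum fun o _ => ?_
  simp only [ite_mul, zero_mul, sum_ite_eq, mem_univ, if_true]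
  rw [sum_mul]
  exact sum_le_sum fun m _ => mul_le_mul_of_nonneg_left (hψ o m) (hG o m)

theorem Achieves.mono {W : X1 → X2 → Y1 × Y2 × Z → ℝ} {N : ℕ} {K A1 A2 : Type} [Fintype K]
    [Fintype A1] [Fintype A2] {δ δ' : ℝ} (h : Achieves W N K A1 A2 δ) (hδ : δ ≤ δ') :
    Achieves W N K A1 A2 δ' := by
  obtain ⟨G1, G2, q, hG1, hG2, hq, hq1, h⟩ := h
  exact ⟨G1, G2, q, hG1, hG2, hq, hq1, h.trans hδ⟩

theorem Achieves.congr {W : X1 → X2 → Y1 × Y2 × Z → ℝ} {N : ℕ} {K K' A1 A1' A2 A2' : Type}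
    [Fintype K] [Fintype A1] [Fintype A2] [Fintype K'] [Fintype A1'] [Fintype A2'] {δ : ℝ}
    (h : Achieves W N K A1 A2 δ) (eK : K' ≃ K) (e1 : A1' ≃ A1) (e2 : A2' ≃ A2) :
    Achieves W N K' A1' A2' δ := by
  obtain ⟨G1, G2, q, hG1, hG2, hq, hq1, h⟩ := h
  refine ⟨fun κ a x y b => G1 (eK κ) (e1 a) x y (e2 b),
    fun κ a x y b => G2 (eK κ) (e2 a) x y (e1 b),
    q, fun κ a => ⟨fun x y b => (hG1 _ _).1 _ _ _, ?_⟩,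
    fun κ a => ⟨fun x y b => (hG2 _ _).1 _ _ _, ?_⟩,
    hq, hq1, le_trans (le_of_eq ?_) h⟩
  · convert (hG1 (eK κ) (e1 a)).2 using 3
    exact e2.sum_comp _
  · convert (hG2 (eK κ) (e2 a)).2 using 3
    exact e1.sum_comp _
  · refine Fintype.expect_equiv (e1.prodCongr e2) _ _ fun a => ?_
    refine sum_congr rfl fun z _ => ?_
    congr 2
    exact Fintype.expect_equiv eK _ _ fun κ => rfl

theorem Achieves.trivial {W : X1 → X2 → Y1 × Y2 × Z → ℝ} (hW0 : ∀ x1 x2 p, 0 ≤ W x1 x2 p)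
    (hW1 : ∀ x1 x2, ∑ p, W x1 x2 p = 1) [Nonempty X1] [Nonempty X2] (N : ℕ) (K : Type) [Fintype K]
    [Nonempty K] : Achieves W N K Unit Unit 0 := by
  classical
  obtain ⟨x1⟩ := ‹Nonempty X1›
  obtain ⟨x2⟩ := ‹Nonempty X2›
  have h1 : IsStrategy fun (_ : K) (_ : Unit) (x : Fin N → X1) (_ : Fin N → Y1) (_ : Unit) =>
      ∏ k, if x k = x1 then (1 : ℝ) else 0 := fun κ a =>
    ⟨fun x y b => prod_nonneg fun k _ => by split_ifs <;> norm_num, by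
      simpa using IsCausalKernel.prod (Y := Y1) (fun (_ : Fin N) a => if a = x1 then (1 : ℝ) else 0)
        fun _ => ⟨fun a => by split_ifs <;> norm_num, by simp⟩⟩
  have h2 : IsStrategy fun (_ : K) (_ : Unit) (x : Fin N → X2) (_ : Fin N → Y2) (_ : Unit) =>
      ∏ k, if x k = x2 then (1 : ℝ) else 0 := fun κ a =>
    ⟨fun x y b => prod_nonneg fun k _ => by split_ifs <;> norm_num, by
      simpa using IsCausalKernel.prod (Y := Y2) (fun (_ : Fin N) a => if a = x2 then (1 : ℝ) else 0)
        fun _ => ⟨fun a => by split_ifs <;> norm_num, by simp⟩⟩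
  obtain ⟨κ⟩ := ‹Nonempty K›
  refine ⟨_, _, interact W N (fun x _ => ∏ k, if x k = x1 then (1 : ℝ) else 0)
    (fun x _ => ∏ k, if x k = x2 then (1 : ℝ) else 0), h1, h2, fun z => ?_, ?_, ?_⟩
  · exact interact_nonneg hW0 (fun _ y => (h1 κ ()).1 _ y ()) (fun _ y => (h2 κ ()).1 _ y ()) z
  · have h1' := (h1 κ ()).2
    have h2' := (h2 κ ()).2
    simp only [univ_unique, sum_singleton] at h1' h2'
    exact sum_interact_eq_one hW1 h1' h2'
  · have : Nonempty K := ⟨κ⟩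
    simp

/-! ### Random codebooks -/

/-- The probability of the codebook `c` when its codewords are drawn independently from `p`. -/
def iidWeight {B V : Type*} [Fintype B] (p : V → ℝ) (c : B → V) : ℝ := ∏ b, p (c b)

section iidWeight

variable {B V : Type*} [Fintype B] [DecidableEq B] [Fintype V] {p : V → ℝ}

theorem iidWeight_nonneg (hp : ∀ v, 0 ≤ p v) (c : B → V) : 0 ≤ iidWeight p c :=
  prod_nonneg fun _ _ => hp _

theorem sum_pi_prod {ι : Type*} [Fintype ι] [DecidableEq ι] (f : ι → V → ℝ) :
    ∑ x : ι → V, ∏ i, f i (x i) = ∏ i, ∑ v, f i v := by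
  rw [prod_univ_sum, Fintype.piFinset_univ]

theorem sum_iidWeight (hp1 : ∑ v, p v = 1) : ∑ c : B → V, iidWeight p c = 1 := by
  simp only [iidWeight]
  rw [sum_pi_prod fun _ v => p v]
  simp [hp1]

theorem sum_iidWeight_mul (hp1 : ∑ v, p v = 1) (b : B) (f : V → ℝ) :
    ∑ c : B → V, iidWeight p c * f (c b) = ∑ v, p v * f v := by
  classical
  have h : ∀ c : B → V, iidWeight p c * f (c b) =
      ∏ i, p (c i) * (if i = b then f (c i) else 1) := fun c => by
    rw [prod_mul_distrib, prod_ite_eq' univ b fun i => f (c i)]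
    simp [iidWeight]
  simp only [h]
  rw [sum_pi_prod fun i v => p v * (if i = b then f v else 1), Fintype.prod_eq_single b]
  · simp
  · intro i hi
    simp [hi, hp1]

theorem sum_iidWeight_mul₂ (hp1 : ∑ v, p v = 1) {b b' : B} (hb : b ≠ b' ∨ Subsingleton V)
    (f : V → V → ℝ) :
    ∑ c : B → V, iidWeight p c * f (c b) (c b') = ∑ v, ∑ v', p v * p v' * f v v' := by
  classical
  rcases hb with hb | hb
  · have h : ∀ c : B → V, iidWeight p c * f (c b) (c b') =
        ∑ u, (iidWeight p c * (if c b = u then 1 else 0)) * f u (c b') := fun c => by simp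
    have h' : ∀ u, ∀ c : B → V, (iidWeight p c * (if c b = u then 1 else 0)) * f u (c b') =
        ∏ i, p (c i) * ((if i = b then (if c i = u then 1 else 0) else 1) *
          (if i = b' then f u (c i) else 1)) := fun u c => by
      rw [prod_mul_distrib, prod_mul_distrib, prod_ite_eq' univ b fun i => if c i = u then (1 : ℝ)
        else 0, prod_ite_eq' univ b' fun i => f u (c i)]
      simp [iidWeight]
    simp only [h]
    rw [sum_comm]
    refine sum_congr rfl fun u _ => ?_
    simp only [h']
    rw [sum_pi_prod fun i v => p v * ((if i = b then (if v = u then (1 : ℝ) else 0) else 1) *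
      (if i = b' then f u v else 1)), Fintype.prod_eq_mul b b' hb]
    · simp [hb, hb.symm, mul_sum, mul_assoc]
    · rintro i ⟨h1, h2⟩
      simp [h1, h2, hp1]
  · have : ∀ c : B → V, f (c b) (c b') = f (c b) (c b) := fun c => by
      rw [Subsingleton.elim (c b) (c b')]
    simp only [this]
    rw [sum_iidWeight_mul hp1 b fun v => f v v]
    refine sum_congr rfl fun v _ => ?_
    have : ∀ v', f v v' = f v v := fun v' => by rw [Subsingleton.elim v' v]
    simp only [this]
    rw [← sum_mul, ← mul_sum, hp1, mul_one]

end iidWeight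

theorem exists_le_of_sum_mul_le {C : Type*} [Fintype C] (w f : C → ℝ) (hw : ∀ c, 0 ≤ w c)
    (hw1 : ∑ c, w c = 1) {b : ℝ} (h : ∑ c, w c * f c ≤ b) : ∃ c, f c ≤ b := by
  by_contra! hf
  have h1 : ∑ c, w c * (f c - b) ≤ 0 := by
    simp only [mul_sub, sum_sub_distrib, ← sum_mul, hw1]
    linarith
  have h2 := (sum_eq_zero_iff_of_nonneg fun c _ => mul_nonneg (hw c) (sub_pos.2 (hf c)).le).1
    (h1.antisymm (sum_nonneg fun c _ => mul_nonneg (hw c) (sub_pos.2 (hf c)).le))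
  have : ∑ c, w c = 0 := sum_eq_zero fun c hc =>
    (mul_eq_zero.1 (h2 c hc)).resolve_right (sub_pos.2 (hf c)).ne'
  linarith

/-- Threshold decoding of a random codebook. -/
theorem exists_threshold_decoder {K B V O : Type*} [Fintype K] [Fintype B] [Nonempty B] [Fintype V]
    [Fintype O] [DecidableEq K] [DecidableEq B] (p : V → ℝ) (hp : ∀ v, 0 ≤ p v) (hp1 : ∑ v, p v = 1)
    (R : V → O → ℝ) (hR : ∀ v o, 0 ≤ R v o) (hR1 : ∀ v, ∑ o, R v o = 1) (θ : ℝ) :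
    ∃ d : (K × B → V) → K → O → B, ∀ κ b,
      ∑ c : K × B → V, iidWeight p c * ∑ o, R (c (κ, b)) o * (if d c κ o = b then 0 else 1) ≤
        (∑ v, p v * ∑ o, R v o * (if R v o < Real.exp θ * ∑ v', p v' * R v' o then 1 else 0)) +
          (Fintype.card B - 1) * Real.exp (-θ) := by
  classical
  let S : O → ℝ := fun o => ∑ v, p v * R v o
  let good : V → O → Prop := fun v o => Real.exp θ * S o ≤ R v o
  let d : (K × B → V) → K → O → B := fun c κ o =>
    if h : ∃ b, good (c (κ, b)) o then h.choose else Classical.arbitrary B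
  refine ⟨d, fun κ b => ?_⟩
  have hd : ∀ c o, (if d c κ o = b then (0 : ℝ) else 1) ≤
      (if R (c (κ, b)) o < Real.exp θ * S o then 1 else 0) +
        ∑ b' ∈ univ.erase b, if good (c (κ, b')) o then 1 else 0 := by
    intro c o
    have h0 : ∀ b', (0 : ℝ) ≤ if good (c (κ, b')) o then 1 else 0 := fun b' => by
      split_ifs <;> norm_num
    by_cases hb : R (c (κ, b)) o < Real.exp θ * S o
    · rw [if_pos hb]
      have := sum_nonneg fun b' (_ : b' ∈ univ.erase b) => h0 b'
      split_ifs <;> linarith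
    · have hex : ∃ b, good (c (κ, b)) o := ⟨b, not_lt.1 hb⟩
      have hch : good (c (κ, d c κ o)) o := by
        simp only [d, dif_pos hex]
        exact hex.choose_spec
      rw [if_neg hb, zero_add]
      split_ifs with h
      · exact sum_nonneg fun b' _ => h0 b'
      · refine le_trans ?_ (single_le_sum (fun b' _ => h0 b')
          (mem_erase.2 ⟨h, mem_univ (d c κ o)⟩))
        rw [if_pos hch]
  have hpair : ∀ b' ∈ univ.erase b, ∑ c : K × B → V, iidWeight p c *
      ∑ o, R (c (κ, b)) o * (if good (c (κ, b')) o then 1 else 0) ≤ Real.exp (-θ) := by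
    intro b' hb'
    rw [sum_iidWeight_mul₂ hp1 (b := (κ, b)) (b' := (κ, b')) (Or.inl fun h => (mem_erase.1 hb').1
      (congrArg Prod.snd h).symm) fun v v' => ∑ o, R v o * (if good v' o then 1 else 0)]
    calc _ = ∑ v', p v' * ∑ o, S o * (if good v' o then 1 else 0) := by
          rw [sum_comm]
          refine sum_congr rfl fun v' _ => ?_
          simp only [S, mul_sum, sum_mul]
          rw [sum_comm]
          exact sum_congr rfl fun _ _ => sum_congr rfl fun _ _ => by ring
      _ ≤ ∑ v', p v' * Real.exp (-θ) := by
          refine sum_le_sum fun v' _ => mul_le_mul_of_nonneg_left ?_ (hp v')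
          refine (sum_le_sum (g := fun o => Real.exp (-θ) * R v' o) fun o _ => ?_).trans
            (by rw [← mul_sum, hR1, mul_one])
          split_ifs with h
          · rw [mul_one, Real.exp_neg, inv_mul_eq_div, le_div_iff₀ (Real.exp_pos _), mul_comm]
            exact h
          · rw [mul_zero]
            exact mul_nonneg (Real.exp_pos _).le (hR _ _)
      _ = Real.exp (-θ) := by rw [← sum_mul, hp1, one_mul]
  calc _ ≤ ∑ c : K × B → V, iidWeight p c * ∑ o, R (c (κ, b)) o *
        ((if R (c (κ, b)) o < Real.exp θ * S o then 1 else 0) +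
          ∑ b' ∈ univ.erase b, if good (c (κ, b')) o then 1 else 0) :=
        sum_le_sum fun c _ => mul_le_mul_of_nonneg_left (sum_le_sum fun o _ =>
          mul_le_mul_of_nonneg_left (hd c o) (hR _ _)) (iidWeight_nonneg hp c)
    _ = (∑ c : K × B → V, iidWeight p c * ∑ o, R (c (κ, b)) o *
          (if R (c (κ, b)) o < Real.exp θ * S o then 1 else 0)) +
        ∑ b' ∈ univ.erase b, ∑ c : K × B → V, iidWeight p c *
          ∑ o, R (c (κ, b)) o * (if good (c (κ, b')) o then 1 else 0) := by
        simp only [mul_add, sum_add_distrib]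
        congr 1
        rw [sum_comm]
        refine sum_congr rfl fun c _ => ?_
        rw [← mul_sum, sum_comm]
        simp only [mul_sum]
    _ ≤ _ := by
        rw [sum_iidWeight_mul hp1 (κ, b) fun v => ∑ o, R v o *
          (if R v o < Real.exp θ * S o then 1 else 0)]
        refine add_le_add_right ((sum_le_sum hpair).trans (le_of_eq ?_)) _
        rw [sum_const, card_erase_of_mem (mem_univ b), card_univ, nsmul_eq_mul,
          Nat.cast_sub Fintype.card_pos, Nat.cast_one]

/-- The average of pairwise uncorrelated bounded variables concentrates around the common mean. -/
theorem sum_mul_abs_sub_expect_le {Ω I : Type*} [Fintype Ω] [Fintype I] [Nonempty I] (w : Ω → ℝ)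
    (hw : ∀ c, 0 ≤ w c) (hw1 : ∑ c, w c = 1) (f : I → Ω → ℝ) {m b : ℝ} (hf : ∀ i c, 0 ≤ f i c)
    (hfb : ∀ i c, f i c ≤ b) (hm : ∀ i, ∑ c, w c * f i c = m)
    (hcorr : ∀ i j, i ≠ j → ∑ c, w c * (f i c * f j c) = m ^ 2) :
    ∑ c, w c * |m - 𝔼 i, f i c| ≤ Real.sqrt (b * m / Fintype.card I) := by
  classical
  have hI : (0 : ℝ) < Fintype.card I := by exact_mod_cast Fintype.card_pos
  have hcov : ∀ i j, ∑ c, w c * ((f i c - m) * (f j c - m)) ≤ if i = j then b * m else 0 := by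
    intro i j
    have e : ∑ c, w c * ((f i c - m) * (f j c - m)) = ∑ c, w c * (f i c * f j c) - m ^ 2 := by
      have : ∀ c, w c * ((f i c - m) * (f j c - m)) =
          w c * (f i c * f j c) - m * (w c * f i c) - m * (w c * f j c) + m ^ 2 * w c :=
        fun c => by ring
      simp only [this, sum_add_distrib, sum_sub_distrib, ← mul_sum, hm, hw1]
      ring
    rw [e]
    split_ifs with h
    · subst h
      have : ∑ c, w c * (f i c * f i c) ≤ b * m := by
        rw [← hm i, mul_sum]
        refine sum_le_sum fun c _ => ?_
        have := mul_le_mul_of_nonneg_right (hfb i c) (hf i c)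
        nlinarith [mul_le_mul_of_nonneg_left this (hw c)]
      nlinarith [sq_nonneg m]
    · rw [hcorr i j h, sub_self]
  have hvar : ∑ c, w c * (m - 𝔼 i, f i c) ^ 2 ≤ b * m / Fintype.card I := by
    have e : ∀ c, w c * (m - 𝔼 i, f i c) ^ 2 =
        (Fintype.card I : ℝ)⁻¹ ^ 2 * ∑ i, ∑ j, w c * ((f i c - m) * (f j c - m)) := by
      intro c
      have : m - 𝔼 i, f i c = -((Fintype.card I : ℝ)⁻¹ * ∑ i, (f i c - m)) := by
        rw [Fintype.expect_eq_sum_div_card, sum_sub_distrib]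
        simp
        field_simp
        ring
      rw [this, neg_sq, mul_pow, sq (∑ i, _), sum_mul_sum]
      simp only [mul_sum]
      exact sum_congr rfl fun _ _ => sum_congr rfl fun _ _ => by ring
    simp only [e]
    rw [← mul_sum, sum_comm]
    have : ∑ i, ∑ c, ∑ j, w c * ((f i c - m) * (f j c - m)) ≤ Fintype.card I * (b * m) := by
      calc _ = ∑ i, ∑ j, ∑ c, w c * ((f i c - m) * (f j c - m)) :=
            sum_congr rfl fun i _ => sum_comm
        _ ≤ ∑ i, ∑ j, if i = j then b * m else 0 :=
            sum_le_sum fun i _ => sum_le_sum fun j _ => hcov i j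
        _ = _ := by simp
    calc _ ≤ (Fintype.card I : ℝ)⁻¹ ^ 2 * (Fintype.card I * (b * m)) :=
          mul_le_mul_of_nonneg_left this (by positivity)
      _ = _ := by field_simp
  refine Real.le_sqrt_of_sq_le (le_trans ?_ hvar)
  have cs := sum_mul_sq_le_sq_mul_sq univ (fun c => Real.sqrt (w c))
    (fun c => Real.sqrt (w c) * |m - 𝔼 i, f i c|)
  simp only [← mul_assoc, Real.mul_self_sqrt (hw _), Real.sq_sqrt (hw _), mul_pow, sq_abs, hw1,
    one_mul] at cs
  exact cs

/-- Soft covering: the output law of a random codebook of pairwise independent codewords is not much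
smaller than the ideal output law. -/
theorem sum_mul_deficit_le {Ω I U S : Type*} [Fintype Ω] [Fintype I] [Nonempty I] [Fintype U]
    [Fintype S] (w : Ω → ℝ) (hw : ∀ c, 0 ≤ w c) (hw1 : ∑ c, w c = 1) (u : I → Ω → U) (p : U → ℝ)
    (hp : ∀ v, 0 ≤ p v) (hu : ∀ i (f : U → ℝ), ∑ c, w c * f (u i c) = ∑ v, p v * f v)
    (hu2 : ∀ i j, i ≠ j → ∀ f : U → ℝ, ∑ c, w c * (f (u i c) * f (u j c)) = (∑ v, p v * f v) ^ 2)
    (P : U → S → ℝ) (hP : ∀ v z, 0 ≤ P v z) (hP1 : ∑ z, ∑ v, p v * P v z = 1) (θ : ℝ) :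
    ∑ c, w c * ∑ z, max ((∑ v, p v * P v z) - 𝔼 i, P (u i c) z) 0 ≤
      (∑ v, p v * ∑ z, P v z * (if Real.exp θ * ∑ v', p v' * P v' z < P v z then 1 else 0)) +
        Real.sqrt (Real.exp θ / Fintype.card I) := by
  classical
  set q : S → ℝ := fun z => ∑ v, p v * P v z with hq
  have hq0 : ∀ z, 0 ≤ q z := fun z => sum_nonneg fun v _ => mul_nonneg (hp v) (hP v z)
  let P' : U → S → ℝ := fun v z => if Real.exp θ * q z < P v z then 0 else P v z
  let m : S → ℝ := fun z => ∑ v, p v * P' v z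
  have hP'0 : ∀ v z, 0 ≤ P' v z := fun v z => by
    simp only [P']; split_ifs; exacts [le_rfl, hP v z]
  have hP'P : ∀ v z, P' v z ≤ P v z := fun v z => by
    simp only [P']; split_ifs; exacts [hP v z, le_rfl]
  have hP'b : ∀ v z, P' v z ≤ Real.exp θ * q z := fun v z => by
    simp only [P']; split_ifs with h
    exacts [mul_nonneg (Real.exp_pos _).le (hq0 z), not_lt.1 h]
  have hmq : ∀ z, m z ≤ q z := fun z =>
    sum_le_sum fun v _ => mul_le_mul_of_nonneg_left (hP'P v z) (hp v)
  have hqm : ∀ z, q z - m z =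
      ∑ v, p v * (P v z * (if Real.exp θ * q z < P v z then 1 else 0)) := fun z => by
    simp only [hq, m, P', ← sum_sub_distrib]
    refine sum_congr rfl fun v _ => ?_
    split_ifs <;> ring
  have hz : ∀ z, ∑ c, w c * max (q z - 𝔼 i, P (u i c) z) 0 ≤
      (q z - m z) + q z * Real.sqrt (Real.exp θ / Fintype.card I) := by
    intro z
    have h1 : ∀ c, max (q z - 𝔼 i, P (u i c) z) 0 ≤ (q z - m z) + |m z - 𝔼 i, P' (u i c) z| := by
      intro c
      have h := expect_le_expect (s := univ) fun i (_ : i ∈ univ) => hP'P (u i c) z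
      refine max_le ?_ (add_nonneg (sub_nonneg.2 (hmq z)) (abs_nonneg _))
      linarith [le_abs_self (m z - 𝔼 i, P' (u i c) z)]
    have h2 := sum_mul_abs_sub_expect_le w hw hw1 (fun i c => P' (u i c) z) (m := m z)
      (b := Real.exp θ * q z) (fun i c => hP'0 _ _) (fun i c => hP'b _ _)
      (fun i => hu i fun v => P' v z) (fun i j hij => hu2 i j hij fun v => P' v z)
    calc _ ≤ ∑ c, w c * ((q z - m z) + |m z - 𝔼 i, P' (u i c) z|) :=
          sum_le_sum fun c _ => mul_le_mul_of_nonneg_left (h1 c) (hw c)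
      _ = (q z - m z) + ∑ c, w c * |m z - 𝔼 i, P' (u i c) z| := by
          simp only [mul_add, sum_add_distrib, ← sum_mul, hw1, one_mul]
      _ ≤ _ := by
          refine add_le_add_right (h2.trans ?_) _
          refine Real.sqrt_le_iff.2 ⟨mul_nonneg (hq0 z) (Real.sqrt_nonneg _), ?_⟩
          rw [mul_pow, Real.sq_sqrt (by positivity)]
          calc _ ≤ Real.exp θ * q z * q z / Fintype.card I := by
                gcongr
                · exact mul_nonneg (Real.exp_pos _).le (hq0 z)
                · exact hmq z
            _ = _ := by ring
  calc _ = ∑ z, ∑ c, w c * max (q z - 𝔼 i, P (u i c) z) 0 := by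
        simp only [mul_sum]
        exact sum_comm
    _ ≤ ∑ z, ((q z - m z) + q z * Real.sqrt (Real.exp θ / Fintype.card I)) :=
        sum_le_sum fun z _ => hz z
    _ = _ := by
        rw [sum_add_distrib, ← sum_mul, hP1, one_mul]
        congr 1
        simp only [hqm]
        rw [sum_comm]
        exact sum_congr rfl fun v _ => by rw [mul_sum]

/-- The probability that the information density of `R` under `p` stays below `θ`. -/
def densityTail {V O : Type*} [Fintype V] [Fintype O] (p : V → ℝ) (R : V → O → ℝ) (θ : ℝ) : ℝ :=
  ∑ v, p v * ∑ o, R v o * (if R v o < Real.exp θ * ∑ v', p v' * R v' o then 1 else 0)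

/-- The probability that the information density of `P` under `p` exceeds `θ`. -/
def densityExcess {V O : Type*} [Fintype V] [Fintype O] (p : V → ℝ) (P : V → O → ℝ) (θ : ℝ) : ℝ :=
  ∑ v, p v * ∑ o, P v o * (if Real.exp θ * ∑ v', p v' * P v' o < P v o then 1 else 0)

theorem exists_threshold_decoder_of_interference {K B B' V V' T O : Type*} [Fintype K] [Fintype B]
    [Fintype B'] [Nonempty B] [Fintype V] [Fintype V'] [Fintype T] [Fintype O] [DecidableEq K]
    [DecidableEq B] [DecidableEq B'] {p : V → ℝ} (hp : ∀ v, 0 ≤ p v) (hp1 : ∑ v, p v = 1)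
    {p' : V' → ℝ} (hp1' : ∑ v, p' v = 1) (obs : T → O) (L : V → V' → T → ℝ)
    {R : V → O → ℝ} (hR0 : ∀ v o, 0 ≤ R v o) (hR1 : ∀ v, ∑ o, R v o = 1)
    (hR : ∀ v (f : O → ℝ), ∑ v', p' v' * ∑ t, L v v' t * f (obs t) = ∑ o, R v o * f o) (θ : ℝ) :
    ∃ d : (K × B → V) → K → O → B, ∀ κ b b',
      ∑ c : (K × B → V) × (B' → V'), iidWeight p c.1 * iidWeight p' c.2 *
        ∑ t, L (c.1 (κ, b)) (c.2 b') t * (if d c.1 κ (obs t) = b then 0 else 1) ≤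
      densityTail p R θ + (Fintype.card B - 1) * Real.exp (-θ) := by
  obtain ⟨d, hd⟩ := exists_threshold_decoder (K := K) (B := B) p hp hp1 R hR0 hR1 θ
  refine ⟨d, fun κ b b' => le_trans (le_of_eq ?_) (hd κ b)⟩
  rw [Fintype.sum_prod_type]
  refine sum_congr rfl fun c _ => ?_
  simp only [mul_assoc, ← mul_sum]
  rw [sum_iidWeight_mul hp1' b' fun v' => ∑ t, L (c (κ, b)) v' t *
    (if d c κ (obs t) = b then 0 else 1), hR (c (κ, b)) fun o => if d c κ o = b then 0 else 1]

theorem sum_iidWeight_prod_mul {B B' V V' : Type*} [Fintype B] [Fintype B'] [DecidableEq B]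
    [DecidableEq B'] [Fintype V] [Fintype V'] {p : V → ℝ} {p' : V' → ℝ} (hp1 : ∑ v, p v = 1)
    (hp1' : ∑ v, p' v = 1) (b : B) (b' : B') (f : V × V' → ℝ) :
    ∑ c : (B → V) × (B' → V'), iidWeight p c.1 * iidWeight p' c.2 * f (c.1 b, c.2 b') =
      ∑ v : V × V', p v.1 * p' v.2 * f v := by
  rw [Fintype.sum_prod_type, Fintype.sum_prod_type]
  simp only [mul_assoc, ← mul_sum]
  rw [← sum_iidWeight_mul hp1 b fun v => ∑ v', p' v' * f (v, v')]
  exact sum_congr rfl fun c _ => by rw [sum_iidWeight_mul hp1' b' fun v' => f (c b, v')]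

theorem sum_iidWeight_prod_mul₂ {B B' V V' : Type*} [Fintype B] [Fintype B'] [DecidableEq B]
    [DecidableEq B'] [Fintype V] [Fintype V'] {p : V → ℝ} {p' : V' → ℝ} (hp1 : ∑ v, p v = 1)
    (hp1' : ∑ v, p' v = 1) {i j : B} {i' j' : B'} (h : i ≠ j ∨ Subsingleton V)
    (h' : i' ≠ j' ∨ Subsingleton V') (f : V × V' → ℝ) :
    ∑ c : (B → V) × (B' → V'), iidWeight p c.1 * iidWeight p' c.2 *
        (f (c.1 i, c.2 i') * f (c.1 j, c.2 j')) =
      (∑ v : V × V', p v.1 * p' v.2 * f v) ^ 2 := by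
  rw [Fintype.sum_prod_type]
  simp only [mul_assoc, ← mul_sum]
  have e : ∀ c : B → V, ∑ c' : B' → V', iidWeight p' c' * (f (c i, c' i') * f (c j, c' j')) =
      ∑ v', ∑ w', p' v' * p' w' * (f (c i, v') * f (c j, w')) := fun c =>
    sum_iidWeight_mul₂ hp1' h' fun v' w' => f (c i, v') * f (c j, w')
  simp only [e]
  rw [sum_iidWeight_mul₂ hp1 h fun v w => ∑ v', ∑ w', p' v' * p' w' * (f (v, v') * f (w, w')),
    Fintype.sum_prod_type, sq, sum_mul_sum]
  refine sum_congr rfl fun v _ => sum_congr rfl fun w _ => ?_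
  rw [sum_mul_sum]
  simp only [mul_sum]
  exact sum_congr rfl fun _ _ => sum_congr rfl fun _ _ => by ring

section randomCoding

variable {W : X1 → X2 → Y1 × Y2 × Z → ℝ} {N : ℕ}

/-- The strategy that sends a random one of the codewords for the message through `Q` and decides
with the deterministic decoder `d`. -/
def codebookStrategy {V X Y K A T A' T' : Type*} [Fintype T] [DecidableEq A']
    (Q : V → (Fin N → X) → ℝ) (c : K × (A × T) → V)
    (d : K → (Fin N → X) × (Fin N → Y) → A' × T') :
    K → A → (Fin N → X) → (Fin N → Y) → A' → ℝ :=
  fun κ a x y b => 𝔼 t, Q (c (κ, (a, t))) x * (if (d κ (x, y)).1 = b then 1 else 0)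

theorem isStrategy_codebookStrategy {V X Y K A T A' T' : Type*} [Fintype X] [Fintype T] [Nonempty T]
    [Fintype A'] [DecidableEq A'] {Q : V → (Fin N → X) → ℝ} (hQ0 : ∀ v x, 0 ≤ Q v x)
    (hQ : ∀ v, IsCausalKernel N fun x (_ : Fin N → Y) => Q v x) (c : K × (A × T) → V)
    (d : K → (Fin N → X) × (Fin N → Y) → A' × T') : IsStrategy (codebookStrategy Q c d) := by
  refine fun κ a => ⟨fun x y b => expect_nonneg fun t _ => mul_nonneg (hQ0 _ _) ?_, ?_⟩
  · split_ifs <;> norm_num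
  · have hm := IsCausalKernel.mixture (ι := T) (fun _ => (Fintype.card T : ℝ)⁻¹)
      (fun _ => by positivity) (by simp) _ fun t => hQ (c (κ, (a, t)))
    convert hm using 3 with x y
    simp only [codebookStrategy]
    rw [← expect_sum_comm, Fintype.expect_eq_sum_div_card, div_eq_inv_mul, mul_sum]
    simp

theorem deficit_codebookStrategy_le (hW0 : ∀ x1 x2 p, 0 ≤ W x1 x2 p) {V1 V2 : Type*}
    {K A1 A2 T1 T2 : Type} [Fintype K] [Fintype T1] [Fintype T2] [Nonempty K]
    [DecidableEq A1] [DecidableEq A2] [DecidableEq T1] [DecidableEq T2]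
    {Q1 : V1 → (Fin N → X1) → ℝ} {Q2 : V2 → (Fin N → X2) → ℝ} (hQ1 : ∀ v x, 0 ≤ Q1 v x)
    (hQ2 : ∀ v x, 0 ≤ Q2 v x) (q : (Fin N → Z) → ℝ)
    (c1 : K × (A1 × T1) → V1) (c2 : K × (A2 × T2) → V2)
    (d1 : K → (Fin N → X1) × (Fin N → Y1) → A2 × T2)
    (d2 : K → (Fin N → X2) × (Fin N → Y2) → A1 × T1) (a : A1 × A2) :
    ∑ z, max (q z - 𝔼 κ, interact W N (fun x y => codebookStrategy Q1 c1 d1 κ a.1 x y a.2)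
        (fun x y => codebookStrategy Q2 c2 d2 κ a.2 x y a.1) z) 0 ≤
      (∑ z, max (q z - 𝔼 i : K × T1 × T2, interact W N
        (fun x (_ : Fin N → Y1) => Q1 (c1 (i.1, (a.1, i.2.1))) x)
        (fun x (_ : Fin N → Y2) => Q2 (c2 (i.1, (a.2, i.2.2))) x) z) 0) +
      𝔼 i : K × T1 × T2, ∑ t : Transcript X1 X2 Y1 Y2 N × (Fin N → Z),
        (Q1 (c1 (i.1, (a.1, i.2.1))) t.1.1 * Q2 (c2 (i.1, (a.2, i.2.2))) t.1.2.1 *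
          ∏ k, W (t.1.1 k) (t.1.2.1 k) (t.1.2.2.1 k, t.1.2.2.2 k, t.2 k)) *
        ((if d1 i.1 (t.1.1, t.1.2.2.1) = (a.2, i.2.2) then 0 else 1) +
          (if d2 i.1 (t.1.2.1, t.1.2.2.2) = (a.1, i.2.1) then 0 else 1)) := by
  let L : K × T1 × T2 → Transcript X1 X2 Y1 Y2 N → (Fin N → Z) → ℝ := fun i t z =>
    Q1 (c1 (i.1, (a.1, i.2.1))) t.1 * Q2 (c2 (i.1, (a.2, i.2.2))) t.2.1 *
      ∏ k, W (t.1 k) (t.2.1 k) (t.2.2.1 k, t.2.2.2 k, z k)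
  let e : K × T1 × T2 → Transcript X1 X2 Y1 Y2 N → ℝ := fun i t =>
    (if d1 i.1 (t.1, t.2.2.1) = (a.2, i.2.2) then 0 else 1) +
      (if d2 i.1 (t.2.1, t.2.2.2) = (a.1, i.2.1) then 0 else 1)
  have hL : ∀ i t z, 0 ≤ L i t z := fun i t z =>
    mul_nonneg (mul_nonneg (hQ1 _ _) (hQ2 _ _)) (prod_nonneg fun _ _ => hW0 _ _ _)
  have he : ∀ i t, 0 ≤ e i t := fun i t => by
    simp only [e]; split_ifs <;> norm_num
  have hg : ∀ z, (𝔼 i, ∑ t, L i t z) - 𝔼 i, ∑ t, L i t z * e i t ≤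
      𝔼 κ, interact W N (fun x y => codebookStrategy Q1 c1 d1 κ a.1 x y a.2)
        (fun x y => codebookStrategy Q2 c2 d2 κ a.2 x y a.1) z := by
    intro z
    rw [← expect_sub_distrib, ← univ_product_univ, expect_product]
    refine expect_le_expect fun κ _ => ?_
    simp only [codebookStrategy]
    rw [interact_expect_left, ← univ_product_univ, expect_product]
    refine expect_le_expect fun t1 _ => ?_
    rw [interact_expect_right]
    refine expect_le_expect fun t2 _ => ?_
    rw [← sum_sub_distrib]
    refine sum_le_sum fun t _ => ?_
    have h := hL (κ, t1, t2) t z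
    have : L (κ, t1, t2) t z - L (κ, t1, t2) t z * e (κ, t1, t2) t ≤
        L (κ, t1, t2) t z * ((if (d1 κ (t.1, t.2.2.1)).1 = a.2 then 1 else 0) *
          (if (d2 κ (t.2.1, t.2.2.2)).1 = a.1 then 1 else 0)) := by
      rw [← mul_one_sub]
      refine mul_le_mul_of_nonneg_left ?_ h
      simp only [e]
      by_cases h1 : d1 κ (t.1, t.2.2.1) = (a.2, t2) <;>
        by_cases h2 : d2 κ (t.2.1, t.2.2.2) = (a.1, t1) <;> simp [h1, h2] <;>
        split_ifs <;> norm_num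
    refine this.trans (le_of_eq ?_)
    simp only [L]
    ring
  have hz : ∀ z, max (q z - 𝔼 κ, interact W N
        (fun x y => codebookStrategy Q1 c1 d1 κ a.1 x y a.2)
        (fun x y => codebookStrategy Q2 c2 d2 κ a.2 x y a.1) z) 0 ≤
      max (q z - 𝔼 i, ∑ t, L i t z) 0 + 𝔼 i, ∑ t, L i t z * e i t := fun z => by
    have h0 : 0 ≤ 𝔼 i, ∑ t, L i t z * e i t :=
      expect_nonneg fun i _ => sum_nonneg fun t _ => mul_nonneg (hL i t z) (he i t)
    refine max_le ?_ (add_nonneg (le_max_right _ _) h0)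
    linarith [hg z, le_max_left (q z - 𝔼 i, ∑ t, L i t z) 0]
  refine (sum_le_sum fun z _ => hz z).trans (le_of_eq ?_)
  rw [sum_add_distrib]
  congr 1
  rw [← expect_sum_comm]
  refine expect_congr rfl fun i _ => ?_
  rw [Fintype.sum_prod_type_right]

end randomCoding

/-- Random coding over `N` channel uses: messages and local randomness are encoded by random
codewords, which are decoded by thresholding and whose ambiguity conceals the messages. -/
theorem Achieves.randomCoding {W : X1 → X2 → Y1 × Y2 × Z → ℝ} (hW0 : ∀ x1 x2 p, 0 ≤ W x1 x2 p)
    (hW1 : ∀ x1 x2, ∑ p, W x1 x2 p = 1) {N : ℕ} {p1 : V1 → ℝ} {p2 : V2 → ℝ}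
    (hp1 : ∀ v, 0 ≤ p1 v) (hp2 : ∀ v, 0 ≤ p2 v) (hp1s : ∑ v, p1 v = 1) (hp2s : ∑ v, p2 v = 1)
    {Q1 : V1 → (Fin N → X1) → ℝ} {Q2 : V2 → (Fin N → X2) → ℝ} (hQ1 : ∀ v x, 0 ≤ Q1 v x)
    (hQ2 : ∀ v x, 0 ≤ Q2 v x) (hQ1c : ∀ v, IsCausalKernel N fun x (_ : Fin N → Y1) => Q1 v x)
    (hQ2c : ∀ v, IsCausalKernel N fun x (_ : Fin N → Y2) => Q2 v x)
    {R1 : V2 → (Fin N → X1) × (Fin N → Y1) → ℝ} {R2 : V1 → (Fin N → X2) × (Fin N → Y2) → ℝ}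
    (hR1 : ∀ v2 o, R1 v2 o = ∑ v1, ∑ x2, ∑ y2 : Fin N → Y2, ∑ z : Fin N → Z,
      p1 v1 * (Q1 v1 o.1 * Q2 v2 x2 * ∏ k, W (o.1 k) (x2 k) (o.2 k, y2 k, z k)))
    (hR2 : ∀ v1 o, R2 v1 o = ∑ v2, ∑ x1, ∑ y1 : Fin N → Y1, ∑ z : Fin N → Z,
      p2 v2 * (Q1 v1 x1 * Q2 v2 o.1 * ∏ k, W (x1 k) (o.1 k) (y1 k, o.2 k, z k)))
    {K A1 A2 T1 T2 : Type} [Fintype K] [Fintype A1] [Fintype A2] [Fintype T1] [Fintype T2]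
    [Nonempty K] [Nonempty A1] [Nonempty A2] [Nonempty T1] [Nonempty T2]
    (hT1 : Subsingleton T1 ∨ Subsingleton V2) (hT2 : Subsingleton T2 ∨ Subsingleton V1)
    (θ θ1 θ2 : ℝ) :
    Achieves W N K A1 A2 (densityExcess (fun v : V1 × V2 => p1 v.1 * p2 v.2)
        (fun v => interact W N (fun x _ => Q1 v.1 x) (fun x _ => Q2 v.2 x)) θ +
      Real.sqrt (Real.exp θ / Fintype.card (K × T1 × T2)) +
      (densityTail p2 R1 θ1 + (Fintype.card (A2 × T2) - 1) * Real.exp (-θ1)) +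
      (densityTail p1 R2 θ2 + (Fintype.card (A1 × T1) - 1) * Real.exp (-θ2))) := by
  classical
  let T := Transcript X1 X2 Y1 Y2 N × (Fin N → Z)
  let L : V1 → V2 → T → ℝ := fun v1 v2 t => Q1 v1 t.1.1 * Q2 v2 t.1.2.1 *
    ∏ k, W (t.1.1 k) (t.1.2.1 k) (t.1.2.2.1 k, t.1.2.2.2 k, t.2 k)
  let P : V1 × V2 → (Fin N → Z) → ℝ := fun v =>
    interact W N (fun x _ => Q1 v.1 x) (fun x _ => Q2 v.2 x)
  have hP : ∀ v z, 0 ≤ P v z := fun v z => interact_nonneg hW0 (fun _ _ => hQ1 _ _)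
    (fun _ _ => hQ2 _ _) z
  have hP1 : ∀ v, ∑ z, P v z = 1 := fun v => sum_interact_eq_one hW1 (hQ1c v.1) (hQ2c v.2)
  have hL : ∀ v1 v2 t, 0 ≤ L v1 v2 t := fun v1 v2 t =>
    mul_nonneg (mul_nonneg (hQ1 _ _) (hQ2 _ _)) (prod_nonneg fun _ _ => hW0 _ _ _)
  have hL1 : ∀ v1 v2, ∑ t, L v1 v2 t = 1 := fun v1 v2 => by
    rw [← hP1 (v1, v2), Fintype.sum_prod_type_right]
    rfl
  let obs1 : T → (Fin N → X1) × (Fin N → Y1) := fun t => (t.1.1, t.1.2.2.1)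
  let obs2 : T → (Fin N → X2) × (Fin N → Y2) := fun t => (t.1.2.1, t.1.2.2.2)
  have hm1 : ∀ v2 (f : (Fin N → X1) × (Fin N → Y1) → ℝ),
      ∑ v1, p1 v1 * ∑ t, L v1 v2 t * f (obs1 t) = ∑ o, R1 v2 o * f o := by
    intro v2 f
    simp only [mul_sum, hR1, sum_mul, ← Fintype.sum_prod_type', L, obs1]
    exact Fintype.sum_equiv
      { toFun := fun s => ((s.2.1.1, s.2.1.2.2.1), s.1, s.2.1.2.1, s.2.1.2.2.2, s.2.2)
        invFun := fun s => (s.2.1, (s.1.1, s.2.2.1, s.1.2, s.2.2.2.1), s.2.2.2.2)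
        left_inv := fun _ => rfl
        right_inv := fun _ => rfl } _ _ fun s => by
          simp only [Equiv.coe_fn_mk]; ring
  have hm2 : ∀ v1 (f : (Fin N → X2) × (Fin N → Y2) → ℝ),
      ∑ v2, p2 v2 * ∑ t, L v1 v2 t * f (obs2 t) = ∑ o, R2 v1 o * f o := by
    intro v1 f
    simp only [mul_sum, hR2, sum_mul, ← Fintype.sum_prod_type', L, obs2]
    exact Fintype.sum_equiv
      { toFun := fun s => ((s.2.1.2.1, s.2.1.2.2.2), s.1, s.2.1.1, s.2.1.2.2.1, s.2.2)
        invFun := fun s => (s.2.1, (s.2.2.1, s.1.1, s.2.2.2.1, s.1.2), s.2.2.2.2)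
        left_inv := fun _ => rfl
        right_inv := fun _ => rfl } _ _ fun s => by
          simp only [Equiv.coe_fn_mk]; ring
  have hR10 : ∀ v o, 0 ≤ R1 v o := fun v o => by
    rw [hR1]
    exact sum_nonneg fun _ _ => sum_nonneg fun _ _ => sum_nonneg fun _ _ => sum_nonneg fun _ _ =>
      mul_nonneg (hp1 _) (mul_nonneg (mul_nonneg (hQ1 _ _) (hQ2 _ _))
        (prod_nonneg fun _ _ => hW0 _ _ _))
  have hR20 : ∀ v o, 0 ≤ R2 v o := fun v o => by
    rw [hR2]
    exact sum_nonneg fun _ _ => sum_nonneg fun _ _ => sum_nonneg fun _ _ => sum_nonneg fun _ _ =>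
      mul_nonneg (hp2 _) (mul_nonneg (mul_nonneg (hQ1 _ _) (hQ2 _ _))
        (prod_nonneg fun _ _ => hW0 _ _ _))
  have hR11 : ∀ v, ∑ o, R1 v o = 1 := fun v => by
    simpa [hL1, hp1s] using (hm1 v fun _ => 1).symm
  have hR21 : ∀ v, ∑ o, R2 v o = 1 := fun v => by
    simpa [hL1, hp2s] using (hm2 v fun _ => 1).symm
  obtain ⟨d1, hd1⟩ := exists_threshold_decoder_of_interference (K := K) (B := A2 × T2)
    (B' := K × (A1 × T1)) hp2 hp2s hp1s obs1 (fun v2 v1 => L v1 v2) hR10 hR11 hm1 θ1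
  obtain ⟨d2, hd2⟩ := exists_threshold_decoder_of_interference (K := K) (B := A1 × T1)
    (B' := K × (A2 × T2)) hp1 hp1s hp2s obs2 L hR20 hR21 hm2 θ2
  let C := (K × (A1 × T1) → V1) × (K × (A2 × T2) → V2)
  let w : C → ℝ := fun c => iidWeight p1 c.1 * iidWeight p2 c.2
  have hw : ∀ c, 0 ≤ w c := fun c => mul_nonneg (iidWeight_nonneg hp1 _) (iidWeight_nonneg hp2 _)
  have hw1 : ∑ c, w c = 1 := by
    simp only [w, C]
    rw [Fintype.sum_prod_type]
    simp [← mul_sum, sum_iidWeight hp1s, sum_iidWeight hp2s]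
  let p : V1 × V2 → ℝ := fun v => p1 v.1 * p2 v.2
  have hp : ∀ v, 0 ≤ p v := fun v => mul_nonneg (hp1 _) (hp2 _)
  let q : (Fin N → Z) → ℝ := fun z => ∑ v, p v * P v z
  have hq : ∀ z, 0 ≤ q z := fun z => sum_nonneg fun v _ => mul_nonneg (hp v) (hP v z)
  have hq1 : ∑ z, q z = 1 := by
    simp only [q]
    rw [sum_comm]
    simp only [← mul_sum, hP1, mul_one, p]
    rw [Fintype.sum_prod_type]
    simp [← mul_sum, hp1s, hp2s]
  have hcov : ∀ a : A1 × A2, ∑ c, w c * ∑ z, max (q z - 𝔼 i : K × T1 × T2,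
      P (c.1 (i.1, (a.1, i.2.1)), c.2 (i.1, (a.2, i.2.2))) z) 0 ≤
      densityExcess p P θ + Real.sqrt (Real.exp θ / Fintype.card (K × T1 × T2)) := fun a =>
    sum_mul_deficit_le w hw hw1
      (fun (i : K × T1 × T2) (c : C) => (c.1 (i.1, (a.1, i.2.1)), c.2 (i.1, (a.2, i.2.2)))) p hp
      (fun i f => sum_iidWeight_prod_mul hp1s hp2s _ _ f)
      (fun i j hij f => by
        refine sum_iidWeight_prod_mul₂ hp1s hp2s ?_ ?_ f
        · by_contra! h
          obtain ⟨h1, h2⟩ := h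
          simp only [Prod.mk.injEq, true_and] at h1
          refine hij (Prod.ext h1.1 (Prod.ext h1.2 ?_))
          exact (hT2.resolve_right (not_subsingleton_iff_nontrivial.2 h2)).elim _ _
        · by_contra! h
          obtain ⟨h1, h2⟩ := h
          simp only [Prod.mk.injEq, true_and] at h1
          refine hij (Prod.ext h1.1 (Prod.ext ?_ h1.2))
          exact (hT1.resolve_right (not_subsingleton_iff_nontrivial.2 h2)).elim _ _)
      P hP hq1 θ
  let D : C → A1 × A2 → ℝ := fun c a => ∑ z, max (q z - 𝔼 κ, interact W N
    (fun x y => codebookStrategy Q1 c.1 (d1 c.2) κ a.1 x y a.2)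
    (fun x y => codebookStrategy Q2 c.2 (d2 c.1) κ a.2 x y a.1) z) 0
  have hD : ∀ a, ∑ c, w c * D c a ≤
      densityExcess p P θ + Real.sqrt (Real.exp θ / Fintype.card (K × T1 × T2)) +
      (densityTail p2 R1 θ1 + (Fintype.card (A2 × T2) - 1) * Real.exp (-θ1)) +
      (densityTail p1 R2 θ2 + (Fintype.card (A1 × T1) - 1) * Real.exp (-θ2)) := by
    intro a
    have hi : ∀ i : K × T1 × T2, ∑ c, w c * ∑ t,
        L (c.1 (i.1, (a.1, i.2.1))) (c.2 (i.1, (a.2, i.2.2))) t *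
        ((if d1 c.2 i.1 (obs1 t) = (a.2, i.2.2) then 0 else 1) +
          (if d2 c.1 i.1 (obs2 t) = (a.1, i.2.1) then 0 else 1)) ≤
        (densityTail p2 R1 θ1 + (Fintype.card (A2 × T2) - 1) * Real.exp (-θ1)) +
        (densityTail p1 R2 θ2 + (Fintype.card (A1 × T1) - 1) * Real.exp (-θ2)) := by
      intro i
      simp only [mul_add, sum_add_distrib]
      refine add_le_add (le_trans (le_of_eq ?_) (hd1 i.1 (a.2, i.2.2) (i.1, (a.1, i.2.1))))
        (hd2 i.1 (a.1, i.2.1) (i.1, (a.2, i.2.2)))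
      refine Fintype.sum_equiv (Equiv.prodComm _ _) _ _ fun c => ?_
      simp only [w, Equiv.prodComm_apply, Prod.fst_swap, Prod.snd_swap]
      rw [mul_comm (iidWeight p1 c.1)]
      congr
    calc _ ≤ ∑ c, w c * ((∑ z, max (q z - 𝔼 i : K × T1 × T2,
            P (c.1 (i.1, (a.1, i.2.1)), c.2 (i.1, (a.2, i.2.2))) z) 0) + 𝔼 i : K × T1 × T2, ∑ t,
          L (c.1 (i.1, (a.1, i.2.1))) (c.2 (i.1, (a.2, i.2.2))) t *
          ((if d1 c.2 i.1 (obs1 t) = (a.2, i.2.2) then 0 else 1) +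
            (if d2 c.1 i.1 (obs2 t) = (a.1, i.2.1) then 0 else 1))) :=
          sum_le_sum fun c _ => mul_le_mul_of_nonneg_left
            (deficit_codebookStrategy_le hW0 hQ1 hQ2 q c.1 c.2 (d1 c.2) (d2 c.1) a) (hw c)
      _ = (∑ c, w c * ∑ z, max (q z - 𝔼 i : K × T1 × T2,
            P (c.1 (i.1, (a.1, i.2.1)), c.2 (i.1, (a.2, i.2.2))) z) 0) +
          𝔼 i : K × T1 × T2, ∑ c, w c * ∑ t,
            L (c.1 (i.1, (a.1, i.2.1))) (c.2 (i.1, (a.2, i.2.2))) t *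
            ((if d1 c.2 i.1 (obs1 t) = (a.2, i.2.2) then 0 else 1) +
              (if d2 c.1 i.1 (obs2 t) = (a.1, i.2.1) then 0 else 1)) := by
          simp only [mul_add (w _), sum_add_distrib (s := (univ : Finset C))]
          congr 1
          rw [expect_sum_comm]
          exact sum_congr rfl fun c _ => mul_expect _ _ _
      _ ≤ _ := by
          rw [add_assoc (_ + _)]
          refine add_le_add (hcov a) ((expect_le_expect fun i _ => hi i).trans (le_of_eq ?_))
          rw [Fintype.expect_const]
  obtain ⟨c, hc⟩ := exists_le_of_sum_mul_le w (fun c => 𝔼 a, D c a) hw hw1 (b :=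
      densityExcess p P θ + Real.sqrt (Real.exp θ / Fintype.card (K × T1 × T2)) +
      (densityTail p2 R1 θ1 + (Fintype.card (A2 × T2) - 1) * Real.exp (-θ1)) +
      (densityTail p1 R2 θ2 + (Fintype.card (A1 × T1) - 1) * Real.exp (-θ2))) (by
    simp only [mul_expect]
    rw [← expect_sum_comm]
    refine (expect_le_expect fun a _ => hD a).trans (le_of_eq ?_)
    rw [Fintype.expect_const])
  exact ⟨_, _, q, isStrategy_codebookStrategy hQ1 hQ1c c.1 (d1 c.2),
    isStrategy_codebookStrategy hQ2 hQ2c c.2 (d2 c.1), hq, hq1, hc⟩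

/-- Gibbs inequality for nonnegative weights. -/
theorem sum_sub_sum_le_sum_mul_log_div {S : Type*} [Fintype S] {P Q : S → ℝ} (hP : ∀ s, 0 ≤ P s)
    (hQ : ∀ s, 0 ≤ Q s) (hPQ : ∀ s, Q s = 0 → P s = 0) :
    ∑ s, P s - ∑ s, Q s ≤ ∑ s, P s * Real.log (P s / Q s) := by
  rw [← sum_sub_distrib]
  refine sum_le_sum fun s _ => ?_
  rcases (hP s).eq_or_lt with h | h
  · simp [← h, hQ s]
  have hq : 0 < Q s := (hQ s).lt_of_ne fun h0 => h.ne' (hPQ s h0.symm)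
  have h1 := Real.one_sub_inv_le_log_of_pos (div_pos h hq)
  calc P s - Q s = P s * (1 - (P s / Q s)⁻¹) := by field_simp
    _ ≤ _ := mul_le_mul_of_nonneg_left h1 h.le

theorem miDist_nonneg {A B : Type*} [Fintype A] [Fintype B] {P : A × B → ℝ} (hP : ∀ p, 0 ≤ P p)
    (hP1 : ∑ p, P p = 1) : 0 ≤ miDist P := by
  have h := sum_sub_sum_le_sum_mul_log_div (P := P)
    (Q := fun p => (∑ b, P (p.1, b)) * ∑ a, P (a, p.2)) hP
    (fun p => mul_nonneg (sum_nonneg fun _ _ => hP _) (sum_nonneg fun _ _ => hP _)) fun p hp => by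
      rcases mul_eq_zero.1 hp with h | h
      · exact (sum_eq_zero_iff_of_nonneg fun _ _ => hP _).1 h p.2 (mem_univ _)
      · exact (sum_eq_zero_iff_of_nonneg fun _ _ => hP _).1 h p.1 (mem_univ _)
  have e : ∑ p : A × B, (∑ b, P (p.1, b)) * ∑ a, P (a, p.2) = 1 := by
    rw [Fintype.sum_prod_type] at hP1 ⊢
    simp only [← mul_sum, ← sum_mul]
    rw [sum_comm (γ := B), hP1, one_mul]
  rw [hP1, e, sub_self, Fintype.sum_prod_type] at h
  exact h

/-- The mutual information between an input with law `p` and the output of the kernel `R`. -/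
def kernelInfo {V O : Type*} [Fintype V] [Fintype O] (p : V → ℝ) (R : V → O → ℝ) : ℝ :=
  ∑ v, p v * ∑ o, R v o * Real.log (R v o / ∑ v', p v' * R v' o)

theorem miDist_eq_kernelInfo {V O : Type*} [Fintype V] [Fintype O] {p : V → ℝ} {R : V → O → ℝ}
    (hR : ∀ v, ∑ o, R v o = 1) : miDist (fun a : V × O => p a.1 * R a.1 a.2) = kernelInfo p R := by
  refine sum_congr rfl fun v _ => ?_
  rw [mul_sum]
  refine sum_congr rfl fun o _ => ?_
  simp only [← mul_sum, hR, mul_one]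
  by_cases h : p v = 0
  · simp [h]
  rw [mul_div_mul_left _ _ h, mul_assoc]

theorem cmiDist_eq_kernelInfo {V X Y : Type*} [Fintype V] [Fintype X] [Fintype Y] {p : V → ℝ}
    {R : V → X × Y → ℝ} {q : X → ℝ} (hp1 : ∑ v, p v = 1) (hR0 : ∀ v o, 0 ≤ R v o)
    (hR : ∀ v x, ∑ y, R v (x, y) = q x) :
    cmiDist (fun a : Y × V × X => p a.2.1 * R a.2.1 (a.2.2, a.1)) = kernelInfo p R := by
  unfold cmiDist kernelInfo
  rw [sum_comm]
  refine sum_congr rfl fun v _ => ?_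
  rw [mul_sum, Fintype.sum_prod_type, sum_comm]
  refine sum_congr rfl fun x _ => sum_congr rfl fun y _ => ?_
  have h1 : ∑ a', ∑ b', p b' * R b' (x, a') = q x := by
    rw [sum_comm]
    simp [← mul_sum, hR, ← sum_mul, hp1]
  simp only [h1, ← mul_sum, hR]
  by_cases h : p v = 0
  · simp [h]
  by_cases hq : q x = 0
  · have : R v (x, y) = 0 :=
      (sum_eq_zero_iff_of_nonneg fun _ _ => hR0 _ _).1 ((hR v x).trans hq) y (mem_univ _)
    simp [this]
  rw [mul_assoc]
  congr 3
  rw [show p v * R v (x, y) * q x = R v (x, y) * (p v * q x) by ring,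
    mul_div_mul_right _ _ (mul_ne_zero h hq)]

theorem kernelInfo_marginal_add_le {p1 : V1 → ℝ} {p2 : V2 → ℝ} {S : V1 × V2 → Z → ℝ}
    (hp1 : ∀ v, 0 ≤ p1 v) (hp2 : ∀ v, 0 ≤ p2 v) (hp1s : ∑ v, p1 v = 1) (hp2s : ∑ v, p2 v = 1)
    (hS0 : ∀ v z, 0 ≤ S v z) (hS1 : ∀ v, ∑ z, S v z = 1) :
    kernelInfo p1 (fun v1 z => ∑ v2, p2 v2 * S (v1, v2) z) +
      kernelInfo p2 (fun v2 z => ∑ v1, p1 v1 * S (v1, v2) z) ≤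
    kernelInfo (fun v : V1 × V2 => p1 v.1 * p2 v.2) S := by
  set S1 : V1 → Z → ℝ := fun v1 z => ∑ v2, p2 v2 * S (v1, v2) z
  set S2 : V2 → Z → ℝ := fun v2 z => ∑ v1, p1 v1 * S (v1, v2) z
  set m : Z → ℝ := fun z => ∑ v : V1 × V2, p1 v.1 * p2 v.2 * S v z
  have hm1 : ∀ z, ∑ v, p1 v * S1 v z = m z := fun z => by
    simp only [S1, m, mul_sum, Fintype.sum_prod_type, mul_assoc]
  have hm2 : ∀ z, ∑ v, p2 v * S2 v z = m z := fun z => by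
    simp only [S2, m, mul_sum, Fintype.sum_prod_type]
    rw [sum_comm]
    exact sum_congr rfl fun _ _ => sum_congr rfl fun _ _ => by ring
  have hS10 : ∀ v z, 0 ≤ S1 v z := fun v z => sum_nonneg fun _ _ => mul_nonneg (hp2 _) (hS0 _ _)
  have hS20 : ∀ v z, 0 ≤ S2 v z := fun v z => sum_nonneg fun _ _ => mul_nonneg (hp1 _) (hS0 _ _)
  have hm0 : ∀ z, 0 ≤ m z := fun z => sum_nonneg fun _ _ =>
    mul_nonneg (mul_nonneg (hp1 _) (hp2 _)) (hS0 _ _)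
  have hpos1 : ∀ v1 v2 z, 0 < p2 v2 → 0 < S (v1, v2) z → 0 < S1 v1 z := fun v1 v2 z h1 h2 =>
    sum_pos' (fun _ _ => mul_nonneg (hp2 _) (hS0 _ _)) ⟨v2, mem_univ _, mul_pos h1 h2⟩
  have hpos2 : ∀ v1 v2 z, 0 < p1 v1 → 0 < S (v1, v2) z → 0 < S2 v2 z := fun v1 v2 z h1 h2 =>
    sum_pos' (fun _ _ => mul_nonneg (hp1 _) (hS0 _ _)) ⟨v1, mem_univ _, mul_pos h1 h2⟩
  have hposm : ∀ v1 v2 z, 0 < p1 v1 → 0 < p2 v2 → 0 < S (v1, v2) z → 0 < m z :=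
    fun v1 v2 z h1 h2 h3 => sum_pos' (fun _ _ => mul_nonneg (mul_nonneg (hp1 _) (hp2 _)) (hS0 _ _))
      ⟨(v1, v2), mem_univ _, mul_pos (mul_pos h1 h2) h3⟩
  have e1 : kernelInfo p1 S1 = ∑ s : (V1 × V2) × Z, p1 s.1.1 * p2 s.1.2 * S s.1 s.2 *
      Real.log (S1 s.1.1 s.2 / m s.2) := by
    simp only [kernelInfo, hm1, Fintype.sum_prod_type]
    refine sum_congr rfl fun v1 _ => ?_
    rw [sum_comm, mul_sum]
    refine sum_congr rfl fun z _ => ?_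
    rw [← sum_mul, ← mul_assoc]
    congr 1
    simp only [S1, mul_sum, mul_assoc]
  have e2 : kernelInfo p2 S2 = ∑ s : (V1 × V2) × Z, p1 s.1.1 * p2 s.1.2 * S s.1 s.2 *
      Real.log (S2 s.1.2 s.2 / m s.2) := by
    simp only [kernelInfo, hm2, Fintype.sum_prod_type]
    rw [sum_comm]
    refine sum_congr rfl fun v2 _ => ?_
    rw [sum_comm, mul_sum]
    refine sum_congr rfl fun z _ => ?_
    rw [← sum_mul, ← mul_assoc]
    congr 1
    simp only [S2, mul_sum]
    exact sum_congr rfl fun _ _ => by ring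
  have e12 : kernelInfo (fun v : V1 × V2 => p1 v.1 * p2 v.2) S =
      ∑ s : (V1 × V2) × Z, p1 s.1.1 * p2 s.1.2 * S s.1 s.2 * Real.log (S s.1 s.2 / m s.2) := by
    rw [Fintype.sum_prod_type]
    exact sum_congr rfl fun v _ => by
      rw [mul_sum]
      exact sum_congr rfl fun z _ => (mul_assoc _ _ _).symm
  let P : (V1 × V2) × Z → ℝ := fun s => p1 s.1.1 * p2 s.1.2 * S s.1 s.2
  let Q : (V1 × V2) × Z → ℝ := fun s =>
    (p1 s.1.1 * S1 s.1.1 s.2) * (p2 s.1.2 * S2 s.1.2 s.2) / m s.2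
  have hP : ∀ s, 0 ≤ P s := fun s => mul_nonneg (mul_nonneg (hp1 _) (hp2 _)) (hS0 _ _)
  have hPpos : ∀ s, 0 < P s → 0 < p1 s.1.1 ∧ 0 < p2 s.1.2 ∧ 0 < S s.1 s.2 := fun s h => by
    refine ⟨(hp1 _).lt_of_ne fun h0 => ?_, (hp2 _).lt_of_ne fun h0 => ?_,
      (hS0 _ _).lt_of_ne fun h0 => ?_⟩ <;> simp [P, ← h0] at h
  have hg := sum_sub_sum_le_sum_mul_log_div (P := P) (Q := Q) hP
    (fun s => div_nonneg (mul_nonneg (mul_nonneg (hp1 _) (hS10 _ _))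
      (mul_nonneg (hp2 _) (hS20 _ _))) (hm0 _)) fun s hs => by
      by_contra h
      obtain ⟨h1, h2, h3⟩ := hPpos s ((hP s).lt_of_ne (Ne.symm h))
      have := hpos1 s.1.1 s.1.2 s.2 h2 h3
      have := hpos2 s.1.1 s.1.2 s.2 h1 h3
      have := hposm s.1.1 s.1.2 s.2 h1 h2 h3
      exact (by positivity : Q s ≠ 0) hs
  have hPs : ∑ s, P s = 1 := by
    simp only [P]
    rw [Fintype.sum_prod_type]
    simp only [← mul_sum, hS1, mul_one]
    rw [Fintype.sum_prod_type]
    simp [← mul_sum, hp1s, hp2s]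
  have hQs : ∑ s, Q s = 1 := by
    have : ∑ z, m z = 1 := by
      rw [← hPs, Fintype.sum_prod_type_right]
    rw [Fintype.sum_prod_type_right, ← this]
    refine sum_congr rfl fun z _ => ?_
    simp only [Q]
    rw [← sum_div, Fintype.sum_prod_type]
    dsimp only
    rw [← sum_mul_sum, hm1, hm2, mul_self_div_self]
  rw [hPs, hQs, sub_self] at hg
  rw [e1, e2, e12, ← sum_add_distrib, ← sub_nonneg, ← sum_sub_distrib]
  refine hg.trans (le_of_eq (sum_congr rfl fun s _ => ?_))
  rcases (hP s).eq_or_lt with h | h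
  · have h' : p1 s.1.1 * p2 s.1.2 * S s.1 s.2 = 0 := h.symm
    simp [P, h']
  obtain ⟨h1, h2, h3⟩ := hPpos s h
  have k1 := hpos1 s.1.1 s.1.2 s.2 h2 h3
  have k2 := hpos2 s.1.1 s.1.2 s.2 h1 h3
  have k3 := hposm s.1.1 s.1.2 s.2 h1 h2 h3
  rw [← mul_add, ← mul_sub, ← Real.log_mul (by positivity) (by positivity),
    ← Real.log_div (by positivity) (by positivity)]
  simp only [P, Q]
  congr 2
  field_simp

/-- Chernoff bound for sums of independent copies of a finitely valued random variable. -/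
theorem exists_sum_prod_mul_indicator_le {Ω : Type*} [Fintype Ω] {J : Ω → ℝ} (hJ : ∀ ω, 0 ≤ J ω)
    (hJ1 : ∑ ω, J ω = 1) (f : Ω → ℝ) {ε : ℝ} (hε : 0 < ε) :
    ∃ γ : ℝ, 0 < γ ∧ ∀ n : ℕ, ∑ ω : Fin n → Ω, (∏ k, J (ω k)) *
      (if n * (∑ ω, J ω * f ω + ε) ≤ ∑ k, f (ω k) then 1 else 0) ≤ Real.exp (-(n * γ)) := by
  set μ := ∑ ω, J ω * f ω with hμ
  set g : Ω → ℝ := fun ω => f ω - (μ + ε) with hg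
  obtain ⟨C, hC1, hC⟩ : ∃ C : ℝ, 1 ≤ C ∧ ∀ ω, |g ω| ≤ C :=
    ⟨1 + ∑ ω, |g ω|, by simpa using sum_nonneg fun _ _ => abs_nonneg _, fun ω => by
      have := single_le_sum (f := fun ω => |g ω|) (fun _ _ => abs_nonneg _) (mem_univ ω)
      linarith⟩
  have hC0 : 0 < C := by linarith
  set s : ℝ := min (1 / C) (ε / (2 * C ^ 2))
  have hs0 : 0 < s := by positivity
  have hs1 : s * C ≤ 1 := by
    calc s * C ≤ 1 / C * C := mul_le_mul_of_nonneg_right (min_le_left _ _) hC0.le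
      _ = 1 := by field_simp
  have hs2 : s * C ^ 2 ≤ ε / 2 := by
    calc s * C ^ 2 ≤ ε / (2 * C ^ 2) * C ^ 2 :=
          mul_le_mul_of_nonneg_right (min_le_right _ _) (by positivity)
      _ = ε / 2 := by field_simp
  set φ := ∑ ω, J ω * Real.exp (s * g ω)
  have hmean : ∑ ω, J ω * g ω = -ε := by
    simp only [hg, mul_sub, sum_sub_distrib, ← sum_mul, hJ1, ← hμ]
    ring
  have hφ1 : φ < 1 := by
    have h : ∀ ω, J ω * Real.exp (s * g ω) ≤ J ω + s * (J ω * g ω) + J ω * (s * (s * C ^ 2)) := by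
      intro ω
      have ha : |s * g ω| ≤ s * C := by
        rw [abs_mul, abs_of_pos hs0]
        exact mul_le_mul_of_nonneg_left (hC ω) hs0.le
      have hb := (abs_le.1 (Real.abs_exp_sub_one_sub_id_le (ha.trans hs1))).2
      have hc : (s * g ω) ^ 2 ≤ (s * C) ^ 2 := sq_le_sq' (by linarith [abs_le.1 ha]) (abs_le.1 ha).2
      nlinarith [hJ ω, mul_le_mul_of_nonneg_left (hb.trans hc) (hJ ω)]
    calc φ ≤ ∑ ω, (J ω + s * (J ω * g ω) + J ω * (s * (s * C ^ 2))) := sum_le_sum fun ω _ => h ω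
      _ = 1 - s * ε + s * (s * C ^ 2) := by
        rw [sum_add_distrib, sum_add_distrib, ← mul_sum, ← sum_mul, hmean, hJ1]
        ring
      _ ≤ 1 - s * ε + s * (ε / 2) := by
        have := mul_le_mul_of_nonneg_left hs2 hs0.le
        linarith
      _ < 1 := by nlinarith
  have hφ0 : 0 < φ := by
    obtain ⟨ω, -, hω⟩ : ∃ ω ∈ univ, J ω ≠ 0 := by
      by_contra! h
      rw [sum_eq_zero h] at hJ1
      exact zero_ne_one hJ1
    exact sum_pos' (fun ω _ => mul_nonneg (hJ ω) (Real.exp_pos _).le)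
      ⟨ω, mem_univ _, mul_pos ((hJ ω).lt_of_ne (Ne.symm hω)) (Real.exp_pos _)⟩
  refine ⟨-Real.log φ, neg_pos.2 (Real.log_neg hφ0 hφ1), fun n => ?_⟩
  have e : Real.exp (-(n * -Real.log φ)) = ∏ _k : Fin n, φ := by
    rw [prod_const, card_univ, Fintype.card_fin, mul_neg, neg_neg, Real.exp_nat_mul,
      Real.exp_log hφ0]
  rw [e, ← sum_pi_prod (fun (_ : Fin n) ω => J ω * Real.exp (s * g ω))]
  refine sum_le_sum fun ω _ => ?_
  rw [prod_mul_distrib]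
  refine mul_le_mul_of_nonneg_left ?_ (prod_nonneg fun _ _ => hJ _)
  rw [← Real.exp_sum]
  split_ifs with h
  · rw [← mul_sum]
    refine Real.one_le_exp (mul_nonneg hs0.le ?_)
    simp only [hg, sum_sub_distrib, sum_const, card_univ, Fintype.card_fin, nsmul_eq_mul]
    linarith
  · exact (Real.exp_pos _).le

section density

variable {V O : Type*} [Fintype V] [Fintype O] {p : V → ℝ} {R : V → O → ℝ}

theorem densityTail_prod {X Y : Type*} [Fintype X] [Fintype Y] {n : ℕ} (p : (Fin n → V) → ℝ)
    (R : V → X × Y → ℝ) (θ : ℝ) :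
    densityTail p (fun v (o : (Fin n → X) × (Fin n → Y)) => ∏ k, R (v k) (o.1 k, o.2 k)) θ =
      densityTail p (fun v (o : Fin n → X × Y) => ∏ k, R (v k) (o k)) θ :=
  sum_congr rfl fun v _ => congr_arg (p v * ·) <|
    Equiv.sum_comp (Equiv.arrowProdEquivProdArrow (Fin n) (fun _ => X) fun _ => Y).symm
      fun o : Fin n → X × Y => (∏ k, R (v k) (o k)) *
        (if ∏ k, R (v k) (o k) < Real.exp θ * ∑ v', p v' * ∏ k, R (v' k) (o k) then 1 else 0)

theorem sum_prod_mul_sum_prod_mul {n : ℕ} (p : V → ℝ) (R : V → O → ℝ)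
    (f : (Fin n → V) → (Fin n → O) → ℝ) :
    ∑ v : Fin n → V, (∏ k, p (v k)) * ∑ o : Fin n → O, (∏ k, R (v k) (o k)) * f v o =
      ∑ ω : Fin n → V × O, (∏ k, p (ω k).1 * R (ω k).1 (ω k).2) *
        f (fun k => (ω k).1) (fun k => (ω k).2) := by
  simp only [mul_sum, ← Fintype.sum_prod_type']
  exact Fintype.sum_equiv (Equiv.arrowProdEquivProdArrow _ _ _).symm _ _ fun _ => by
    simp only [Equiv.arrowProdEquivProdArrow_symm_apply, prod_mul_distrib, mul_assoc]

theorem sum_prod_mul_prod {n : ℕ} (p : V → ℝ) (R : V → O → ℝ) (o : Fin n → O) :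
    ∑ v : Fin n → V, (∏ k, p (v k)) * ∏ k, R (v k) (o k) = ∏ k, ∑ v, p v * R v (o k) := by
  rw [← sum_pi_prod fun k v => p v * R v (o k)]
  simp only [prod_mul_distrib]

theorem exists_density_pow_le (hp : ∀ v, 0 ≤ p v) (hp1 : ∑ v, p v = 1) (hR0 : ∀ v o, 0 ≤ R v o)
    (hR1 : ∀ v, ∑ o, R v o = 1) {ε : ℝ} (hε : 0 < ε) :
    ∃ γ : ℝ, 0 < γ ∧ ∀ n : ℕ,
      densityTail (fun v : Fin n → V => ∏ k, p (v k)) (fun v (o : Fin n → O) => ∏ k, R (v k) (o k))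
        (n * (kernelInfo p R - ε)) ≤ Real.exp (-(n * γ)) ∧
      densityExcess (fun v : Fin n → V => ∏ k, p (v k))
        (fun v (o : Fin n → O) => ∏ k, R (v k) (o k)) (n * (kernelInfo p R + ε)) ≤
          Real.exp (-(n * γ)) := by
  let m : O → ℝ := fun o => ∑ v, p v * R v o
  let J : V × O → ℝ := fun ω => p ω.1 * R ω.1 ω.2
  let f : V × O → ℝ := fun ω => Real.log (R ω.1 ω.2 / m ω.2)
  have hJ : ∀ ω, 0 ≤ J ω := fun ω => mul_nonneg (hp _) (hR0 _ _)
  have hJ1 : ∑ ω, J ω = 1 := by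
    simp only [J]
    rw [Fintype.sum_prod_type]
    simp [← mul_sum, hR1, hp1]
  have hf : ∑ ω, J ω * f ω = kernelInfo p R := by
    rw [Fintype.sum_prod_type]
    exact sum_congr rfl fun v _ => by
      rw [mul_sum]
      exact sum_congr rfl fun o _ => mul_assoc _ _ _
  have hpos : ∀ ω, J ω ≠ 0 → 0 < R ω.1 ω.2 ∧ 0 < m ω.2 := fun ω h => by
    have h1 := (hp ω.1).lt_of_ne fun h0 => h (by simp [J, ← h0])
    have h2 := (hR0 ω.1 ω.2).lt_of_ne fun h0 => h (by simp [J, ← h0])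
    exact ⟨h2, sum_pos' (fun v _ => mul_nonneg (hp v) (hR0 v _)) ⟨ω.1, mem_univ _, mul_pos h1 h2⟩⟩
  have hlog : ∀ {n : ℕ} (ω : Fin n → V × O), ∏ k, J (ω k) ≠ 0 →
      0 < ∏ k, R (ω k).1 (ω k).2 ∧ 0 < ∏ k, m (ω k).2 ∧
      ∑ k, f (ω k) = Real.log (∏ k, R (ω k).1 (ω k).2) - Real.log (∏ k, m (ω k).2) := by
    intro n ω h
    have h' : ∀ k, 0 < R (ω k).1 (ω k).2 ∧ 0 < m (ω k).2 := fun k =>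
      hpos _ (prod_ne_zero_iff.1 h k (mem_univ _))
    refine ⟨prod_pos fun k _ => (h' k).1, prod_pos fun k _ => (h' k).2, ?_⟩
    rw [Real.log_prod (fun k _ => (h' k).1.ne'), Real.log_prod (fun k _ => (h' k).2.ne'),
      ← sum_sub_distrib]
    exact sum_congr rfl fun k _ => Real.log_div (h' k).1.ne' (h' k).2.ne'
  obtain ⟨γ1, hγ1, h1⟩ := exists_sum_prod_mul_indicator_le hJ hJ1 (fun ω => -f ω) hε
  obtain ⟨γ2, hγ2, h2⟩ := exists_sum_prod_mul_indicator_le hJ hJ1 f hε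
  have key : ∀ (n : ℕ) {γ : ℝ}, min γ1 γ2 ≤ γ →
      Real.exp (-(n * γ)) ≤ Real.exp (-(n * min γ1 γ2)) := fun n γ h =>
    Real.exp_le_exp.2 (neg_le_neg (mul_le_mul_of_nonneg_left h (Nat.cast_nonneg _)))
  refine ⟨min γ1 γ2, lt_min hγ1 hγ2, fun n => ⟨?_, ?_⟩⟩
  · refine le_trans ?_ ((h1 n).trans (key n (min_le_left _ _)))
    unfold densityTail
    simp only [sum_prod_mul_prod]
    rw [sum_prod_mul_sum_prod_mul p R fun v o => if ∏ k, R (v k) (o k) <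
      Real.exp (n * (kernelInfo p R - ε)) * ∏ k, ∑ v, p v * R v (o k) then 1 else 0]
    refine sum_le_sum fun ω _ => ?_
    by_cases h0 : ∏ k, J (ω k) = 0
    · simp only [J] at h0 ⊢
      simp [h0]
    refine mul_le_mul_of_nonneg_left ?_ (prod_nonneg fun _ _ => hJ _)
    obtain ⟨a, b, c⟩ := hlog ω h0
    split_ifs with h3 h4 <;> norm_num
    refine h4 ?_
    have h5 := Real.log_lt_log a h3
    rw [Real.log_mul (Real.exp_pos _).ne' b.ne', Real.log_exp] at h5
    simp only [mul_neg, sum_neg_distrib, hf, c]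
    linarith
  · refine le_trans ?_ ((h2 n).trans (key n (min_le_right _ _)))
    unfold densityExcess
    simp only [sum_prod_mul_prod]
    rw [sum_prod_mul_sum_prod_mul p R fun v o => if Real.exp (n * (kernelInfo p R + ε)) *
      ∏ k, ∑ v, p v * R v (o k) < ∏ k, R (v k) (o k) then 1 else 0]
    refine sum_le_sum fun ω _ => ?_
    by_cases h0 : ∏ k, J (ω k) = 0
    · simp only [J] at h0 ⊢
      simp [h0]
    refine mul_le_mul_of_nonneg_left ?_ (prod_nonneg fun _ _ => hJ _)
    obtain ⟨a, b, c⟩ := hlog ω h0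
    split_ifs with h3 h4 <;> norm_num
    refine h4 ?_
    have h5 := Real.log_lt_log (mul_pos (Real.exp_pos _) b) h3
    rw [Real.log_mul (Real.exp_pos _).ne' b.ne', Real.log_exp] at h5
    simp only [hf, c]
    linarith

end density

theorem sum_channel_eq_one {W : X1 → X2 → Y1 × Y2 × Z → ℝ}
    (hW1 : ∀ x1 x2, ∑ p, W x1 x2 p = 1) (x1 : X1) (x2 : X2) :
    ∑ y1, ∑ y2, ∑ z, W x1 x2 (y1, y2, z) = 1 := by
  rw [← hW1 x1 x2, Fintype.sum_prod_type]
  exact sum_congr rfl fun _ _ => by rw [Fintype.sum_prod_type]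

namespace InputDist

variable (d : InputDist X1 X2) (W : X1 → X2 → Y1 × Y2 × Z → ℝ)

/-- The kernel from `V2` to the observation of user 1. -/
def obs1 (v2 : d.V2) (o : X1 × Y1) : ℝ :=
  ∑ v1, ∑ x2, ∑ y2, ∑ z, d.PV1 v1 * (d.PX1 v1 o.1 * d.PX2 v2 x2 * W o.1 x2 (o.2, y2, z))

/-- The kernel from `V1` to the observation of user 2. -/
def obs2 (v1 : d.V1) (o : X2 × Y2) : ℝ :=
  ∑ v2, ∑ x1, ∑ y1, ∑ z, d.PV2 v2 * (d.PX1 v1 x1 * d.PX2 v2 o.1 * W x1 o.1 (y1, o.2, z))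

/-- The kernel from `(V1, V2)` to the observation of the eavesdropper. -/
def tap (v : d.V1 × d.V2) (z : Z) : ℝ :=
  ∑ x1, ∑ x2, ∑ y1, ∑ y2, d.PX1 v.1 x1 * d.PX2 v.2 x2 * W x1 x2 (y1, y2, z)

variable {W}

theorem obs1_nonneg (hW0 : ∀ x1 x2 p, 0 ≤ W x1 x2 p) (v : d.V2) (o : X1 × Y1) :
    0 ≤ d.obs1 W v o :=
  sum_nonneg fun _ _ => sum_nonneg fun _ _ => sum_nonneg fun _ _ => sum_nonneg fun _ _ =>
    mul_nonneg (d.PV1_nonneg _) (mul_nonneg (mul_nonneg (d.PX1_nonneg _ _) (d.PX2_nonneg _ _))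
      (hW0 _ _ _))

theorem obs2_nonneg (hW0 : ∀ x1 x2 p, 0 ≤ W x1 x2 p) (v : d.V1) (o : X2 × Y2) :
    0 ≤ d.obs2 W v o :=
  sum_nonneg fun _ _ => sum_nonneg fun _ _ => sum_nonneg fun _ _ => sum_nonneg fun _ _ =>
    mul_nonneg (d.PV2_nonneg _) (mul_nonneg (mul_nonneg (d.PX1_nonneg _ _) (d.PX2_nonneg _ _))
      (hW0 _ _ _))

theorem tap_nonneg (hW0 : ∀ x1 x2 p, 0 ≤ W x1 x2 p) (v : d.V1 × d.V2) (z : Z) :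
    0 ≤ d.tap W v z :=
  sum_nonneg fun _ _ => sum_nonneg fun _ _ => sum_nonneg fun _ _ => sum_nonneg fun _ _ =>
    mul_nonneg (mul_nonneg (d.PX1_nonneg _ _) (d.PX2_nonneg _ _)) (hW0 _ _ _)

theorem sum_obs1 (hW1 : ∀ x1 x2, ∑ p, W x1 x2 p = 1) (v : d.V2) (x1 : X1) :
    ∑ y, d.obs1 W v (x1, y) = ∑ v1, d.PV1 v1 * d.PX1 v1 x1 := by
  simp only [obs1]
  rw [sum_comm]
  refine sum_congr rfl fun v1 _ => ?_
  rw [sum_comm]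
  simp only [← mul_sum, sum_channel_eq_one hW1, mul_one, d.PX2_sum]

theorem sum_obs2 (hW1 : ∀ x1 x2, ∑ p, W x1 x2 p = 1) (v : d.V1) (x2 : X2) :
    ∑ y, d.obs2 W v (x2, y) = ∑ v2, d.PV2 v2 * d.PX2 v2 x2 := by
  simp only [obs2]
  rw [sum_comm]
  refine sum_congr rfl fun v2 _ => ?_
  rw [sum_comm]
  simp only [← mul_sum]
  congr 1
  calc _ = ∑ x1, d.PX1 v x1 * d.PX2 v2 x2 := by
        refine sum_congr rfl fun x1 _ => ?_
        rw [sum_comm, sum_channel_eq_one hW1, mul_one]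
    _ = _ := by rw [← sum_mul, d.PX1_sum, one_mul]

theorem sum_obs1_eq_one (hW1 : ∀ x1 x2, ∑ p, W x1 x2 p = 1) (v : d.V2) :
    ∑ o, d.obs1 W v o = 1 := by
  rw [Fintype.sum_prod_type]
  simp only [d.sum_obs1 hW1]
  rw [sum_comm]
  simp [← mul_sum, d.PX1_sum, d.PV1_sum]

theorem sum_obs2_eq_one (hW1 : ∀ x1 x2, ∑ p, W x1 x2 p = 1) (v : d.V1) :
    ∑ o, d.obs2 W v o = 1 := by
  rw [Fintype.sum_prod_type]
  simp only [d.sum_obs2 hW1]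
  rw [sum_comm]
  simp [← mul_sum, d.PX2_sum, d.PV2_sum]

theorem sum_tap (hW1 : ∀ x1 x2, ∑ p, W x1 x2 p = 1) (v : d.V1 × d.V2) : ∑ z, d.tap W v z = 1 := by
  simp only [tap]
  rw [sum_comm]
  calc _ = ∑ x1, ∑ x2, d.PX1 v.1 x1 * d.PX2 v.2 x2 := by
        refine sum_congr rfl fun x1 _ => ?_
        rw [sum_comm]
        refine sum_congr rfl fun x2 _ => ?_
        rw [sum_comm]
        simp_rw [sum_comm (s := (univ : Finset Z))]
        simp only [← mul_sum, sum_channel_eq_one hW1, mul_one]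
    _ = 1 := by simp [← mul_sum, d.PX2_sum, d.PX1_sum]

theorem cmiDist_pY2V1X2 (hW0 : ∀ x1 x2 p, 0 ≤ W x1 x2 p) (hW1 : ∀ x1 x2, ∑ p, W x1 x2 p = 1) :
    cmiDist (pY2V1X2 d.PV1 d.PX1 d.PV2 d.PX2 W) = kernelInfo d.PV1 (d.obs2 W) := by
  rw [← cmiDist_eq_kernelInfo d.PV1_sum (d.obs2_nonneg hW0) (d.sum_obs2 hW1)]
  congr 1
  funext a
  simp only [pY2V1X2, slJoint, obs2, mul_sum]
  exact sum_congr rfl fun _ _ => sum_congr rfl fun _ _ => sum_congr rfl fun _ _ =>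
    sum_congr rfl fun _ _ => by ring

theorem cmiDist_pY1V2X1 (hW0 : ∀ x1 x2 p, 0 ≤ W x1 x2 p) (hW1 : ∀ x1 x2, ∑ p, W x1 x2 p = 1) :
    cmiDist (pY1V2X1 d.PV1 d.PX1 d.PV2 d.PX2 W) = kernelInfo d.PV2 (d.obs1 W) := by
  rw [← cmiDist_eq_kernelInfo d.PV2_sum (d.obs1_nonneg hW0) (d.sum_obs1 hW1)]
  congr 1
  funext a
  simp only [pY1V2X1, slJoint, obs1, mul_sum]
  exact sum_congr rfl fun _ _ => sum_congr rfl fun _ _ => sum_congr rfl fun _ _ =>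
    sum_congr rfl fun _ _ => by ring

theorem miDist_pV12Z (hW1 : ∀ x1 x2, ∑ p, W x1 x2 p = 1) :
    miDist (pV12Z d.PV1 d.PX1 d.PV2 d.PX2 W) =
      kernelInfo (fun v : d.V1 × d.V2 => d.PV1 v.1 * d.PV2 v.2) (d.tap W) := by
  rw [← miDist_eq_kernelInfo (d.sum_tap hW1)]
  congr 1
  funext a
  simp only [pV12Z, slJoint, tap, mul_sum]
  exact sum_congr rfl fun _ _ => sum_congr rfl fun _ _ => sum_congr rfl fun _ _ =>
    sum_congr rfl fun _ _ => by ring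

/-- Random coding over `n` channel uses with i.i.d. codewords. -/
theorem exists_achieves (hW0 : ∀ x1 x2 p, 0 ≤ W x1 x2 p) (hW1 : ∀ x1 x2, ∑ p, W x1 x2 p = 1)
    {ε : ℝ} (hε : 0 < ε) : ∃ γ : ℝ, 0 < γ ∧ ∀ (n : ℕ) (K A1 A2 T1 T2 : Type)
      [Fintype K] [Fintype A1] [Fintype A2] [Fintype T1] [Fintype T2]
      [Nonempty K] [Nonempty A1] [Nonempty A2] [Nonempty T1] [Nonempty T2],
      (Subsingleton T1 ∨ Subsingleton d.V2) → (Subsingleton T2 ∨ Subsingleton d.V1) →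
      (Fintype.card (A1 × T1) - 1 : ℝ) ≤ Real.exp (n * (kernelInfo d.PV1 (d.obs2 W) - ε)) →
      (Fintype.card (A2 × T2) - 1 : ℝ) ≤ Real.exp (n * (kernelInfo d.PV2 (d.obs1 W) - ε)) →
      Real.exp (n * (kernelInfo (fun v : d.V1 × d.V2 => d.PV1 v.1 * d.PV2 v.2) (d.tap W) + ε)) ≤
        Fintype.card (K × T1 × T2) →
      Achieves W n K A1 A2 (6 * Real.exp (-(n * γ))) := by
  obtain ⟨γ1, hγ1, h1⟩ := exists_density_pow_le d.PV1_nonneg d.PV1_sum (d.obs2_nonneg hW0)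
    (d.sum_obs2_eq_one hW1) (half_pos hε)
  obtain ⟨γ2, hγ2, h2⟩ := exists_density_pow_le d.PV2_nonneg d.PV2_sum (d.obs1_nonneg hW0)
    (d.sum_obs1_eq_one hW1) (half_pos hε)
  obtain ⟨γ3, hγ3, h3⟩ := exists_density_pow_le
    (p := fun v : d.V1 × d.V2 => d.PV1 v.1 * d.PV2 v.2)
    (fun v => mul_nonneg (d.PV1_nonneg _) (d.PV2_nonneg _))
    (by rw [Fintype.sum_prod_type]; simp [← mul_sum, d.PV1_sum, d.PV2_sum])
    (d.tap_nonneg hW0) (d.sum_tap hW1) (half_pos hε)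
  set I1 := kernelInfo d.PV1 (d.obs2 W)
  set I2 := kernelInfo d.PV2 (d.obs1 W)
  set I := kernelInfo (fun v : d.V1 × d.V2 => d.PV1 v.1 * d.PV2 v.2) (d.tap W)
  set γ := min (min γ1 γ2) (min γ3 (ε / 4))
  have hle1 : γ ≤ γ1 := (min_le_left _ _).trans (min_le_left _ _)
  have hle2 : γ ≤ γ2 := (min_le_left _ _).trans (min_le_right _ _)
  have hle3 : γ ≤ γ3 := (min_le_right _ _).trans (min_le_left _ _)
  have hle4 : γ ≤ ε / 4 := (min_le_right _ _).trans (min_le_right _ _)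
  refine ⟨γ, by positivity, ?_⟩
  intro n K A1 A2 T1 T2 _ _ _ _ _ _ _ _ _ _ hT1 hT2 hA1 hA2 hK
  have hexp : ∀ {c : ℝ}, γ ≤ c → Real.exp (-(n * c)) ≤ Real.exp (-(n * γ)) := fun h =>
    Real.exp_le_exp.2 (neg_le_neg (mul_le_mul_of_nonneg_left h (Nat.cast_nonneg _)))
  have hpow : ∀ {V : Type} [Fintype V] {p : V → ℝ}, (∀ v, 0 ≤ p v) → ∑ v, p v = 1 →
      (∀ v : Fin n → V, 0 ≤ ∏ k, p (v k)) ∧ ∑ v : Fin n → V, ∏ k, p (v k) = 1 :=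
    fun hp hp1 => ⟨fun v => prod_nonneg fun _ _ => hp _, by
      classical
      rw [sum_pi_prod fun _ v => _]
      simp [hp1]⟩
  have hA : ∀ {a I : ℝ}, a ≤ Real.exp (n * (I - ε)) →
      a * Real.exp (-(n * (I - ε / 2))) ≤ Real.exp (-(n * γ)) := fun {a I} h => by
    calc _ ≤ Real.exp (n * (I - ε)) * Real.exp (-(n * (I - ε / 2))) :=
          mul_le_mul_of_nonneg_right h (Real.exp_pos _).le
      _ = Real.exp (-(n * (ε / 2))) := by rw [← Real.exp_add]; ring_nf
      _ ≤ _ := hexp (by linarith)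
  have hrc := Achieves.randomCoding hW0 hW1
    (p1 := fun v : Fin n → d.V1 => ∏ k, d.PV1 (v k))
    (p2 := fun v : Fin n → d.V2 => ∏ k, d.PV2 (v k))
    (hpow d.PV1_nonneg d.PV1_sum).1 (hpow d.PV2_nonneg d.PV2_sum).1
    (hpow d.PV1_nonneg d.PV1_sum).2 (hpow d.PV2_nonneg d.PV2_sum).2
    (Q1 := fun v x => ∏ k, d.PX1 (v k) (x k)) (Q2 := fun v x => ∏ k, d.PX2 (v k) (x k))
    (fun v x => prod_nonneg fun _ _ => d.PX1_nonneg _ _)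
    (fun v x => prod_nonneg fun _ _ => d.PX2_nonneg _ _)
    (fun v => IsCausalKernel.prod _ fun k => ⟨d.PX1_nonneg _, d.PX1_sum _⟩)
    (fun v => IsCausalKernel.prod _ fun k => ⟨d.PX2_nonneg _, d.PX2_sum _⟩)
    (R1 := fun v o => ∏ k, d.obs1 W (v k) (o.1 k, o.2 k))
    (R2 := fun v o => ∏ k, d.obs2 W (v k) (o.1 k, o.2 k))
    (fun v o => by
      simp only [obs1, prod_univ_sum, Fintype.piFinset_univ, prod_mul_distrib])
    (fun v o => by
      simp only [obs2, prod_univ_sum, Fintype.piFinset_univ, prod_mul_distrib])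
    (K := K) (A1 := A1) (A2 := A2) (T1 := T1) (T2 := T2)
    (hT1.imp_right fun h => ⟨fun _ _ => funext fun _ => h.elim _ _⟩)
    (hT2.imp_right fun h => ⟨fun _ _ => funext fun _ => h.elim _ _⟩)
    (n * (I + ε / 2)) (n * (I2 - ε / 2)) (n * (I1 - ε / 2))
  refine hrc.mono ?_
  have e1 : densityExcess
      (fun v : (Fin n → d.V1) × (Fin n → d.V2) => (∏ k, d.PV1 (v.1 k)) * ∏ k, d.PV2 (v.2 k))
      (fun v => interact W n (fun x _ => ∏ k, d.PX1 (v.1 k) (x k))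
        (fun x _ => ∏ k, d.PX2 (v.2 k) (x k))) (n * (I + ε / 2)) ≤ Real.exp (-(n * γ)) := by
    refine le_trans (le_of_eq ?_) ((h3 n).2.trans (hexp hle3))
    have hint : ∀ (v : (Fin n → d.V1) × (Fin n → d.V2)) (z : Fin n → Z),
        interact W n (fun x _ => ∏ k, d.PX1 (v.1 k) (x k)) (fun x _ => ∏ k, d.PX2 (v.2 k) (x k)) z =
        ∏ k, d.tap W (v.1 k, v.2 k) (z k) := fun v z => by
      simp only [interact, tap, prod_univ_sum, Fintype.piFinset_univ, prod_mul_distrib,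
        Fintype.sum_prod_type]
    have hsum : ∀ f : (Fin n → d.V1 × d.V2) → ℝ, ∑ v : (Fin n → d.V1) × (Fin n → d.V2),
        f (fun k => (v.1 k, v.2 k)) = ∑ v, f v := fun f =>
      (Equiv.arrowProdEquivProdArrow _ _ _).symm.sum_comp f
    simp only [densityExcess, hint, ← prod_mul_distrib]
    rw [← hsum]
    refine sum_congr rfl fun v _ => ?_
    congr 1
    refine sum_congr rfl fun z _ => ?_
    rw [← hsum]
  have e2 : Real.sqrt (Real.exp (n * (I + ε / 2)) / Fintype.card (K × T1 × T2)) ≤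
      Real.exp (-(n * γ)) := by
    refine Real.sqrt_le_iff.2 ⟨(Real.exp_pos _).le, ?_⟩
    rw [div_le_iff₀ (Nat.cast_pos.2 Fintype.card_pos)]
    calc Real.exp (n * (I + ε / 2)) = Real.exp (-(n * (ε / 4))) ^ 2 * Real.exp (n * (I + ε)) := by
          rw [← Real.exp_nat_mul, ← Real.exp_add]; push_cast; ring_nf
      _ ≤ _ := mul_le_mul (pow_le_pow_left₀ (Real.exp_pos _).le (hexp hle4) _) hK
        (Real.exp_pos _).le (by positivity)
  have e3 : densityTail (fun v : Fin n → d.V2 => ∏ k, d.PV2 (v k))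
      (fun v (o : (Fin n → X1) × (Fin n → Y1)) => ∏ k, d.obs1 W (v k) (o.1 k, o.2 k))
      (n * (I2 - ε / 2)) ≤ Real.exp (-(n * γ)) :=
    (densityTail_prod _ _ _).trans_le ((h2 n).1.trans (hexp hle2))
  have e4 : densityTail (fun v : Fin n → d.V1 => ∏ k, d.PV1 (v k))
      (fun v (o : (Fin n → X2) × (Fin n → Y2)) => ∏ k, d.obs2 W (v k) (o.1 k, o.2 k))
      (n * (I1 - ε / 2)) ≤ Real.exp (-(n * γ)) :=
    (densityTail_prod _ _ _).trans_le ((h1 n).1.trans (hexp hle1))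
  linarith [hA hA1, hA hA2]

end InputDist

theorem kernelInfo_nonneg {V O : Type*} [Fintype V] [Fintype O] {p : V → ℝ} {R : V → O → ℝ}
    (hp : ∀ v, 0 ≤ p v) (hp1 : ∑ v, p v = 1) (hR0 : ∀ v o, 0 ≤ R v o)
    (hR1 : ∀ v, ∑ o, R v o = 1) : 0 ≤ kernelInfo p R := by
  rw [← miDist_eq_kernelInfo hR1]
  refine miDist_nonneg (fun a => mul_nonneg (hp _) (hR0 _ _)) ?_
  rw [Fintype.sum_prod_type]
  simp [← mul_sum, hR1, hp1]

theorem eventually_le_exp_mul (c : ℝ) {ε : ℝ} (hε : 0 < ε) :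
    ∀ᶠ n : ℕ in Filter.atTop, c ≤ Real.exp (n * ε) :=
  (Real.tendsto_exp_atTop.comp
    (tendsto_natCast_atTop_atTop.atTop_mul_const hε)).eventually_ge_atTop c

theorem eventually_exists_nat_exp {I J : ℝ} (hJ : 0 ≤ J) (hIJ : J < I) :
    ∃ ε : ℝ, 0 < ε ∧ ∃ κ : ℝ, 0 < κ ∧ ∀ᶠ n : ℕ in Filter.atTop, ∃ a t : ℕ, 0 < a ∧ 0 < t ∧
      (a * t - 1 : ℝ) ≤ Real.exp (n * (I - ε)) ∧ Real.exp (n * (J + ε)) ≤ t ∧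
      Real.exp (n * κ) ≤ a := by
  obtain ⟨ε, hε, rfl⟩ : ∃ ε : ℝ, 0 < ε ∧ I = J + 4 * ε := ⟨(I - J) / 4, by linarith, by ring⟩
  refine ⟨ε, hε, ε / 2, by positivity, ?_⟩
  filter_upwards [eventually_le_exp_mul 4 (show 0 < 3 * ε / 2 by positivity)] with n hn
  have hceil : ∀ {c : ℝ}, 0 ≤ c → 0 < ⌈Real.exp (n * c)⌉₊ ∧ Real.exp (n * c) ≤ ⌈Real.exp (n * c)⌉₊ ∧
      (⌈Real.exp (n * c)⌉₊ : ℝ) ≤ 2 * Real.exp (n * c) := fun {c} hc => by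
    refine ⟨Nat.ceil_pos.2 (Real.exp_pos _), Nat.le_ceil _, ?_⟩
    have h1 := (Nat.ceil_lt_add_one (Real.exp_pos (n * c)).le).le
    have h2 := Real.one_le_exp (mul_nonneg (Nat.cast_nonneg n) hc)
    linarith
  obtain ⟨h1, h2, h3⟩ := hceil (show 0 ≤ ε / 2 by positivity)
  obtain ⟨h4, h5, h6⟩ := hceil (show 0 ≤ J + ε by positivity)
  refine ⟨_, _, h1, h4, ?_, h5, h2⟩
  calc _ ≤ (⌈Real.exp (n * (ε / 2))⌉₊ * ⌈Real.exp (n * (J + ε))⌉₊ : ℝ) := by linarith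
    _ ≤ (2 * Real.exp (n * (ε / 2))) * (2 * Real.exp (n * (J + ε))) :=
        mul_le_mul h3 h6 (by positivity) (by positivity)
    _ = 4 * (Real.exp (n * (ε / 2)) * Real.exp (n * (J + ε))) := by ring
    _ ≤ Real.exp (n * (3 * ε / 2)) * (Real.exp (n * (ε / 2)) * Real.exp (n * (J + ε))) :=
        mul_le_mul_of_nonneg_right hn (by positivity)
    _ = _ := by
        rw [← Real.exp_add, ← Real.exp_add]
        ring_nf

namespace InputDist

variable (d : InputDist X1 X2) {W : X1 → X2 → Y1 × Y2 × Z → ℝ}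

/-- The input distribution in which `V1` is hidden in the prefixing kernel of user 1. -/
def blind1 : InputDist X1 X2 where
  V1 := Unit
  V2 := d.V2
  PV1 := 1
  PX1 _ x := ∑ v, d.PV1 v * d.PX1 v x
  PV2 := d.PV2
  PX2 := d.PX2
  PV1_nonneg _ := zero_le_one
  PV1_sum := by simp
  PX1_nonneg _ _ := sum_nonneg fun _ _ => mul_nonneg (d.PV1_nonneg _) (d.PX1_nonneg _ _)
  PX1_sum _ := by rw [sum_comm]; simp [← mul_sum, d.PX1_sum, d.PV1_sum]
  PV2_nonneg := d.PV2_nonneg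
  PV2_sum := d.PV2_sum
  PX2_nonneg := d.PX2_nonneg
  PX2_sum := d.PX2_sum

/-- The input distribution in which `V2` is hidden in the prefixing kernel of user 2. -/
def blind2 : InputDist X1 X2 where
  V1 := d.V1
  V2 := Unit
  PV1 := d.PV1
  PX1 := d.PX1
  PV2 := 1
  PX2 _ x := ∑ v, d.PV2 v * d.PX2 v x
  PV1_nonneg := d.PV1_nonneg
  PV1_sum := d.PV1_sum
  PX1_nonneg := d.PX1_nonneg
  PX1_sum := d.PX1_sum
  PV2_nonneg _ := zero_le_one
  PV2_sum := by simp
  PX2_nonneg _ _ := sum_nonneg fun _ _ => mul_nonneg (d.PV2_nonneg _) (d.PX2_nonneg _ _)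
  PX2_sum _ := by rw [sum_comm]; simp [← mul_sum, d.PX2_sum, d.PV2_sum]

theorem blind1_obs1 : d.blind1.obs1 W = d.obs1 W := by
  funext v o
  change ∑ _v1 : Unit, ∑ x2, ∑ y2, ∑ z,
    1 * ((∑ v, d.PV1 v * d.PX1 v o.1) * d.PX2 v x2 * W o.1 x2 (o.2, y2, z)) = _
  simp only [univ_unique, sum_singleton, one_mul, obs1, sum_mul, mul_assoc]
  simp_rw [sum_comm (γ := d.V1)]

theorem blind2_obs2 : d.blind2.obs2 W = d.obs2 W := by
  funext v o
  change ∑ _v2 : Unit, ∑ x1, ∑ y1, ∑ z,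
    1 * (d.PX1 v x1 * (∑ v, d.PV2 v * d.PX2 v o.1) * W x1 o.1 (y1, o.2, z)) = _
  simp only [univ_unique, sum_singleton, one_mul, obs2, sum_mul, mul_sum]
  simp_rw [sum_comm (γ := d.V2)]
  exact sum_congr rfl fun _ _ => sum_congr rfl fun _ _ => sum_congr rfl fun _ _ =>
    sum_congr rfl fun _ _ => by ring

theorem blind1_tap (v : Unit × d.V2) (z : Z) :
    d.blind1.tap W v z = ∑ v1, d.PV1 v1 * d.tap W (v1, v.2) z := by
  change ∑ x1, ∑ x2, ∑ y1, ∑ y2,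
    (∑ v1, d.PV1 v1 * d.PX1 v1 x1) * d.PX2 v.2 x2 * W x1 x2 (y1, y2, z) = _
  simp only [tap, sum_mul, mul_sum, mul_assoc]
  simp_rw [sum_comm (γ := d.V1)]

theorem blind2_tap (v : d.V1 × Unit) (z : Z) :
    d.blind2.tap W v z = ∑ v2, d.PV2 v2 * d.tap W (v.1, v2) z := by
  change ∑ x1, ∑ x2, ∑ y1, ∑ y2,
    d.PX1 v.1 x1 * (∑ v2, d.PV2 v2 * d.PX2 v2 x2) * W x1 x2 (y1, y2, z) = _
  simp only [tap, sum_mul, mul_sum]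
  simp_rw [sum_comm (γ := d.V2)]
  exact sum_congr rfl fun _ _ => sum_congr rfl fun _ _ => sum_congr rfl fun _ _ =>
    sum_congr rfl fun _ _ => sum_congr rfl fun _ _ => by ring

theorem kernelInfo_blind1_tap :
    kernelInfo (fun v : d.blind1.V1 × d.blind1.V2 => d.blind1.PV1 v.1 * d.blind1.PV2 v.2)
      (d.blind1.tap W) = kernelInfo d.PV2 fun v2 z => ∑ v1, d.PV1 v1 * d.tap W (v1, v2) z := by
  change kernelInfo (fun v : Unit × d.V2 => (1 : ℝ) * d.PV2 v.2) (d.blind1.tap W) = _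
  simp only [kernelInfo, one_mul]
  rw [Fintype.sum_prod_type]
  simp only [univ_unique, sum_singleton, Fintype.sum_prod_type, d.blind1_tap]

theorem kernelInfo_blind2_tap :
    kernelInfo (fun v : d.blind2.V1 × d.blind2.V2 => d.blind2.PV1 v.1 * d.blind2.PV2 v.2)
      (d.blind2.tap W) = kernelInfo d.PV1 fun v1 z => ∑ v2, d.PV2 v2 * d.tap W (v1, v2) z := by
  change kernelInfo (fun v : d.V1 × Unit => d.PV1 v.1 * (1 : ℝ)) (d.blind2.tap W) = _
  simp only [kernelInfo, mul_one]
  rw [Fintype.sum_prod_type]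
  simp only [univ_unique, sum_singleton, Fintype.sum_prod_type, d.blind2_tap]

/-- When the sum rate is positive, one of the users can agree on a secret key with the other one
without using any shared randomness. -/
theorem exists_key (hW0 : ∀ x1 x2 p, 0 ≤ W x1 x2 p) (hW1 : ∀ x1 x2, ∑ p, W x1 x2 p = 1)
    (h : kernelInfo (fun v : d.V1 × d.V2 => d.PV1 v.1 * d.PV2 v.2) (d.tap W) <
      kernelInfo d.PV1 (d.obs2 W) + kernelInfo d.PV2 (d.obs1 W)) :
    ∃ γ : ℝ, 0 < γ ∧ ∃ κ : ℝ, 0 < κ ∧ ∀ᶠ n : ℕ in Filter.atTop, ∃ a1 a2 : ℕ, 0 < a1 ∧ 0 < a2 ∧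
      Real.exp (n * κ) ≤ a1 * a2 ∧
      Achieves W n Unit (Fin a1) (Fin a2) (6 * Real.exp (-(n * γ))) := by
  have hsup := kernelInfo_marginal_add_le d.PV1_nonneg d.PV2_nonneg d.PV1_sum d.PV2_sum
    (d.tap_nonneg hW0) (d.sum_tap hW1)
  have hor : kernelInfo d.PV1 (fun v1 z => ∑ v2, d.PV2 v2 * d.tap W (v1, v2) z) <
        kernelInfo d.PV1 (d.obs2 W) ∨
      kernelInfo d.PV2 (fun v2 z => ∑ v1, d.PV1 v1 * d.tap W (v1, v2) z) <
        kernelInfo d.PV2 (d.obs1 W) := by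
    by_contra! hc
    linarith [hc.1, hc.2]
  rcases hor with hlt | hlt
  · have h0 : 0 ≤ kernelInfo d.PV1 (fun v1 z => ∑ v2, d.PV2 v2 * d.tap W (v1, v2) z) :=
      kernelInfo_nonneg d.PV1_nonneg d.PV1_sum
        (fun _ _ => sum_nonneg fun _ _ => mul_nonneg (d.PV2_nonneg _) (d.tap_nonneg hW0 _ _))
        fun v => by rw [sum_comm]; simp [← mul_sum, d.sum_tap hW1, d.PV2_sum]
    obtain ⟨ε, hε, κ, hκ, hn⟩ := eventually_exists_nat_exp h0 hlt
    obtain ⟨γ, hγ, hrc⟩ := d.blind2.exists_achieves hW0 hW1 hε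
    refine ⟨γ, hγ, κ, hκ, hn.mono ?_⟩
    rintro n ⟨a, t, ha, ht, h1, h2, h3⟩
    have : NeZero a := ⟨ha.ne'⟩
    have : NeZero t := ⟨ht.ne'⟩
    refine ⟨a, 1, ha, one_pos, by simpa using h3,
      hrc n Unit (Fin a) (Fin 1) (Fin t) Unit (Or.inr ?_) (Or.inl inferInstance) ?_ ?_ ?_⟩
    · exact inferInstanceAs (Subsingleton Unit)
    · rw [d.blind2_obs2]
      change _ ≤ Real.exp (n * (kernelInfo d.PV1 (d.obs2 W) - ε))
      simpa using h1
    · simpa using (Real.exp_pos _).le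
    · rw [d.kernelInfo_blind2_tap]
      simpa using h2
  · have h0 : 0 ≤ kernelInfo d.PV2 (fun v2 z => ∑ v1, d.PV1 v1 * d.tap W (v1, v2) z) :=
      kernelInfo_nonneg d.PV2_nonneg d.PV2_sum
        (fun _ _ => sum_nonneg fun _ _ => mul_nonneg (d.PV1_nonneg _) (d.tap_nonneg hW0 _ _))
        fun v => by rw [sum_comm]; simp [← mul_sum, d.sum_tap hW1, d.PV1_sum]
    obtain ⟨ε, hε, κ, hκ, hn⟩ := eventually_exists_nat_exp h0 hlt
    obtain ⟨γ, hγ, hrc⟩ := d.blind1.exists_achieves hW0 hW1 hε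
    refine ⟨γ, hγ, κ, hκ, hn.mono ?_⟩
    rintro n ⟨a, t, ha, ht, h1, h2, h3⟩
    have : NeZero a := ⟨ha.ne'⟩
    have : NeZero t := ⟨ht.ne'⟩
    refine ⟨1, a, one_pos, ha, by simpa using h3,
      hrc n Unit (Fin 1) (Fin a) Unit (Fin t) (Or.inl inferInstance) (Or.inr ?_) ?_ ?_ ?_⟩
    · exact inferInstanceAs (Subsingleton Unit)
    · simpa using (Real.exp_pos _).le
    · rw [d.blind1_obs1]
      change _ ≤ Real.exp (n * (kernelInfo d.PV2 (d.obs1 W) - ε))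
      simpa using h1
    · rw [d.kernelInfo_blind1_tap]
      simpa using h2

end InputDist

namespace Achieves

variable {W : X1 → X2 → Y1 × Y2 × Z → ℝ} {N n : ℕ} {K1 K2 J1 J2 M1 M2 : Type}
  [Fintype K1] [Fintype K2] [Fintype J1] [Fintype J2] [Fintype M1] [Fintype M2]
  [Nonempty K1] [Nonempty K2] [Nonempty J1] [Nonempty J2] [Nonempty M1] [Nonempty M2] {δ δ' : ℝ}

theorem chain (hW0 : ∀ x1 x2 p, 0 ≤ W x1 x2 p) (hW1 : ∀ x1 x2, ∑ p, W x1 x2 p = 1)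
    [Nonempty X1] [Nonempty X2] (h : Achieves W n (J1 × J2) (M1 × J1) (M2 × J2) δ) (r b : ℕ) :
    Achieves W (b * n + r) (J1 × J2) (Fin b → M1) (Fin b → M2) (b * δ) := by
  induction b with
  | zero =>
    simpa using (Achieves.trivial hW0 hW1 (0 * n + r) (J1 × J2)).congr (Equiv.refl _)
      (Equiv.equivPUnit (Fin 0 → M1)) (Equiv.equivPUnit (Fin 0 → M2))
  | succ b ih =>
    have := (h.comp hW0 hW1 ih).congr (Equiv.refl _) (Fin.insertNthEquiv (fun _ => M1) 0).symm
      (Fin.insertNthEquiv (fun _ => M2) 0).symm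
    convert this using 1
    · ring
    · push_cast
      ring

theorem pow (hW0 : ∀ x1 x2 p, 0 ≤ W x1 x2 p) (hW1 : ∀ x1 x2, ∑ p, W x1 x2 p = 1)
    [Nonempty X1] [Nonempty X2] (h : Achieves W n Unit M1 M2 δ) (b : ℕ) :
    Achieves W (b * n) Unit (Fin b → M1) (Fin b → M2) (b * δ) :=
  ((h.congr (Equiv.prodPUnit Unit) (Equiv.prodPUnit M1)
    (Equiv.prodPUnit M2)).chain hW0 hW1 0 b).congr
    (Equiv.prodPUnit Unit).symm (Equiv.refl _) (Equiv.refl _)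

/-- A shared key of type `K1 × K2` is used to start a chain of blocks, each of which carries a
message together with the key for the next block. -/
theorem bootstrap (hW0 : ∀ x1 x2 p, 0 ≤ W x1 x2 p) (hW1 : ∀ x1 x2, ∑ p, W x1 x2 p = 1)
    [Nonempty X1] [Nonempty X2] (hK : Achieves W N Unit K1 K2 δ')
    (h0 : Achieves W n (K1 × K2) (M1 × J1) (M2 × J2) δ)
    (h : Achieves W n (J1 × J2) (M1 × J1) (M2 × J2) δ) (r b : ℕ) :
    Achieves W (N + (n + (b * n + r))) Unit (Fin (b + 1) → M1) (Fin (b + 1) → M2)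
      (δ' + (δ + b * δ)) :=
  ((hK.congr (Equiv.refl _) (Equiv.punitProd K1) (Equiv.punitProd K2)).comp hW0 hW1
    (h0.comp hW0 hW1 (h.chain hW0 hW1 r b))).congr (Equiv.refl _)
      ((Fin.insertNthEquiv (fun _ => M1) 0).symm.trans (Equiv.punitProd _).symm)
      ((Fin.insertNthEquiv (fun _ => M2) 0).symm.trans (Equiv.punitProd _).symm)

theorem error_nonneg {K : Type} [Fintype K] (h : Achieves W N K M1 M2 δ) : 0 ≤ δ := by
  obtain ⟨_, _, q, _, _, _, _, h⟩ := h
  refine le_trans ?_ h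
  rw [expect_eq_sum_div_card]
  exact div_nonneg (sum_nonneg fun _ _ => sum_nonneg fun _ _ => le_max_right _ _) (by positivity)

end Achieves

/-- The rate pairs `r` such that for all large `N` there are codes of length `N` and rates close
to `r` with `N * δ` small. -/
def achievableRates (W : X1 → X2 → Y1 × Y2 × Z → ℝ) : Set (ℝ × ℝ) :=
  {r | ∀ ε : ℝ, 0 < ε → ∀ᶠ N : ℕ in Filter.atTop, ∃ M1 M2 : ℕ, 0 < M1 ∧ 0 < M2 ∧ ∃ δ : ℝ,
    Achieves W N Unit (Fin M1) (Fin M2) δ ∧ |Real.log M1 - N * r.1| ≤ N * ε ∧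
      |Real.log M2 - N * r.2| ≤ N * ε ∧ N * δ ≤ ε}

theorem isClosed_achievableRates (W : X1 → X2 → Y1 × Y2 × Z → ℝ) :
    IsClosed (achievableRates W) := by
  refine isClosed_of_closure_subset fun r hr ε hε => ?_
  obtain ⟨s, hs, hrs⟩ := Metric.mem_closure_iff.1 hr (ε / 2) (by positivity)
  have h1 : |s.1 - r.1| ≤ ε / 2 := by
    rw [abs_sub_comm]
    exact ((le_max_left _ _).trans_eq (Prod.dist_eq (x := r) (y := s)).symm).trans hrs.le
  have h2 : |s.2 - r.2| ≤ ε / 2 := by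
    rw [abs_sub_comm]
    exact ((le_max_right _ _).trans_eq (Prod.dist_eq (x := r) (y := s)).symm).trans hrs.le
  have key : ∀ (N : ℕ) {l u v : ℝ}, |l - N * u| ≤ N * (ε / 2) → |u - v| ≤ ε / 2 →
      |l - N * v| ≤ N * ε := fun N l u v hl hu => by
    calc |l - N * v| = |(l - N * u) + N * (u - v)| := by ring_nf
      _ ≤ |l - N * u| + N * |u - v| := by
        refine (abs_add_le _ _).trans_eq ?_
        rw [abs_mul, Nat.abs_cast]
      _ ≤ N * (ε / 2) + N * (ε / 2) := by gcongr
      _ = N * ε := by ring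
  filter_upwards [hs (ε / 2) (by positivity)] with N ⟨M1, M2, hM1, hM2, δ, hδ, hl1, hl2, hN⟩
  exact ⟨M1, M2, hM1, hM2, δ, hδ, key N hl1 h1, key N hl2 h2, by linarith⟩

theorem Achieves.mul {W : X1 → X2 → Y1 × Y2 × Z → ℝ} (hW0 : ∀ x1 x2 p, 0 ≤ W x1 x2 p)
    (hW1 : ∀ x1 x2, ∑ p, W x1 x2 p = 1) {N N' M1 M2 M1' M2' : ℕ} (hM1 : 0 < M1) (hM2 : 0 < M2)
    (hM1' : 0 < M1') (hM2' : 0 < M2') {δ δ' : ℝ} (h : Achieves W N Unit (Fin M1) (Fin M2) δ)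
    (h' : Achieves W N' Unit (Fin M1') (Fin M2') δ') :
    Achieves W (N + N') Unit (Fin (M1 * M1')) (Fin (M2 * M2')) (δ + δ') := by
  have := Fin.pos_iff_nonempty.1 hM1
  have := Fin.pos_iff_nonempty.1 hM2
  have := Fin.pos_iff_nonempty.1 hM1'
  have := Fin.pos_iff_nonempty.1 hM2'
  exact ((h.congr (Equiv.refl _) (Equiv.prodPUnit _) (Equiv.prodPUnit _)).comp hW0 hW1
    (h'.congr (Equiv.prodPUnit _) (Equiv.refl _) (Equiv.refl _))).congr (Equiv.refl _)
      finProdFinEquiv.symm finProdFinEquiv.symm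

theorem eventually_le_natCast_mul (c : ℝ) {ε : ℝ} (hε : 0 < ε) :
    ∀ᶠ n : ℕ in Filter.atTop, c ≤ n * ε :=
  (tendsto_natCast_atTop_atTop.atTop_mul_const hε).eventually_ge_atTop c

theorem convex_achievableRates {W : X1 → X2 → Y1 × Y2 × Z → ℝ} (hW0 : ∀ x1 x2 p, 0 ≤ W x1 x2 p)
    (hW1 : ∀ x1 x2, ∑ p, W x1 x2 p = 1) : Convex ℝ (achievableRates W) := by
  refine convex_iff_forall_pos.2 fun r hr s hs α β hα hβ hαβ ε hε => ?_
  set η := ε * α * β / 4 with hη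
  have hη0 : 0 < η := by positivity
  have hα1 : α ≤ 1 := by linarith
  have hβ1 : β ≤ 1 := by linarith
  have hηα : η ≤ ε * α / 4 := by
    rw [hη]
    nlinarith [mul_pos hε hα]
  have hηβ : η ≤ ε * β / 4 := by
    rw [hη]
    nlinarith [mul_pos hε hβ]
  have hηε : η ≤ ε / 4 := by nlinarith
  have hfl : Filter.Tendsto (fun N : ℕ => ⌊N * α⌋₊) Filter.atTop Filter.atTop :=
    tendsto_nat_floor_atTop.comp (tendsto_natCast_atTop_atTop.atTop_mul_const hα)
  have hle : ∀ N : ℕ, (⌊N * α⌋₊ : ℝ) ≤ N * α := fun N => Nat.floor_le (by positivity)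
  have hleN : ∀ N : ℕ, ⌊N * α⌋₊ ≤ N := fun N => by
    refine Nat.cast_le (α := ℝ).1 ((hle N).trans ?_)
    nlinarith [Nat.cast_nonneg (α := ℝ) N]
  have hge : ∀ N : ℕ, N * β ≤ ((N - ⌊N * α⌋₊ : ℕ) : ℝ) := fun N => by
    rw [Nat.cast_sub (hleN N), show β = 1 - α by linarith]
    linarith [hle N]
  have hsub : Filter.Tendsto (fun N : ℕ => N - ⌊N * α⌋₊) Filter.atTop Filter.atTop := by
    refine (tendsto_natCast_atTop_iff (R := ℝ)).1 ?_
    exact Filter.tendsto_atTop_mono hge (tendsto_natCast_atTop_atTop.atTop_mul_const hβ)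
  have key : ∀ (N : ℕ) {l l' u v : ℝ}, |l - (⌊N * α⌋₊ : ℕ) * u| ≤ (⌊N * α⌋₊ : ℕ) * η →
      |l' - ((N - ⌊N * α⌋₊ : ℕ) : ℝ) * v| ≤ ((N - ⌊N * α⌋₊ : ℕ) : ℝ) * η →
      |u| + |v| ≤ N * (ε / 2) → |l + l' - N * (α * u + β * v)| ≤ N * ε :=
    fun N l l' u v hl hl' huv => by
    have h1 : |(⌊N * α⌋₊ : ℝ) - N * α| ≤ 1 := by
      rw [abs_le]
      constructor <;> linarith [hle N, Nat.lt_floor_add_one (N * α)]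
    have h2 : |((⌊N * α⌋₊ : ℝ) - N * α) * (u - v)| ≤ |u| + |v| := by
      rw [abs_mul]
      calc _ ≤ 1 * |u - v| := by gcongr
        _ ≤ |u| + |v| := by rw [one_mul]; exact abs_sub _ _
    rw [Nat.cast_sub (hleN N)] at hl'
    calc |l + l' - N * (α * u + β * v)|
        = |(l - ⌊N * α⌋₊ * u) + (l' - (N - ⌊N * α⌋₊) * v) +
            ((⌊N * α⌋₊ : ℝ) - N * α) * (u - v)| := by
          rw [show β = 1 - α by linarith]
          ring_nf
      _ ≤ (⌊N * α⌋₊ : ℕ) * η + (N - ⌊N * α⌋₊) * η + (|u| + |v|) :=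
          (abs_add_three _ _ _).trans (by gcongr)
      _ = N * η + (|u| + |v|) := by ring
      _ ≤ N * (ε / 2) + N * (ε / 2) := by gcongr; linarith
      _ = N * ε := by ring
  filter_upwards [hfl.eventually (hr η hη0), hsub.eventually (hs η hη0),
    eventually_le_natCast_mul (|r.1| + |s.1|) (half_pos hε),
    eventually_le_natCast_mul (|r.2| + |s.2|) (half_pos hε),
    eventually_le_natCast_mul 2 hα]
    with N ⟨M1, M2, hM1, hM2, δ, hδ, hl1, hl2, hN⟩ ⟨M1', M2', hM1', hM2', δ', hδ', hl1', hl2', hN'⟩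
      hr1 hr2 hN2
  have : Nonempty (Fin M1) := Fin.pos_iff_nonempty.1 hM1
  have : Nonempty (Fin M2) := Fin.pos_iff_nonempty.1 hM2
  have : Nonempty (Fin M1') := Fin.pos_iff_nonempty.1 hM1'
  have : Nonempty (Fin M2') := Fin.pos_iff_nonempty.1 hM2'
  have hcomp := hδ.mul hW0 hW1 hM1 hM2 hM1' hM2' hδ'
  rw [Nat.add_sub_cancel' (hleN N)] at hcomp
  refine ⟨M1 * M1', M2 * M2', by positivity, by positivity, δ + δ', hcomp, ?_, ?_, ?_⟩
  · rw [Nat.cast_mul, Real.log_mul (by positivity) (by positivity)]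
    exact key N hl1 hl1' hr1
  · rw [Nat.cast_mul, Real.log_mul (by positivity) (by positivity)]
    exact key N hl2 hl2' hr2
  · have h1 : N * δ ≤ ε / 2 := by
      have : N * α / 2 * δ ≤ ε * α / 4 := by
        refine le_trans (mul_le_mul_of_nonneg_right ?_ hδ.error_nonneg) (hN.trans hηα)
        linarith [Nat.lt_floor_add_one (N * α)]
      refine le_of_mul_le_mul_right ?_ hα
      linarith
    have h2 : N * δ' ≤ ε / 4 := by
      have : N * β * δ' ≤ ε * β / 4 :=
        le_trans (mul_le_mul_of_nonneg_right (hge N) hδ'.error_nonneg) (hN'.trans hηβ)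
      refine le_of_mul_le_mul_right ?_ hβ
      linarith
    linarith

theorem eventually_mul_succ_mul_exp_le (C : ℝ) {γ ε : ℝ} (hγ : 0 < γ) (hε : 0 < ε) :
    ∀ᶠ n : ℕ in Filter.atTop, C * (n + 1) * Real.exp (-(n * γ)) ≤ ε := by
  have hq : |Real.exp (-γ)| < 1 := by
    rw [abs_of_pos (Real.exp_pos _)]
    exact Real.exp_lt_one_iff.2 (by linarith)
  have h1 := tendsto_pow_const_mul_const_pow_of_abs_lt_one 1 hq
  have h0 := tendsto_pow_const_mul_const_pow_of_abs_lt_one 0 hq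
  have h := ((h1.add h0).const_mul C)
  rw [add_zero, mul_zero] at h
  filter_upwards [h.eventually_le_const hε] with n hn
  refine le_trans (le_of_eq ?_) hn
  rw [← Real.exp_nat_mul]
  ring_nf

theorem mem_achievableRates_of_blocks {W : X1 → X2 → Y1 × Y2 × Z → ℝ} {B : ℕ} (hB : 0 < B)
    {a : ℝ × ℝ} {C γ : ℝ} (hγ : 0 < γ)
    (h : ∀ᶠ n : ℕ in Filter.atTop, ∀ r : ℕ, ∃ M1 M2 : ℕ, 0 < M1 ∧ 0 < M2 ∧
      Achieves W (B * n + r) Unit (Fin M1) (Fin M2) (C * Real.exp (-(n * γ))) ∧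
        |Real.log M1 - n * a.1| ≤ C ∧ |Real.log M2 - n * a.2| ≤ C) :
    (B : ℝ)⁻¹ • a ∈ achievableRates W := by
  intro ε hε
  have hdiv : Filter.Tendsto (fun N : ℕ => N / B) Filter.atTop Filter.atTop :=
    Nat.tendsto_div_const_atTop hB.ne'
  have hB' : (0 : ℝ) < B := Nat.cast_pos.2 hB
  have key : ∀ (N : ℕ) {l u : ℝ}, |l - (N / B : ℕ) * u| ≤ C → C + |u| ≤ N * ε →
      |l - N * ((B : ℝ)⁻¹ * u)| ≤ N * ε := fun N l u hl hu => by
    have h1 : |((N / B : ℕ) : ℝ) - N * (B : ℝ)⁻¹| ≤ 1 := by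
      rw [← div_eq_mul_inv, ← Nat.floor_div_eq_div (K := ℝ), abs_le]
      constructor <;> linarith [Nat.floor_le (show (0 : ℝ) ≤ N / B by positivity),
        Nat.lt_floor_add_one ((N : ℝ) / B)]
    calc |l - N * ((B : ℝ)⁻¹ * u)|
        = |(l - (N / B : ℕ) * u) + (((N / B : ℕ) : ℝ) - N * (B : ℝ)⁻¹) * u| := by ring_nf
      _ ≤ C + 1 * |u| := (abs_add_le _ _).trans (by rw [abs_mul]; gcongr)
      _ ≤ N * ε := by linarith
  filter_upwards [hdiv.eventually h, hdiv.eventually (eventually_mul_succ_mul_exp_le (B * C) hγ hε),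
    eventually_le_natCast_mul (C + |a.1|) hε, eventually_le_natCast_mul (C + |a.2|) hε]
    with N hN hN1 hN2 hN3
  obtain ⟨M1, M2, hM1, hM2, hA, hl1, hl2⟩ := hN (N % B)
  rw [Nat.div_add_mod] at hA
  have : Nonempty (Fin M1) := Fin.pos_iff_nonempty.1 hM1
  have : Nonempty (Fin M2) := Fin.pos_iff_nonempty.1 hM2
  refine ⟨M1, M2, hM1, hM2, _, hA, key N hl1 hN2, key N hl2 hN3, le_trans ?_ hN1⟩
  have hNB : (N : ℝ) ≤ B * ((N / B : ℕ) + 1) := by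
    exact_mod_cast (Nat.lt_mul_div_succ N hB).le
  calc _ ≤ B * ((N / B : ℕ) + 1) * (C * Real.exp (-((N / B : ℕ) * γ))) :=
        mul_le_mul_of_nonneg_right hNB hA.error_nonneg
    _ = _ := by ring

theorem zero_mem_achievableRates {W : X1 → X2 → Y1 × Y2 × Z → ℝ} (hW0 : ∀ x1 x2 p, 0 ≤ W x1 x2 p)
    (hW1 : ∀ x1 x2, ∑ p, W x1 x2 p = 1) [Nonempty X1] [Nonempty X2] :
    (0 : ℝ × ℝ) ∈ achievableRates W := by
  intro ε hε
  refine Filter.Eventually.of_forall fun N => ⟨1, 1, one_pos, one_pos, 0, ?_, ?_, ?_, ?_⟩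
  · exact (Achieves.trivial hW0 hW1 N Unit).congr (Equiv.refl _) (Equiv.equivPUnit _)
      (Equiv.equivPUnit _)
  · simp
    positivity
  · simp
    positivity
  · simpa using hε.le

theorem natFloor_exp_bounds {n : ℕ} {c : ℝ} (hc : 0 ≤ c) :
    0 < ⌊Real.exp (n * c)⌋₊ ∧ (⌊Real.exp (n * c)⌋₊ : ℝ) ≤ Real.exp (n * c) ∧
      Real.exp (n * c) ≤ 2 * ⌊Real.exp (n * c)⌋₊ ∧
      |Real.log ⌊Real.exp (n * c)⌋₊ - n * c| ≤ 1 := by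
  have h1 := Real.one_le_exp (mul_nonneg (Nat.cast_nonneg n) hc)
  have hpos : 0 < ⌊Real.exp (n * c)⌋₊ := Nat.floor_pos.2 h1
  have hle := Nat.floor_le (Real.exp_pos (n * c)).le
  have h1' : (1 : ℝ) ≤ ⌊Real.exp (n * c)⌋₊ := by exact_mod_cast hpos
  have h2 : Real.exp (n * c) ≤ 2 * ⌊Real.exp (n * c)⌋₊ := by
    linarith [(Nat.lt_floor_add_one (Real.exp (n * c))).le]
  refine ⟨hpos, hle, h2, ?_⟩
  have h3 := Real.log_le_log (by positivity) hle
  have h4 := Real.log_le_log (Real.exp_pos _) h2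
  rw [Real.log_exp] at h3 h4
  rw [Real.log_mul two_ne_zero (by positivity)] at h4
  have h5 := Real.log_two_lt_d9
  rw [abs_le]
  constructor <;> linarith

theorem exists_key_rate {I R l : ℝ} (hR : 0 ≤ R) (hRI : R ≤ I) (hl0 : 0 < l) (hl1 : l < 1) :
    ∃ e : ℝ, 0 < e ∧ ∀ ε : ℝ, 0 < ε → ε ≤ e → ∃ k : ℝ, 0 ≤ k ∧ I - l * R - ε ≤ k ∧
      ∀ n : ℕ, (⌊Real.exp (n * (l * R))⌋₊ * ⌊Real.exp (n * k)⌋₊ - 1 : ℝ) ≤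
        Real.exp (n * (I - ε)) := by
  rcases (hR.trans hRI).eq_or_lt with hI | hI
  · obtain rfl : R = 0 := by linarith
    refine ⟨1, one_pos, fun ε hε _ => ⟨0, le_rfl, by rw [← hI]; linarith, fun n => ?_⟩⟩
    simpa using (Real.exp_pos _).le
  · refine ⟨(1 - l) * I, mul_pos (by linarith) hI, fun ε hε hεe => ⟨I - ε - l * R, ?_, by linarith,
      fun n => ?_⟩⟩
    · nlinarith
    · have h1 := Nat.floor_le (Real.exp_pos (n * (l * R))).le
      have h2 := Nat.floor_le (Real.exp_pos (n * (I - ε - l * R))).le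
      calc _ ≤ (⌊Real.exp (n * (l * R))⌋₊ * ⌊Real.exp (n * (I - ε - l * R))⌋₊ : ℝ) := by linarith
        _ ≤ Real.exp (n * (l * R)) * Real.exp (n * (I - ε - l * R)) := by gcongr
        _ = _ := by rw [← Real.exp_add]; ring_nf

theorem InputDist.mem_achievableRates_of_lt (d : InputDist X1 X2) {W : X1 → X2 → Y1 × Y2 × Z → ℝ}
    (hW0 : ∀ x1 x2 p, 0 ≤ W x1 x2 p) (hW1 : ∀ x1 x2, ∑ p, W x1 x2 p = 1)
    [Nonempty X1] [Nonempty X2] {r : ℝ × ℝ} (hr1 : 0 ≤ r.1) (hr2 : 0 ≤ r.2)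
    (h1 : r.1 ≤ kernelInfo d.PV1 (d.obs2 W)) (h2 : r.2 ≤ kernelInfo d.PV2 (d.obs1 W))
    (h12 : r.1 + r.2 ≤ kernelInfo d.PV1 (d.obs2 W) + kernelInfo d.PV2 (d.obs1 W) -
      kernelInfo (fun v : d.V1 × d.V2 => d.PV1 v.1 * d.PV2 v.2) (d.tap W))
    (hS : kernelInfo (fun v : d.V1 × d.V2 => d.PV1 v.1 * d.PV2 v.2) (d.tap W) <
      kernelInfo d.PV1 (d.obs2 W) + kernelInfo d.PV2 (d.obs1 W))
    {l : ℝ} (hl0 : 0 < l) (hl1 : l < 1) : l • r ∈ achievableRates W := by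
  obtain ⟨γ', hγ', κ, hκ, hkey⟩ := d.exists_key hW0 hW1 hS
  obtain ⟨e1, he1, hk1⟩ := exists_key_rate hr1 h1 hl0 hl1
  obtain ⟨e2, he2, hk2⟩ := exists_key_rate hr2 h2 hl0 hl1
  have hrc : ∀ ε : ℝ, 0 < ε → _ := fun ε hε => d.exists_achieves (W := W) hW0 hW1 hε
  set I1 := kernelInfo d.PV1 (d.obs2 W)
  set I2 := kernelInfo d.PV2 (d.obs1 W)
  set I := kernelInfo (fun v : d.V1 × d.V2 => d.PV1 v.1 * d.PV2 v.2) (d.tap W)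
  set ε := min (min e1 e2) ((1 - l) * (I1 + I2 - I) / 4) with hεdef
  have hε : 0 < ε := lt_min (lt_min he1 he2) (by
    have := mul_pos (sub_pos.2 hl1) (sub_pos.2 hS)
    positivity)
  have hε4 : 4 * ε ≤ (1 - l) * (I1 + I2 - I) := by
    have : ε ≤ (1 - l) * (I1 + I2 - I) / 4 := min_le_right _ _
    linarith
  obtain ⟨k1, hk10, hk1r, hk1n⟩ := hk1 ε hε ((min_le_left _ _).trans (min_le_left _ _))
  obtain ⟨k2, hk20, hk2r, hk2n⟩ := hk2 ε hε ((min_le_left _ _).trans (min_le_right _ _))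
  obtain ⟨γ, hγ, hrc⟩ := hrc ε hε
  have hk12 : I + 2 * ε ≤ k1 + k2 := by nlinarith
  obtain ⟨c, hc⟩ := exists_nat_ge ((I + ε) / κ)
  rw [div_le_iff₀ hκ] at hc
  have hblock : ∀ b : ℕ, ((c + (b + 1) : ℕ) : ℝ)⁻¹ • ((b + 1 : ℕ) : ℝ) • l • r ∈
      achievableRates W := fun b => by
    refine mem_achievableRates_of_blocks (C := 6 * (c + (b + 1) : ℕ)) (γ := min γ γ')
      (by positivity)
      (lt_min hγ hγ') ?_
    filter_upwards [hkey, eventually_le_exp_mul 4 hε] with n ⟨a1, a2, ha1, ha2, ha, hA⟩ hn4 s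
    obtain ⟨hm1, hm1', -, hm1l⟩ := natFloor_exp_bounds (n := n) (mul_nonneg hl0.le hr1)
    obtain ⟨hm2, hm2', -, hm2l⟩ := natFloor_exp_bounds (n := n) (mul_nonneg hl0.le hr2)
    obtain ⟨hj1, -, hj1', -⟩ := natFloor_exp_bounds (n := n) hk10
    obtain ⟨hj2, -, hj2', -⟩ := natFloor_exp_bounds (n := n) hk20
    have hn1 := hk1n n
    have hn2 := hk2n n
    set m1 := ⌊Real.exp (n * (l * r.1))⌋₊
    set m2 := ⌊Real.exp (n * (l * r.2))⌋₊
    set j1 := ⌊Real.exp (n * k1)⌋₊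
    set j2 := ⌊Real.exp (n * k2)⌋₊
    have := Fin.pos_iff_nonempty.1 hm1
    have := Fin.pos_iff_nonempty.1 hm2
    have := Fin.pos_iff_nonempty.1 hj1
    have := Fin.pos_iff_nonempty.1 hj2
    have := Fin.pos_iff_nonempty.1 ha1
    have := Fin.pos_iff_nonempty.1 ha2
    have hblk := fun (K : Type) [Fintype K] [Nonempty K] =>
      hrc n K (Fin m1 × Fin j1) (Fin m2 × Fin j2) Unit Unit (Or.inl inferInstance)
        (Or.inl inferInstance) (by simpa using hn1) (by simpa using hn2)
    have hfirst := hblk ((Fin c → Fin a1) × (Fin c → Fin a2)) (by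
      simp only [Fintype.card_prod, Fintype.card_fun, Fintype.card_fin, Fintype.card_unit, mul_one,
        Nat.cast_mul, Nat.cast_pow]
      rw [← mul_pow]
      calc Real.exp (n * (I + ε)) ≤ Real.exp (c * (n * κ)) := by
            refine Real.exp_le_exp.2 ?_
            rw [mul_left_comm]
            gcongr
        _ = Real.exp (n * κ) ^ c := Real.exp_nat_mul _ _
        _ ≤ _ := by gcongr)
    have hnext := hblk (Fin j1 × Fin j2) (by
      simp only [Fintype.card_prod, Fintype.card_fin, Fintype.card_unit, mul_one, Nat.cast_mul]
      have h4 : 4 * Real.exp (n * (I + ε)) ≤ Real.exp (n * k1) * Real.exp (n * k2) := by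
        calc 4 * Real.exp (n * (I + ε)) ≤ Real.exp (n * ε) * Real.exp (n * (I + ε)) := by gcongr
          _ = Real.exp (n * (I + 2 * ε)) := by rw [← Real.exp_add]; ring_nf
          _ ≤ Real.exp (n * (k1 + k2)) := by gcongr
          _ = _ := by rw [← Real.exp_add]; ring_nf
      have h5 : Real.exp (n * k1) * Real.exp (n * k2) ≤ (2 * j1) * (2 * j2) := by gcongr
      linarith)
    have hall := ((hA.pow hW0 hW1 c).bootstrap hW0 hW1 hfirst hnext s b).congr (Equiv.refl _)
      (finFunctionFinEquiv.symm : Fin (m1 ^ (b + 1)) ≃ _)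
      (finFunctionFinEquiv.symm : Fin (m2 ^ (b + 1)) ≃ _)
    have hlen : (c + (b + 1)) * n + s = c * n + (n + (b * n + s)) := by ring
    have hlog : ∀ {m : ℕ} {x : ℝ}, |Real.log m - n * (l * x)| ≤ 1 →
        |Real.log ((m ^ (b + 1) : ℕ) : ℝ) - n * (((b + 1 : ℕ) : ℝ) * (l * x))| ≤
          6 * (c + (b + 1) : ℕ) := fun {m x} hm => by
      rw [Nat.cast_pow, Real.log_pow]
      calc _ = ((b + 1 : ℕ) : ℝ) * |Real.log m - n * (l * x)| := by
            rw [← Nat.abs_cast (b + 1), ← abs_mul, Nat.abs_cast]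
            ring_nf
        _ ≤ ((b + 1 : ℕ) : ℝ) * 1 := by gcongr
        _ ≤ _ := by
            push_cast
            linarith [Nat.cast_nonneg (α := ℝ) c, Nat.cast_nonneg (α := ℝ) b]
    refine ⟨m1 ^ (b + 1), m2 ^ (b + 1), by positivity, by positivity, ?_, hlog hm1l, hlog hm2l⟩
    rw [hlen]
    refine hall.mono ?_
    have hγ1 : Real.exp (-(n * γ)) ≤ Real.exp (-(n * min γ γ')) := by
      gcongr
      exact min_le_left _ _
    have hγ2 : Real.exp (-(n * γ')) ≤ Real.exp (-(n * min γ γ')) := by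
      gcongr
      exact min_le_right _ _
    calc _ ≤ c * (6 * Real.exp (-(n * min γ γ'))) + (6 * Real.exp (-(n * min γ γ')) +
          b * (6 * Real.exp (-(n * min γ γ')))) := by gcongr
      _ = _ := by
          push_cast
          ring
  refine (isClosed_achievableRates W).mem_of_tendsto (b := Filter.atTop) ?_
    (Filter.Eventually.of_forall hblock)
  have hlim := (tendsto_natCast_div_add_atTop (c : ℝ)).comp (Filter.tendsto_add_atTop_nat 1)
  have hlim' := hlim.smul_const (l • r)
  rw [one_smul] at hlim'
  refine hlim'.congr fun b => ?_
  rw [Function.comp_apply, div_eq_inv_mul, mul_smul]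
  push_cast
  rw [add_comm (c : ℝ)]

theorem InputDist.mem_achievableRates (d : InputDist X1 X2) {W : X1 → X2 → Y1 × Y2 × Z → ℝ}
    (hW0 : ∀ x1 x2 p, 0 ≤ W x1 x2 p) (hW1 : ∀ x1 x2, ∑ p, W x1 x2 p = 1)
    [Nonempty X1] [Nonempty X2] {r : ℝ × ℝ} (hr1 : 0 ≤ r.1) (hr2 : 0 ≤ r.2)
    (h1 : r.1 ≤ kernelInfo d.PV1 (d.obs2 W)) (h2 : r.2 ≤ kernelInfo d.PV2 (d.obs1 W))
    (h12 : r.1 + r.2 ≤ kernelInfo d.PV1 (d.obs2 W) + kernelInfo d.PV2 (d.obs1 W) -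
      kernelInfo (fun v : d.V1 × d.V2 => d.PV1 v.1 * d.PV2 v.2) (d.tap W)) :
    r ∈ achievableRates W := by
  rcases lt_or_ge (kernelInfo (fun v : d.V1 × d.V2 => d.PV1 v.1 * d.PV2 v.2) (d.tap W))
    (kernelInfo d.PV1 (d.obs2 W) + kernelInfo d.PV2 (d.obs1 W)) with hS | hS
  · have hlim : Filter.Tendsto (fun l : ℝ => l • r) (nhdsWithin 1 (Set.Iio 1)) (nhds r) := by
      have : ContinuousWithinAt (fun l : ℝ => l • r) (Set.Iio 1) 1 := by fun_prop
      simpa [ContinuousWithinAt] using this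
    refine (isClosed_achievableRates W).mem_of_tendsto hlim ?_
    filter_upwards [Ioo_mem_nhdsLT (zero_lt_one (α := ℝ))] with l hl
    exact d.mem_achievableRates_of_lt hW0 hW1 hr1 hr2 h1 h2 h12 hS hl.1 hl.2
  · have : r = 0 := Prod.ext (show r.1 = 0 by linarith) (show r.2 = 0 by linarith)
    rw [this]
    exact zero_mem_achievableRates hW0 hW1

theorem Achieves.exists_code {W : X1 → X2 → Y1 × Y2 × Z → ℝ} (hW0 : ∀ x1 x2 p, 0 ≤ W x1 x2 p)
    (hW1 : ∀ x1 x2, ∑ p, W x1 x2 p = 1) [Nonempty Z] {N L1 L2 : ℕ} [NeZero L1] [NeZero L2] {δ : ℝ}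
    (h : Achieves W N Unit (Fin L1) (Fin L2) δ) :
    ∃ (φ1 : Fin N → Fin L1 → (Fin N → X1) → (Fin N → Y1) → X1 → ℝ)
      (φ2 : Fin N → Fin L2 → (Fin N → X2) → (Fin N → Y2) → X2 → ℝ)
      (ψ1 : Fin L1 → (Fin N → X1) → (Fin N → Y1) → Fin L2)
      (ψ2 : Fin L2 → (Fin N → X2) → (Fin N → Y2) → Fin L1),
      Causal N L1 φ1 ∧ Causal N L2 φ2 ∧
      (∀ k m xs ys, (∀ a, 0 ≤ φ1 k m xs ys a) ∧ ∑ a, φ1 k m xs ys a = 1) ∧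
      (∀ k m xs ys, (∀ a, 0 ≤ φ2 k m xs ys a) ∧ ∑ a, φ2 k m xs ys a = 1) ∧
      PeA N L1 L2 W φ1 φ2 ψ1 ψ2 ≤ 2 * δ ∧ 0 ≤ leakJointA N L1 L2 W φ1 φ2 ∧
      leakJointA N L1 L2 W φ1 φ2 ≤
        (δ + Real.exp (-N)) * (1 + N * (Real.log (Fintype.card Z) + 1)) := by
  obtain ⟨G1, G2, q, hG1, hG2, hq, hq1, hδ⟩ := h
  simp only [univ_unique, expect_singleton, PUnit.default_eq_unit] at hδ
  choose φ1 hc1 hp1 he1 using fun m => (hG1 () m).2.exists_encoder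
  choose φ2 hc2 hp2 he2 using fun m => (hG2 () m).2.exists_encoder
  let T := Transcript X1 X2 Y1 Y2 N × (Fin N → Z)
  let ω : T → ℝ := fun t => ∏ k, W (t.1.1 k) (t.1.2.1 k) (t.1.2.2.1 k, t.1.2.2.2 k, t.2 k)
  let F1 : Fin L1 → T → ℝ := fun m t => ∑ b, G1 () m t.1.1 t.1.2.2.1 b
  let F2 : Fin L2 → T → ℝ := fun m t => ∑ b, G2 () m t.1.2.1 t.1.2.2.2 b
  have hω : ∀ t, 0 ≤ ω t := fun t => prod_nonneg fun _ _ => hW0 _ _ _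
  have hF1 : ∀ m t, 0 ≤ F1 m t := fun m t => sum_nonneg fun b _ => (hG1 _ _).1 _ _ _
  have hF2 : ∀ m t, 0 ≤ F2 m t := fun m t => sum_nonneg fun b _ => (hG2 _ _).1 _ _ _
  have hg1 : ∀ m1 m2 t, G1 () m1 t.1.1 t.1.2.2.1 m2 ≤ F1 m1 t := fun m1 m2 t =>
    single_le_sum (f := fun b => G1 () m1 t.1.1 t.1.2.2.1 b) (fun b _ => (hG1 _ _).1 _ _ _)
      (mem_univ _)
  have hg2 : ∀ m1 m2 t, G2 () m2 t.1.2.1 t.1.2.2.2 m1 ≤ F2 m2 t := fun m1 m2 t =>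
    single_le_sum (f := fun b => G2 () m2 t.1.2.1 t.1.2.2.2 b) (fun b _ => (hG2 _ _).1 _ _ _)
      (mem_univ _)
  choose ψ1 hψ1 using fun m1 : Fin L1 => exists_decoder
    (fun t : T => (t.1.1, t.1.2.2.1)) (fun (m2 : Fin L2) t => F2 m2 t * ω t)
  choose ψ2 hψ2 using fun m2 : Fin L2 => exists_decoder
    (fun t : T => (t.1.2.1, t.1.2.2.2)) (fun (m1 : Fin L1) t => F1 m1 t * ω t)
  let w : ℝ := 1 / ((L1 : ℝ) * (L2 : ℝ))
  have hw0 : 0 ≤ w := by positivity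
  have hwc : w = (Fintype.card (Fin L1 × Fin L2) : ℝ)⁻¹ := by simp [w]
  have hw : ∀ f : Fin L1 × Fin L2 → ℝ, ∑ m1, ∑ m2, w * f (m1, m2) = 𝔼 m, f m := fun f => by
    rw [← Fintype.sum_prod_type' (f := fun m1 m2 => w * f (m1, m2)), ← mul_sum,
      Fintype.expect_eq_sum_div_card, hwc, div_eq_inv_mul]
  have hout : ∀ (m : Fin L1 × Fin L2) z, interact W N (fun x y => ∑ b, G1 () m.1 x y b)
      (fun x y => ∑ b, G2 () m.2 x y b) z = ∑ p, F1 m.1 (p, z) * F2 m.2 (p, z) * ω (p, z) :=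
    fun _ _ => rfl
  have hout1 : ∀ m : Fin L1 × Fin L2, ∑ t : T, F1 m.1 t * F2 m.2 t * ω t = 1 := fun m => by
    rw [← sum_interact_eq_one hW1 (hG1 () m.1).2 (hG2 () m.2).2, Fintype.sum_prod_type_right]
    rfl
  have hcorr : ∀ m : Fin L1 × Fin L2, 1 - ∑ z, max (q z - interact W N
      (fun x y => G1 () m.1 x y m.2) (fun x y => G2 () m.2 x y m.1) z) 0 ≤
      ∑ t : T, G1 () m.1 t.1.1 t.1.2.2.1 m.2 * G2 () m.2 t.1.2.1 t.1.2.2.2 m.1 * ω t := by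
    intro m
    have e : ∑ t : T, G1 () m.1 t.1.1 t.1.2.2.1 m.2 * G2 () m.2 t.1.2.1 t.1.2.2.2 m.1 * ω t =
      ∑ z, interact W N (fun x y => G1 () m.1 x y m.2) (fun x y => G2 () m.2 x y m.1) z := by
      rw [Fintype.sum_prod_type_right]
      rfl
    rw [e, ← hq1, ← sum_sub_distrib]
    refine sum_le_sum fun z _ => ?_
    linarith [le_max_left (q z - interact W N
      (fun x y => G1 () m.1 x y m.2) (fun x y => G2 () m.2 x y m.1) z) 0]
  have hcorr' : 1 - δ ≤ ∑ m1, ∑ m2, w * ∑ t : T, G1 () m1 t.1.1 t.1.2.2.1 m2 *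
      G2 () m2 t.1.2.1 t.1.2.2.2 m1 * ω t := by
    rw [hw fun m => ∑ t : T, G1 () m.1 t.1.1 t.1.2.2.1 m.2 * G2 () m.2 t.1.2.1 t.1.2.2.2 m.1 * ω t]
    refine le_trans ?_ (expect_le_expect fun m _ => hcorr m)
    rw [expect_sub_distrib, Fintype.expect_const]
    linarith
  have herr1 : 1 - δ ≤ ∑ m1, ∑ m2, w * ∑ t : T,
      (if ψ1 m1 (t.1.1, t.1.2.2.1) = m2 then 1 else 0) * (F1 m1 t * F2 m2 t * ω t) := by
    refine hcorr'.trans (sum_le_sum fun m1 _ => ?_)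
    rw [← mul_sum, ← mul_sum]
    refine mul_le_mul_of_nonneg_left ?_ hw0
    refine le_trans ?_ ((hψ1 m1 (fun o m2 => G1 () m1 o.1 o.2 m2)
      fun o m2 => (hG1 _ _).1 _ _ _).trans (le_of_eq ?_))
    · refine sum_le_sum fun m2 _ => sum_le_sum fun t _ => ?_
      rw [mul_assoc]
      exact mul_le_mul_of_nonneg_left (mul_le_mul_of_nonneg_right (hg2 _ _ _) (hω t))
        ((hG1 _ _).1 _ _ _)
    · refine sum_congr rfl fun m2 _ => sum_congr rfl fun t _ => ?_
      simp only [F1]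
      split_ifs <;> ring
  have herr2 : 1 - δ ≤ ∑ m1, ∑ m2, w * ∑ t : T,
      (if ψ2 m2 (t.1.2.1, t.1.2.2.2) = m1 then 1 else 0) * (F1 m1 t * F2 m2 t * ω t) := by
    rw [sum_comm] at hcorr' ⊢
    refine hcorr'.trans (sum_le_sum fun m2 _ => ?_)
    rw [← mul_sum, ← mul_sum]
    refine mul_le_mul_of_nonneg_left ?_ hw0
    refine le_trans ?_ ((hψ2 m2 (fun o m1 => G2 () m2 o.1 o.2 m1)
      fun o m1 => (hG2 _ _).1 _ _ _).trans (le_of_eq ?_))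
    · refine sum_le_sum fun m1 _ => sum_le_sum fun t _ => ?_
      rw [mul_comm (G1 _ _ _ _ _), mul_assoc]
      exact mul_le_mul_of_nonneg_left (mul_le_mul_of_nonneg_right (hg1 _ _ _) (hω t))
        ((hG2 _ _).1 _ _ _)
    · refine sum_congr rfl fun m1 _ => sum_congr rfl fun t _ => ?_
      simp only [F2]
      split_ifs <;> ring
  have hfull : ∀ (m1 : Fin L1) (m2 : Fin L2) (t : T),
      PfullA N L1 L2 W (fun k m => φ1 m k) (fun k m => φ2 m k)
        ((m1, m2), t.1.1, t.1.2.1, t.1.2.2.1, t.1.2.2.2, t.2) =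
      w * (F1 m1 t * F2 m2 t * ω t) := by
    intro m1 m2 t
    simp only [PfullA, F1, F2, he1, he2, ω, w]
    ring
  refine ⟨fun k m => φ1 m k, fun k m => φ2 m k, fun m x y => ψ1 m (x, y), fun m x y => ψ2 m (x, y),
    fun k m x x' y y' h => hc1 m k x x' y y' h, fun k m x x' y y' h => hc2 m k x x' y y' h,
    fun k m => hp1 m k, fun k m => hp2 m k, ?_, ?_⟩
  · have e : PeA N L1 L2 W (fun k m => φ1 m k) (fun k m => φ2 m k) (fun m x y => ψ1 m (x, y))
        (fun m x y => ψ2 m (x, y)) = ∑ m1, ∑ m2, ∑ t : T, w * (F1 m1 t * F2 m2 t * ω t) *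
          (if ψ1 m1 (t.1.1, t.1.2.2.1) ≠ m2 ∨ ψ2 m2 (t.1.2.1, t.1.2.2.2) ≠ m1 then 1 else 0) := by
      simp only [PeA, ← hfull, T, Transcript, Fintype.sum_prod_type]
    have e1 : ∑ m1, ∑ m2, w * ∑ t : T, F1 m1 t * F2 m2 t * ω t = 1 := by
      rw [hw fun m => ∑ t : T, F1 m.1 t * F2 m.2 t * ω t]
      simp only [hout1, Fintype.expect_const]
    have : PeA N L1 L2 W (fun k m => φ1 m k) (fun k m => φ2 m k) (fun m x y => ψ1 m (x, y))
        (fun m x y => ψ2 m (x, y)) ≤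
        2 * (∑ m1, ∑ m2, w * ∑ t : T, F1 m1 t * F2 m2 t * ω t) -
        (∑ m1, ∑ m2, w * ∑ t : T,
          (if ψ1 m1 (t.1.1, t.1.2.2.1) = m2 then 1 else 0) * (F1 m1 t * F2 m2 t * ω t)) -
        ∑ m1, ∑ m2, w * ∑ t : T,
          (if ψ2 m2 (t.1.2.1, t.1.2.2.2) = m1 then 1 else 0) * (F1 m1 t * F2 m2 t * ω t) := by
      rw [e]
      simp only [mul_sum, ← sum_sub_distrib]
      refine sum_le_sum fun m1 _ => sum_le_sum fun m2 _ => sum_le_sum fun t _ => ?_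
      have := mul_nonneg hw0 (mul_nonneg (mul_nonneg (hF1 m1 t) (hF2 m2 t)) (hω t))
      by_cases h1 : ψ1 m1 (t.1.1, t.1.2.2.1) = m2 <;>
        by_cases h2 : ψ2 m2 (t.1.2.1, t.1.2.2.2) = m1 <;> simp [h1, h2] <;> linarith
    linarith
  · let P : Fin L1 × Fin L2 → (Fin N → Z) → ℝ := fun m => interact W N
      (fun x y => ∑ b, G1 () m.1 x y b) (fun x y => ∑ b, G2 () m.2 x y b)
    have hP : ∀ m z, 0 ≤ P m z := fun m z =>
      interact_nonneg hW0 (fun _ _ => sum_nonneg fun _ _ => (hG1 _ _).1 _ _ _)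
        (fun _ _ => sum_nonneg fun _ _ => (hG2 _ _).1 _ _ _) z
    have hP1 : ∀ m, ∑ z, P m z = 1 := fun m =>
      sum_interact_eq_one hW1 (hG1 () m.1).2 (hG2 () m.2).2
    have e : leakJointA N L1 L2 W (fun k m => φ1 m k) (fun k m => φ2 m k) =
        miDist fun p : (Fin L1 × Fin L2) × (Fin N → Z) =>
          (Fintype.card (Fin L1 × Fin L2) : ℝ)⁻¹ * P p.1 p.2 := by
      unfold leakJointA
      congr 1
      funext p
      rw [← hwc]
      simp only [P, hout, mul_sum, ← hfull, Transcript, Fintype.sum_prod_type]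
    have hη : (0 : ℝ) < Real.exp (-N) := Real.exp_pos _
    have hη1 : Real.exp (-N) ≤ 1 := Real.exp_le_one_iff.2 (by simp)
    have hS : (0 : ℝ) < Fintype.card (Fin N → Z) := by exact_mod_cast Fintype.card_pos
    have hr : ∀ z, 0 < (1 - Real.exp (-N)) * q z + Real.exp (-N) / Fintype.card (Fin N → Z) :=
      fun z => add_pos_of_nonneg_of_pos (mul_nonneg (by linarith) (hq z)) (by positivity)
    have hwt : (0 : ℝ) ≤ (Fintype.card (Fin L1 × Fin L2) : ℝ)⁻¹ := by positivity
    rw [e]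
    refine ⟨miDist_nonneg (fun p => mul_nonneg hwt (hP p.1 p.2)) ?_,
      (miDist_le_sum_log P hP hP1 _ hr ?_).trans
      ((expect_le_expect fun m _ => sum_mul_log_le (P m) q (hP m) (hP1 m) hq hq1 hη hη1).trans ?_)⟩
    · rw [Fintype.sum_prod_type]
      simp only [← mul_sum, hP1]
      rw [sum_const, card_univ, nsmul_eq_mul, mul_one]
      exact inv_mul_cancel₀ (Nat.cast_ne_zero.2 Fintype.card_ne_zero)
    · simp only [sum_add_distrib, ← mul_sum, hq1]
      simp only [sum_const, card_univ, nsmul_eq_mul]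
      field_simp
      ring
    · rw [← expect_mul, expect_add_distrib, Fintype.expect_const]
      have hlog : Real.log (Fintype.card (Fin N → Z) / Real.exp (-N)) =
          N * (Real.log (Fintype.card Z) + 1) := by
        rw [Real.log_div hS.ne' hη.ne', Real.log_exp]
        simp
        ring
      have hZ : 0 ≤ Real.log (Fintype.card Z) :=
        Real.log_nonneg (by exact_mod_cast Fintype.card_pos)
      rw [hlog]
      refine mul_le_mul_of_nonneg_right (add_le_add_left (le_trans ?_ hδ) _) (by positivity)
      refine expect_le_expect fun m _ => sum_le_sum fun z _ =>
        max_le_max_right _ (sub_le_sub_left ?_ _)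
      exact interact_mono hW0 (fun _ _ => (hG1 _ _).1 _ _ _) (fun _ _ => (hG2 _ _).1 _ _ _)
        (fun x y => single_le_sum (f := fun b => G1 () m.1 x y b)
          (fun b _ => (hG1 _ _).1 _ _ _) (mem_univ _))
        (fun x y => single_le_sum (f := fun b => G2 () m.2 x y b)
          (fun b _ => (hG2 _ _).1 _ _ _) (mem_univ _)) z


theorem PeA_nonneg {W : X1 → X2 → Y1 × Y2 × Z → ℝ} (hW0 : ∀ x1 x2 p, 0 ≤ W x1 x2 p) {N L1 L2 : ℕ}
    {φ1 : Fin N → Fin L1 → (Fin N → X1) → (Fin N → Y1) → X1 → ℝ}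
    {φ2 : Fin N → Fin L2 → (Fin N → X2) → (Fin N → Y2) → X2 → ℝ}
    (h1 : ∀ k m xs ys a, 0 ≤ φ1 k m xs ys a) (h2 : ∀ k m xs ys a, 0 ≤ φ2 k m xs ys a)
    (ψ1 : Fin L1 → (Fin N → X1) → (Fin N → Y1) → Fin L2)
    (ψ2 : Fin L2 → (Fin N → X2) → (Fin N → Y2) → Fin L1) :
    0 ≤ PeA N L1 L2 W φ1 φ2 ψ1 ψ2 := by
  refine sum_nonneg fun _ _ => sum_nonneg fun _ _ => sum_nonneg fun _ _ => sum_nonneg fun _ _ =>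
    sum_nonneg fun _ _ => sum_nonneg fun _ _ => sum_nonneg fun _ _ => mul_nonneg ?_ ?_
  · exact mul_nonneg (mul_nonneg (mul_nonneg (by positivity) (prod_nonneg fun _ _ => h1 _ _ _ _ _))
      (prod_nonneg fun _ _ => h2 _ _ _ _ _)) (prod_nonneg fun _ _ => hW0 _ _ _)
  · split_ifs <;> norm_num

theorem exists_tendsto_zero_of_eventually {P : ℝ → ℕ → Prop}
    (hmono : ∀ {ε ε' : ℝ} {N : ℕ}, ε ≤ ε' → P ε N → P ε' N) (h0 : ∀ N : ℕ, ∃ ε, P ε N)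
    (h : ∀ ε, 0 < ε → ∀ᶠ N in Filter.atTop, P ε N) :
    ∃ f : ℕ → ℝ, Filter.Tendsto f Filter.atTop (nhds 0) ∧ ∀ N, P (f N) N := by
  let E : ℕ → Set ℝ := fun N => {ε | 0 ≤ ε ∧ P ε N}
  have hE : ∀ N, (E N).Nonempty := fun N =>
    let ⟨ε, hε⟩ := h0 N
    ⟨max ε 0, le_max_right _ _, hmono (le_max_left _ _) hε⟩
  have hbdd : ∀ N, BddBelow (E N) := fun N => ⟨0, fun _ h => h.1⟩
  have hpos : ∀ N, 0 ≤ sInf (E N) := fun N => Real.sInf_nonneg fun _ h => h.1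
  have hone := tendsto_one_div_add_atTop_nhds_zero_nat (𝕜 := ℝ)
  refine ⟨fun N => sInf (E N) + 1 / ((N : ℝ) + 1), ?_, fun N => ?_⟩
  · rw [← add_zero (0 : ℝ)]
    refine Filter.Tendsto.add ?_ hone
    refine tendsto_order.2 ⟨fun a ha => Filter.Eventually.of_forall fun N => ha.trans_le (hpos N),
      fun a ha => ?_⟩
    filter_upwards [h (a / 2) (half_pos ha)] with N hN
    exact (csInf_le (hbdd N) ⟨(half_pos ha).le, hN⟩).trans_lt (half_lt_self ha)
  · obtain ⟨ε, hε, hlt⟩ := exists_lt_of_csInf_lt (hE N)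
      (lt_add_of_pos_right (sInf (E N)) (show (0 : ℝ) < 1 / ((N : ℝ) + 1) by positivity))
    exact hmono hlt.le hε.2

/-- Achievable rate pairs are achieved by a sequence of codes with `N * δ` tending to zero. -/
theorem exists_seq_of_mem_achievableRates {W : X1 → X2 → Y1 × Y2 × Z → ℝ}
    (hW0 : ∀ x1 x2 p, 0 ≤ W x1 x2 p) (hW1 : ∀ x1 x2, ∑ p, W x1 x2 p = 1) [Nonempty X1]
    [Nonempty X2] {r : ℝ × ℝ} (hr : r ∈ achievableRates W) :
    ∃ (f : ℕ → ℝ) (L1 L2 : ℕ → ℕ) (δ : ℕ → ℝ), Filter.Tendsto f Filter.atTop (nhds 0) ∧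
      (∀ N, 0 < L1 N) ∧ (∀ N, 0 < L2 N) ∧
      ∀ N : ℕ, Achieves W N Unit (Fin (L1 N)) (Fin (L2 N)) (δ N) ∧
        |Real.log (L1 N) - N * r.1| ≤ N * f N ∧ |Real.log (L2 N) - N * r.2| ≤ N * f N ∧
        N * δ N ≤ f N := by
  let P : ℝ → ℕ → Prop := fun ε N => ∃ M1 M2 : ℕ, 0 < M1 ∧ 0 < M2 ∧ ∃ δ : ℝ,
    Achieves W N Unit (Fin M1) (Fin M2) δ ∧ |Real.log M1 - N * r.1| ≤ N * ε ∧
      |Real.log M2 - N * r.2| ≤ N * ε ∧ N * δ ≤ ε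
  have hmono : ∀ {ε ε' : ℝ} {N : ℕ}, ε ≤ ε' → P ε N → P ε' N := by
    rintro ε ε' N hε ⟨M1, M2, hM1, hM2, δ, hA, h1, h2, h3⟩
    have : N * ε ≤ N * ε' := by gcongr
    exact ⟨M1, M2, hM1, hM2, δ, hA, h1.trans this, h2.trans this, h3.trans hε⟩
  have h0 : ∀ N : ℕ, ∃ ε, P ε N := by
    refine fun N => ⟨|r.1| + |r.2|, 1, 1, one_pos, one_pos, 0,
      (Achieves.trivial hW0 hW1 N Unit).congr (Equiv.refl _) (Equiv.equivPUnit _)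
        (Equiv.equivPUnit _), ?_, ?_, ?_⟩
    · simp only [Nat.cast_one, Real.log_one, zero_sub, abs_neg, abs_mul, Nat.abs_cast]
      gcongr
      linarith [abs_nonneg r.2]
    · simp only [Nat.cast_one, Real.log_one, zero_sub, abs_neg, abs_mul, Nat.abs_cast]
      gcongr
      linarith [abs_nonneg r.1]
    · rw [mul_zero]
      positivity
  obtain ⟨f, hf, hP⟩ := exists_tendsto_zero_of_eventually (P := P) hmono h0 fun ε hε => hr ε hε
  choose L1 L2 hL1 hL2 δ h using hP
  exact ⟨f, L1, L2, δ, hf, hL1, hL2, h⟩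

theorem tendsto_div_of_abs_sub_le {l f : ℕ → ℝ} {r : ℝ}
    (hf : Filter.Tendsto f Filter.atTop (nhds 0)) (h : ∀ N : ℕ, |l N - N * r| ≤ N * f N) :
    Filter.Tendsto (fun N : ℕ => l N / N) Filter.atTop (nhds r) := by
  rw [tendsto_iff_dist_tendsto_zero]
  refine squeeze_zero' (Filter.Eventually.of_forall fun _ => dist_nonneg) ?_ hf
  filter_upwards [Filter.eventually_gt_atTop 0] with N hN
  have hN' : (0 : ℝ) < N := Nat.cast_pos.2 hN
  rw [Real.dist_eq, show l N / N - r = (l N - N * r) / N by field_simp, abs_div, abs_of_pos hN',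
    div_le_iff₀ hN', mul_comm (f N)]
  exact h N

theorem nonempty_of_sum_eq_one {α : Type*} [Fintype α] {f : α → ℝ} (h : ∑ a, f a = 1) :
    Nonempty α := by
  by_contra hα
  rw [not_nonempty_iff] at hα
  simp at h

theorem InputDist.nonempty_inputs (d : InputDist X1 X2) : Nonempty X1 ∧ Nonempty X2 :=
  ⟨nonempty_of_sum_eq_one (d.PX1_sum (nonempty_of_sum_eq_one d.PV1_sum).some),
    nonempty_of_sum_eq_one (d.PX2_sum (nonempty_of_sum_eq_one d.PV2_sum).some)⟩

/-- If `N * δ N` is dominated by a null sequence, the leakage bound tends to zero. -/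
theorem tendsto_leakage_bound {δ f : ℕ → ℝ} {c : ℝ} (hc : 0 ≤ c) (hδ : ∀ N, 0 ≤ δ N)
    (h : ∀ N : ℕ, N * δ N ≤ f N) (hf : Filter.Tendsto f Filter.atTop (nhds 0)) :
    Filter.Tendsto (fun N : ℕ => (δ N + Real.exp (-N)) * (1 + N * c)) Filter.atTop (nhds 0) := by
  have hq : |Real.exp (-1)| < 1 := by
    rw [abs_of_pos (Real.exp_pos _)]
    exact Real.exp_lt_one_iff.2 (by norm_num)
  have hlim := (hf.mul_const (1 + c)).add
    ((tendsto_pow_const_mul_const_pow_of_abs_lt_one 0 hq).add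
      ((tendsto_pow_const_mul_const_pow_of_abs_lt_one 1 hq).mul_const c))
  rw [zero_mul, zero_mul, add_zero, add_zero] at hlim
  refine squeeze_zero' (Filter.Eventually.of_forall fun N =>
    mul_nonneg (add_nonneg (hδ N) (Real.exp_pos _).le) (by positivity)) ?_ hlim
  filter_upwards [Filter.eventually_ge_atTop 1] with N hN
  have hN' : (1 : ℝ) ≤ N := Nat.one_le_cast.2 hN
  have hδN : δ N ≤ N * δ N := le_mul_of_one_le_left (hδ N) hN'
  have hexp : Real.exp (-1) ^ N = Real.exp (-N) := by
    rw [← Real.exp_nat_mul, mul_neg_one]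
  have hcδ := mul_le_mul_of_nonneg_right (h N) hc
  rw [pow_zero, pow_one, one_mul, hexp]
  linarith [h N]

/-- Every rate pair in the region `ℛ_{J,A}` (closure of the convex hull of the single-
letter regions over all input distributions in `𝒬`) is achievable under the strong joint
secrecy constraint by adaptive codes. -/
theorem achievable_joint_adaptive
    {X1 X2 Y1 Y2 Z : Type*}
    [Fintype X1] [Fintype X2] [Fintype Y1] [Fintype Y2] [Fintype Z]
    (W : X1 → X2 → Y1 × Y2 × Z → ℝ)
    (hW0 : ∀ x1 x2 p, 0 ≤ W x1 x2 p) (hW1 : ∀ x1 x2, ∑ p, W x1 x2 p = 1)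
    (r : ℝ × ℝ)
    (hr : r ∈ closure (convexHull ℝ
      {p : ℝ × ℝ | ∃ d : InputDist X1 X2, 0 ≤ p.1 ∧ 0 ≤ p.2 ∧
        p.1 ≤ cmiDist (pY2V1X2 d.PV1 d.PX1 d.PV2 d.PX2 W) ∧
        p.2 ≤ cmiDist (pY1V2X1 d.PV1 d.PX1 d.PV2 d.PX2 W) ∧
        p.1 + p.2 ≤ cmiDist (pY2V1X2 d.PV1 d.PX1 d.PV2 d.PX2 W) +
          cmiDist (pY1V2X1 d.PV1 d.PX1 d.PV2 d.PX2 W) -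
          miDist (pV12Z d.PV1 d.PX1 d.PV2 d.PX2 W)})) :
    ∃ (L1 L2 : ℕ → ℕ)
      (φ1 : ∀ n, Fin n → Fin (L1 n) → (Fin n → X1) → (Fin n → Y1) → X1 → ℝ)
      (φ2 : ∀ n, Fin n → Fin (L2 n) → (Fin n → X2) → (Fin n → Y2) → X2 → ℝ)
      (ψ1 : ∀ n, Fin (L1 n) → (Fin n → X1) → (Fin n → Y1) → Fin (L2 n))
      (ψ2 : ∀ n, Fin (L2 n) → (Fin n → X2) → (Fin n → Y2) → Fin (L1 n)),
      (∀ n, Causal n (L1 n) (φ1 n)) ∧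
      (∀ n, Causal n (L2 n) (φ2 n)) ∧
      (∀ n k m xs ys, (∀ a, 0 ≤ φ1 n k m xs ys a) ∧ ∑ a, φ1 n k m xs ys a = 1) ∧
      (∀ n k m xs ys, (∀ a, 0 ≤ φ2 n k m xs ys a) ∧ ∑ a, φ2 n k m xs ys a = 1) ∧
      Filter.Tendsto (fun n => Real.log (L1 n) / (n : ℝ)) Filter.atTop (nhds r.1) ∧
      Filter.Tendsto (fun n => Real.log (L2 n) / (n : ℝ)) Filter.atTop (nhds r.2) ∧
      Filter.Tendsto (fun n => PeA n (L1 n) (L2 n) W (φ1 n) (φ2 n) (ψ1 n) (ψ2 n))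
        Filter.atTop (nhds 0) ∧
      Filter.Tendsto (fun n => leakJointA n (L1 n) (L2 n) W (φ1 n) (φ2 n))
        Filter.atTop (nhds 0) := by
  have hXU : ({p : ℝ × ℝ | ∃ d : InputDist X1 X2, 0 ≤ p.1 ∧ 0 ≤ p.2 ∧
        p.1 ≤ cmiDist (pY2V1X2 d.PV1 d.PX1 d.PV2 d.PX2 W) ∧
        p.2 ≤ cmiDist (pY1V2X1 d.PV1 d.PX1 d.PV2 d.PX2 W) ∧
        p.1 + p.2 ≤ cmiDist (pY2V1X2 d.PV1 d.PX1 d.PV2 d.PX2 W) +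
          cmiDist (pY1V2X1 d.PV1 d.PX1 d.PV2 d.PX2 W) -
          miDist (pV12Z d.PV1 d.PX1 d.PV2 d.PX2 W)}).Nonempty :=
    convexHull_nonempty_iff.1 (closure_nonempty_iff.1 ⟨r, hr⟩)
  obtain ⟨_, d₀, _⟩ := hXU
  obtain ⟨_, _⟩ := d₀.nonempty_inputs
  have : Nonempty Z := (nonempty_of_sum_eq_one (hW1 (Classical.arbitrary X1)
    (Classical.arbitrary X2))).map fun p => p.2.2
  have hr' : r ∈ achievableRates W := by
    refine closure_minimal (convexHull_min ?_ (convex_achievableRates hW0 hW1))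
      (isClosed_achievableRates W) hr
    rintro p ⟨d, hp1, hp2, h1, h2, h12⟩
    rw [d.cmiDist_pY2V1X2 hW0 hW1] at h1 h12
    rw [d.cmiDist_pY1V2X1 hW0 hW1] at h2 h12
    rw [d.miDist_pV12Z hW1] at h12
    exact d.mem_achievableRates hW0 hW1 hp1 hp2 h1 h2 h12
  obtain ⟨f, L1, L2, δ, hf, hL1, hL2, h⟩ := exists_seq_of_mem_achievableRates hW0 hW1 hr'
  have hcode := fun N : ℕ =>
    haveI : NeZero (L1 N) := ⟨(hL1 N).ne'⟩
    haveI : NeZero (L2 N) := ⟨(hL2 N).ne'⟩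
    (h N).1.exists_code hW0 hW1
  choose φ1 φ2 ψ1 ψ2 hc1 hc2 hp1 hp2 hPe hleak0 hleak using hcode
  have hδ : ∀ N, 0 ≤ δ N := fun N =>
    haveI := Fin.pos_iff_nonempty.1 (hL1 N)
    haveI := Fin.pos_iff_nonempty.1 (hL2 N)
    (h N).1.error_nonneg
  refine ⟨L1, L2, φ1, φ2, ψ1, ψ2, hc1, hc2, hp1, hp2,
    tendsto_div_of_abs_sub_le hf fun N => (h N).2.1,
    tendsto_div_of_abs_sub_le hf fun N => (h N).2.2.1, ?_, ?_⟩
  · have hf2 := hf.const_mul 2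
    rw [mul_zero] at hf2
    refine squeeze_zero' (Filter.Eventually.of_forall fun N => PeA_nonneg hW0
      (fun k m xs ys => (hp1 N k m xs ys).1) (fun k m xs ys => (hp2 N k m xs ys).1) _ _) ?_ hf2
    filter_upwards [Filter.eventually_ge_atTop 1] with N hN
    have hδN := le_mul_of_one_le_left (hδ N) (Nat.one_le_cast.2 hN)
    linarith [hPe N, (h N).2.2.2]
  · have hZ : 0 ≤ Real.log (Fintype.card Z) + 1 :=
      add_nonneg (Real.log_nonneg (by exact_mod_cast Fintype.card_pos)) zero_le_one
    exact squeeze_zero hleak0 hleak (tendsto_leakage_bound hZ hδ (fun N => (h N).2.2.2) hf)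

end
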